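/- (Key inequality) Let ω > 0, let (φ_ω,ψ_ω) be a ground state, and let (u,v) ∈ ℬ_ω, i.e., (u,v) ∈ H¹×H¹ \ {(0,0)} with S_ω(u,v) < S_ω(φ_ω,ψ_ω) and Q(u,v) < 0. Then Q(u,v) ≤ 2 (S_ω(u,v) − S_ω(φ_ω,ψ_ω)). -/

import Mathlib

open MeasureTheory Complex Filter
open scoped ENNReal NNReal

noncomputable section

abbrev E5 := EuclideanSpace ℝ (Fin 5)

/-- Membership in `H¹(ℝ⁵, ℂ)`: `u ∈ L²` with (weak) gradient in `L²`. -/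
def InH1 (u : E5 → ℂ) : Prop :=
  MemLp u 2 (volume : Measure E5) ∧ Differentiable ℝ u ∧
    MemLp (fun x => fderiv ℝ u x) 2 (volume : Measure E5)

/-- Squared `H¹` norm. -/
def H1normSq (u : E5 → ℂ) : ℝ :=
  (∫ x : E5, ‖u x‖ ^ 2) + ∫ x : E5, ‖fderiv ℝ u x‖ ^ 2

/-- The kinetic functional `K(u,v) = ‖∇u‖² + (1/2)‖∇v‖²`. -/
def Kin (u v : E5 → ℂ) : ℝ :=
  (∫ x : E5, ‖fderiv ℝ u x‖ ^ 2) + (1 / 2) * ∫ x : E5, ‖fderiv ℝ v x‖ ^ 2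

/-- The mass functional `M(u,v) = ‖u‖² + 2‖v‖²`. -/
def Mass (u v : E5 → ℂ) : ℝ :=
  (∫ x : E5, ‖u x‖ ^ 2) + 2 * ∫ x : E5, ‖v x‖ ^ 2

/-- The interaction functional `P(u,v) = Re ∫ conj v · u²`. -/
def Pot (u v : E5 → ℂ) : ℝ :=
  ∫ x : E5, ((starRingEnd ℂ) (v x) * (u x) ^ 2).re

/-- The action functional `S_ω`. -/
def Sfun (ω : ℝ) (u v : E5 → ℂ) : ℝ :=
  (1 / 2) * Kin u v + (ω / 2) * Mass u v - Pot u v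

/-- The Nehari functional `K_ω`. -/
def Nehari (ω : ℝ) (u v : E5 → ℂ) : ℝ :=
  Kin u v + ω * Mass u v - 3 * Pot u v

/-- The energy `E(u,v) = (1/2)K(u,v) − P(u,v)`. -/
def Efun (u v : E5 → ℂ) : ℝ := (1 / 2) * Kin u v - Pot u v

/-- The virial functional `Q(u,v) = K(u,v) − (5/2)P(u,v)`. -/
def Qfun (u v : E5 → ℂ) : ℝ := Kin u v - (5 / 2) * Pot u v

/-- Nontriviality of a pair. -/
def Nontriv2 (u v : E5 → ℂ) : Prop := ¬(u = 0 ∧ v = 0)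

/-- The infimum `d(ω)` of `S_ω` on the Nehari manifold. -/
def dmin (ω : ℝ) : ℝ :=
  sInf {s : ℝ | ∃ u v : E5 → ℂ, InH1 u ∧ InH1 v ∧ Nontriv2 u v ∧
    Nehari ω u v = 0 ∧ s = Sfun ω u v}

/-- Laplacian of a complex-valued function on `ℝ⁵`. -/
def lap (u : E5 → ℂ) (x : E5) : ℂ :=
  ∑ i : Fin 5,
    fderiv ℝ (fun y => fderiv ℝ u y (EuclideanSpace.single i (1 : ℝ))) x
      (EuclideanSpace.single i (1 : ℝ))

/-- `(φ,ψ)` is an `H¹` solution of the elliptic system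
`−Δφ + ωφ = 2ψ conj φ`, `−(1/2)Δψ + 2ωψ = φ²`. -/
def IsEllSol (ω : ℝ) (φ ψ : E5 → ℂ) : Prop :=
  InH1 φ ∧ InH1 ψ ∧
  (∀ x, -lap φ x + (ω : ℂ) * φ x = 2 * ψ x * (starRingEnd ℂ) (φ x)) ∧
  (∀ x, -(1 / 2 : ℂ) * lap ψ x + (2 * ω : ℂ) * ψ x = (φ x) ^ 2)

/-- A ground state: a nontrivial solution of the elliptic system minimizing
`S_ω` among all nontrivial solutions. -/
def IsGroundState (ω : ℝ) (φ ψ : E5 → ℂ) : Prop :=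
  IsEllSol ω φ ψ ∧ Nontriv2 φ ψ ∧
    ∀ u v : E5 → ℂ, IsEllSol ω u v → Nontriv2 u v → Sfun ω φ ψ ≤ Sfun ω u v

/-- The `L²`-invariant scaling `u^γ(x) = γ^{5/2} u(γ x)`. -/
def scaleFn (γ : ℝ) (u : E5 → ℂ) : E5 → ℂ :=
  fun x => ((γ ^ ((5 : ℝ) / 2) : ℝ) : ℂ) * u (γ • x)

/-- Finite variance. -/
def FinVar (u : E5 → ℂ) : Prop :=
  Integrable (fun x : E5 => ‖x‖ ^ 2 * ‖u x‖ ^ 2) (volume : Measure E5)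

/-- `(u,v)` solves the evolution system `i∂_t u + Δu = −2v conj u`,
`i∂_t v + (1/2)Δv = −u²` on the time set `I`, staying in `H¹ × H¹`. -/
def IsEvolSol (u v : ℝ → E5 → ℂ) (I : Set ℝ) : Prop :=
  (∀ t ∈ I, InH1 (u t) ∧ InH1 (v t)) ∧
  (∀ t ∈ I, ∀ x : E5,
    Complex.I * deriv (fun s => u s x) t + lap (u t) x
      = -2 * v t x * (starRingEnd ℂ) (u t x)) ∧
  (∀ t ∈ I, ∀ x : E5,
    Complex.I * deriv (fun s => v s x) t + (1 / 2 : ℂ) * lap (v t) x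
      = -(u t x) ^ 2)

/-- The time set `[0, T)` for `T : ℝ≥0∞`. -/
def timeSet (T : ℝ≥0∞) : Set ℝ := {t : ℝ | 0 ≤ t ∧ ENNReal.ofReal t < T}

/-- Conservation of mass and energy on a time set. -/
def Conserves (u v : ℝ → E5 → ℂ) (I : Set ℝ) : Prop :=
  (∀ t ∈ I, Mass (u t) (v t) = Mass (u 0) (v 0)) ∧
  (∀ t ∈ I, Efun (u t) (v t) = Efun (u 0) (v 0))

/-- Membership in the blow-up set `ℬ_ω` associated with a ground state `(φ,ψ)`. -/
def InBset (ω : ℝ) (φ ψ u v : E5 → ℂ) : Prop :=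
  InH1 u ∧ InH1 v ∧ Nontriv2 u v ∧ Sfun ω u v < Sfun ω φ ψ ∧ Qfun u v < 0

/-- A maximal solution of the evolution system on `[0,T)` with given data,
conserving mass and energy. -/
def IsMaximalSol (u v : ℝ → E5 → ℂ) (T : ℝ≥0∞) (u₀ v₀ : E5 → ℂ) : Prop :=
  0 < T ∧ u 0 = u₀ ∧ v 0 = v₀ ∧ IsEvolSol u v (timeSet T) ∧
    Conserves u v (timeSet T) ∧
    ∀ (u' v' : ℝ → E5 → ℂ) (T' : ℝ≥0∞),
      IsEvolSol u' v' (timeSet T') → Conserves u' v' (timeSet T') →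
      (∀ t ∈ timeSet T, u' t = u t ∧ v' t = v t) → u' 0 = u₀ → v' 0 = v₀ →
        T' ≤ T

/-- Blow-up in finite time: the maximal time is finite and the `H¹ × H¹` norm
tends to infinity as `t` approaches it from below. -/
def BlowsUp (u v : ℝ → E5 → ℂ) (T : ℝ≥0∞) : Prop :=
  T ≠ ⊤ ∧ Tendsto (fun t : ℝ => Real.sqrt (H1normSq (u t) + H1normSq (v t)))
    (nhdsWithin T.toReal (Set.Iio T.toReal)) atTop

end

open MeasureTheory Complex Filter
open scoped ENNReal

open scoped NNReal Pointwise Topology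

/-- One-dimensional Brunn–Minkowski inequality. -/
theorem volume_add_volume_le_of_add_mem {A B S : Set ℝ} (hA : MeasurableSet A)
    (hB : MeasurableSet B) (hA0 : A.Nonempty) (hB0 : B.Nonempty)
    (hS : ∀ x ∈ A, ∀ y ∈ B, x + y ∈ S) : volume A + volume B ≤ volume S := by
  have key : ∀ K L : Set ℝ, IsCompact K → IsCompact L → K.Nonempty → L.Nonempty → K ⊆ A →
      L ⊆ B → volume K + volume L ≤ volume S := by
    intro K L hK hL hK0 hL0 hKA hLB
    obtain ⟨a, ha⟩ := hK.exists_isGreatest hK0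
    obtain ⟨b, hb⟩ := hL.exists_isLeast hL0
    have h1 : volume ((fun x => x + b) '' K) = volume K := by
      simp
    have h2 : volume ((fun x => a + x) '' L) = volume L := by
      simp
    have hd : AEDisjoint volume ((fun x => x + b) '' K) ((fun x => a + x) '' L) := by
      refine measure_mono_null (t := {a + b}) ?_ (by simp)
      rintro z ⟨⟨x, hx, rfl⟩, ⟨y, hy, hxy⟩⟩
      have := ha.2 hx
      have := hb.2 hy
      simp only [Set.mem_singleton_iff]
      simp only at hxy
      linarith
    have hm : MeasurableSet ((fun x => a + x) '' L) :=
      (hL.image (by fun_prop)).measurableSet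
    rw [← h1, ← h2, ← measure_union₀ hm.nullMeasurableSet hd]
    refine measure_mono ?_
    rintro z (⟨x, hx, rfl⟩ | ⟨y, hy, rfl⟩)
    · exact hS _ (hKA hx) _ (hLB hb.1)
    · exact hS _ (hKA ha.1) _ (hLB hy)
  obtain ⟨x0, hx0⟩ := hA0
  obtain ⟨y0, hy0⟩ := hB0
  rw [hA.measure_eq_iSup_isCompact, hB.measure_eq_iSup_isCompact]
  simp only [iSup_and']
  refine ENNReal.biSup_add_biSup_le' ⟨∅, by simp⟩ ⟨∅, by simp⟩ ?_
  rintro K ⟨hKA, hK⟩ L ⟨hLB, hL⟩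
  refine le_trans (add_le_add (measure_mono (Set.subset_insert x0 K))
    (measure_mono (Set.subset_insert y0 L))) ?_
  exact key _ _ (hK.insert _) (hL.insert _) (Set.insert_nonempty _ _) (Set.insert_nonempty _ _)
    (Set.insert_subset hx0 hKA) (Set.insert_subset hy0 hLB)

/-- One-dimensional Brunn–Minkowski inequality for convex combinations. -/
theorem mul_volume_add_mul_volume_le {A B S : Set ℝ} (hA : MeasurableSet A)
    (hB : MeasurableSet B) (hA0 : A.Nonempty) (hB0 : B.Nonempty) {a b : ℝ} (ha : 0 < a)
    (hb : 0 < b) (hS : ∀ x ∈ A, ∀ y ∈ B, a * x + b * y ∈ S) :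
    ENNReal.ofReal a * volume A + ENNReal.ofReal b * volume B ≤ volume S := by
  have h := volume_add_volume_le_of_add_mem (A := a • A) (B := b • B) (S := S)
    (hA.const_smul₀ a) (hB.const_smul₀ b) (hA0.smul_set) (hB0.smul_set) (by
      rintro _ ⟨x, hx, rfl⟩ _ ⟨y, hy, rfl⟩
      exact hS x hx y hy)
  rw [Measure.addHaar_smul, Measure.addHaar_smul] at h
  simpa [abs_of_pos ha, abs_of_pos hb] using h

/-- Prékopa–Leindler on the line for functions with supremum one. -/
theorem lintegral_add_le_of_iSup_eq_one {f g h : ℝ → ℝ} (hf : Measurable f) (hg : Measurable g)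
    (hh : Measurable h) (hf0 : ∀ x, 0 ≤ f x) (hg0 : ∀ x, 0 ≤ g x) (hh0 : ∀ x, 0 ≤ h x)
    (hf1 : ∀ x, f x ≤ 1) (hg1 : ∀ x, g x ≤ 1)
    (hf1' : ∀ t < 1, ∃ x, t < f x) (hg1' : ∀ t < 1, ∃ x, t < g x)
    {a b : ℝ} (ha : 0 < a) (hb : 0 < b)
    (H : ∀ x y t, 0 < t → t < f x → t < g y → t < h (a * x + b * y)) :
    ENNReal.ofReal a * (∫⁻ x, ENNReal.ofReal (f x)) +
        ENNReal.ofReal b * (∫⁻ x, ENNReal.ofReal (g x))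
      ≤ ∫⁻ x, ENNReal.ofReal (h x) := by
  rw [lintegral_eq_lintegral_meas_lt _ (ae_of_all _ hf0) hf.aemeasurable,
    lintegral_eq_lintegral_meas_lt _ (ae_of_all _ hg0) hg.aemeasurable,
    lintegral_eq_lintegral_meas_lt _ (ae_of_all _ hh0) hh.aemeasurable]
  have hmeas : ∀ F : ℝ → ℝ, Measurable fun t => volume {x | t < F x} := fun F =>
    (show Antitone fun t => volume {x | t < F x} from
      fun s t hst => measure_mono fun x (hx : t < F x) => lt_of_le_of_lt hst hx).measurable
  rw [← lintegral_const_mul _ (hmeas f), ← lintegral_const_mul _ (hmeas g),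
    ← lintegral_add_left ((hmeas f).const_mul _)]
  refine setLIntegral_mono' measurableSet_Ioi fun t ht0 => ?_
  rcases lt_or_ge t 1 with ht | ht
  · exact mul_volume_add_mul_volume_le (hf measurableSet_Ioi) (hg measurableSet_Ioi)
      (hf1' t ht) (hg1' t ht) ha hb fun x hx y hy => H x y t ht0 hx hy
  · have e1 : {x | t < f x} = ∅ := by
      ext x; simpa using (hf1 x).trans ht
    have e2 : {x | t < g x} = ∅ := by
      ext x; simpa using (hg1 x).trans ht
    simp [e1, e2]

theorem ENNReal.rpow_mul_rpow_le_add (x y : ℝ≥0∞) {a b : ℝ} (ha : 0 < a) (hb : 0 < b)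
    (hab : a + b = 1) :
    x ^ a * y ^ b ≤ ENNReal.ofReal a * x + ENNReal.ofReal b * y := by
  have hx := ENNReal.young_inequality (x ^ a) (y ^ b)
    (p := a⁻¹) (q := b⁻¹) (Real.HolderConjugate.inv_inv ha hb hab)
  rw [← ENNReal.rpow_mul, ← ENNReal.rpow_mul, mul_inv_cancel₀ ha.ne', mul_inv_cancel₀ hb.ne',
    ENNReal.rpow_one, ENNReal.rpow_one] at hx
  rwa [ENNReal.ofReal_inv_of_pos ha, ENNReal.ofReal_inv_of_pos hb, ENNReal.div_eq_inv_mul,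
    ENNReal.div_eq_inv_mul, inv_inv, inv_inv] at hx

/-- Prékopa–Leindler on the line for bounded functions. -/
theorem prekopa_leindler_real_of_bounded {f g h : ℝ → ℝ≥0∞} (hf : Measurable f) (hg : Measurable g)
    (hh : Measurable h) (hfb : (⨆ x, f x) ≠ ∞) (hgb : (⨆ x, g x) ≠ ∞)
    {a b : ℝ} (ha : 0 < a) (hb : 0 < b) (hab : a + b = 1)
    (H : ∀ x y, f x ^ a * g y ^ b ≤ h (a * x + b * y)) :
    (∫⁻ x, f x) ^ a * (∫⁻ x, g x) ^ b ≤ ∫⁻ x, h x := by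
  set M := ⨆ x, f x with hM
  set N := ⨆ x, g x with hN
  rcases eq_or_ne M 0 with hM0 | hM0
  · have : ∀ x, f x = 0 := by simpa [hM, ENNReal.iSup_eq_zero] using hM0
    simp [this, ha]
  rcases eq_or_ne N 0 with hN0 | hN0
  · have : ∀ x, g x = 0 := by simpa [hN, ENNReal.iSup_eq_zero] using hN0
    simp [this, hb]
  set C := M ^ a * N ^ b with hC
  have hMa0 : M ^ a ≠ 0 := by simp [hM0, hfb]
  have hNb0 : N ^ b ≠ 0 := by simp [hN0, hgb]
  have hMa : M ^ a ≠ ∞ := ENNReal.rpow_ne_top_of_nonneg ha.le hfb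
  have hNb : N ^ b ≠ ∞ := ENNReal.rpow_ne_top_of_nonneg hb.le hgb
  have hC0 : C ≠ 0 := mul_ne_zero hMa0 hNb0
  have hCt : C ≠ ∞ := ENNReal.mul_ne_top hMa hNb
  have hf1 : ∀ x, f x / M ≤ 1 := fun x => ENNReal.div_le_of_le_mul (by simpa using le_iSup f x)
  have hg1 : ∀ x, g x / N ≤ 1 := fun x => ENNReal.div_le_of_le_mul (by simpa using le_iSup g x)
  have hh1 : ∀ x, min (h x / C) 1 ≠ ∞ := fun x => ne_top_of_le_ne_top ENNReal.one_ne_top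
    (min_le_right _ _)
  have hft : ∀ x, f x / M ≠ ∞ := fun x => ne_top_of_le_ne_top ENNReal.one_ne_top (hf1 x)
  have hgt : ∀ x, g x / N ≠ ∞ := fun x => ne_top_of_le_ne_top ENNReal.one_ne_top (hg1 x)
  have sup1 : ∀ (F : ℝ → ℝ≥0∞), (⨆ x, F x) ≠ ∞ → (⨆ x, F x) ≠ 0 → ∀ t < (1 : ℝ),
      ∃ x, t < (F x / ⨆ x, F x).toReal := by
    intro F hF hF0 t ht
    have : ENNReal.ofReal (max t 0) * (⨆ x, F x) < ⨆ x, F x := by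
      conv_rhs => rw [← one_mul (⨆ x, F x)]
      exact ENNReal.mul_lt_mul_left hF0 hF (by simpa using ht)
    obtain ⟨x, hx⟩ := lt_iSup_iff.1 this
    refine ⟨x, lt_of_le_of_lt (le_max_left t 0) ?_⟩
    rw [← ENNReal.ofReal_lt_iff_lt_toReal (le_max_right _ _)
      (ENNReal.div_ne_top (ne_top_of_le_ne_top hF (le_iSup F x)) hF0)]
    exact (ENNReal.lt_div_iff_mul_lt (Or.inl hF0) (Or.inl hF)).2 hx
  have main := lintegral_add_le_of_iSup_eq_one (f := fun x => (f x / M).toReal)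
    (g := fun x => (g x / N).toReal) (h := fun x => (min (h x / C) 1).toReal)
    (hf.div_const M).ennreal_toReal (hg.div_const N).ennreal_toReal
    ((hh.div_const C).min measurable_const).ennreal_toReal
    (fun _ => ENNReal.toReal_nonneg) (fun _ => ENNReal.toReal_nonneg)
    (fun _ => ENNReal.toReal_nonneg)
    (fun x => ENNReal.toReal_le_of_le_ofReal zero_le_one (by simpa using hf1 x))
    (fun x => ENNReal.toReal_le_of_le_ofReal zero_le_one (by simpa using hg1 x))
    (sup1 f hfb hM0) (sup1 g hgb hN0) ha hb (by
      intro x y t ht h1 h2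
      rw [← ENNReal.ofReal_lt_iff_lt_toReal ht.le (hft x)] at h1
      rw [← ENNReal.ofReal_lt_iff_lt_toReal ht.le (hgt y)] at h2
      rw [← ENNReal.ofReal_lt_iff_lt_toReal ht.le (hh1 _)]
      refine lt_min ?_ (h1.trans_le (hf1 x))
      calc ENNReal.ofReal t = ENNReal.ofReal t ^ a * ENNReal.ofReal t ^ b := by
            rw [← ENNReal.rpow_add _ _ (by simpa using ht) ENNReal.ofReal_ne_top, hab,
              ENNReal.rpow_one]
        _ < (f x / M) ^ a * (g y / N) ^ b := by
            exact ENNReal.mul_lt_mul (ENNReal.rpow_lt_rpow h1 ha) (ENNReal.rpow_lt_rpow h2 hb)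
        _ = f x ^ a * g y ^ b / C := by
            rw [ENNReal.div_rpow_of_nonneg _ _ ha.le, ENNReal.div_rpow_of_nonneg _ _ hb.le,
              ENNReal.div_eq_inv_mul, ENNReal.div_eq_inv_mul, ENNReal.div_eq_inv_mul, hC,
              ENNReal.mul_inv (Or.inl hMa0) (Or.inl hMa)]
            ring
        _ ≤ _ := ENNReal.div_le_div_right (H x y) _)
  simp only [ENNReal.ofReal_toReal (hft _), ENNReal.ofReal_toReal (hgt _),
    ENNReal.ofReal_toReal (hh1 _)] at main
  have main2 := (ENNReal.rpow_mul_rpow_le_add _ _ ha hb hab).trans main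
  have hle : ∫⁻ x, min (h x / C) 1 ≤ (∫⁻ x, h x) / C := by
    rw [ENNReal.div_eq_inv_mul, ← lintegral_const_mul _ hh]
    exact lintegral_mono fun x => (min_le_left _ _).trans (by rw [ENNReal.div_eq_inv_mul])
  have main3 := main2.trans hle
  simp only [ENNReal.div_eq_inv_mul] at main3
  rw [lintegral_const_mul _ hf, lintegral_const_mul _ hg, ENNReal.mul_rpow_of_nonneg _ _ ha.le,
    ENNReal.mul_rpow_of_nonneg _ _ hb.le, ENNReal.inv_rpow, ENNReal.inv_rpow] at main3
  calc (∫⁻ x, f x) ^ a * (∫⁻ x, g x) ^ b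
      = C * ((M ^ a)⁻¹ * (∫⁻ x, f x) ^ a * ((N ^ b)⁻¹ * (∫⁻ x, g x) ^ b)) := by
        rw [show C * ((M ^ a)⁻¹ * (∫⁻ x, f x) ^ a * ((N ^ b)⁻¹ * (∫⁻ x, g x) ^ b)) =
          (M ^ a * (M ^ a)⁻¹) * (N ^ b * (N ^ b)⁻¹) * ((∫⁻ x, f x) ^ a * (∫⁻ x, g x) ^ b) by
            rw [hC]; ring, ENNReal.mul_inv_cancel hMa0 hMa, ENNReal.mul_inv_cancel hNb0 hNb]
        simp
    _ ≤ C * (C⁻¹ * ∫⁻ x, h x) := by gcongr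
    _ = ∫⁻ x, h x := by rw [← mul_assoc, ENNReal.mul_inv_cancel hC0 hCt, one_mul]

/-- Prékopa–Leindler on the line. -/
theorem prekopa_leindler_real {f g h : ℝ → ℝ≥0∞} (hf : Measurable f) (hg : Measurable g)
    (hh : Measurable h) {a b : ℝ} (ha : 0 < a) (hb : 0 < b) (hab : a + b = 1)
    (H : ∀ x y, f x ^ a * g y ^ b ≤ h (a * x + b * y)) :
    (∫⁻ x, f x) ^ a * (∫⁻ x, g x) ^ b ≤ ∫⁻ x, h x := by
  have lim : ∀ F : ℝ → ℝ≥0∞, Measurable F →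
      Tendsto (fun n : ℕ => ∫⁻ x, min (F x) n) atTop (nhds (∫⁻ x, F x)) := by
    intro F hF
    refine lintegral_tendsto_of_tendsto_of_monotone
      (fun n => (hF.min measurable_const).aemeasurable) ?_ ?_
    · exact ae_of_all _ fun x m n hmn => min_le_min le_rfl (by exact_mod_cast hmn)
    · refine ae_of_all _ fun x => ?_
      simpa using (tendsto_const_nhds (x := F x)).min ENNReal.tendsto_nat_nhds_top
  have bdd : ∀ F : ℝ → ℝ≥0∞, ∀ n : ℕ, (⨆ x, min (F x) n) ≠ ∞ := fun F n =>
    ne_top_of_le_ne_top (ENNReal.natCast_ne_top n) (iSup_le fun x => min_le_right _ _)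
  have hm : ∀ m n : ℕ, (∫⁻ x, min (f x) m) ^ a * (∫⁻ x, min (g x) n) ^ b ≤ ∫⁻ x, h x :=
    fun m n => prekopa_leindler_real_of_bounded (hf.min measurable_const)
      (hg.min measurable_const) hh (bdd f m) (bdd g n) ha hb hab fun x y =>
        (mul_le_mul' (ENNReal.rpow_le_rpow (min_le_left _ _) ha.le)
          (ENNReal.rpow_le_rpow (min_le_left _ _) hb.le)).trans (H x y)
  have hsup : ∀ F : ℝ → ℝ≥0∞, Measurable F → (∫⁻ x, F x) = ⨆ n : ℕ, ∫⁻ x, min (F x) n := by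
    intro F hF
    refine tendsto_nhds_unique (lim F hF) (tendsto_atTop_iSup fun m n hmn => ?_)
    exact lintegral_mono fun x => min_le_min le_rfl (by exact_mod_cast hmn)
  rw [hsup f hf, hsup g hg, (ENNReal.monotone_rpow_of_nonneg ha.le).map_iSup_of_continuousAt
    ENNReal.continuous_rpow_const.continuousAt (by simp [ha]),
    (ENNReal.monotone_rpow_of_nonneg hb.le).map_iSup_of_continuousAt
    ENNReal.continuous_rpow_const.continuousAt (by simp [hb]), ENNReal.iSup_mul]
  refine iSup_le fun m => ?_
  rw [ENNReal.mul_iSup]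
  exact iSup_le fun n => hm m n

/-- The Prékopa–Leindler inequality. -/
theorem prekopa_leindler (n : ℕ) {f g h : (Fin n → ℝ) → ℝ≥0∞} (hf : Measurable f)
    (hg : Measurable g) (hh : Measurable h) {a b : ℝ} (ha : 0 < a) (hb : 0 < b) (hab : a + b = 1)
    (H : ∀ x y, f x ^ a * g y ^ b ≤ h (a • x + b • y)) :
    (∫⁻ x, f x) ^ a * (∫⁻ x, g x) ^ b ≤ ∫⁻ x, h x := by
  induction n with
  | zero =>
    have e : ∀ F : (Fin 0 → ℝ) → ℝ≥0∞, ∫⁻ x, F x = F 0 := by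
      intro F
      rw [lintegral_unique]
      simp [volume_pi]
      exact congrArg F (Subsingleton.elim _ _)
    rw [e, e, e]
    simpa using H 0 0
  | succ n ih =>
    have e : ∀ F : (Fin (n + 1) → ℝ) → ℝ≥0∞, Measurable F →
        ∫⁻ x, F x = ∫⁻ s : ℝ, ∫⁻ x : Fin n → ℝ, F (Fin.cons s x) := by
      intro F hF
      rw [← (volume_preserving_piFinSuccAbove (fun _ : Fin (n + 1) => ℝ) 0).symm.lintegral_comp hF,
        Measure.volume_eq_prod,
        lintegral_prod (fun p => F ((MeasurableEquiv.piFinSuccAbove (fun _ => ℝ) 0).symm p))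
          (hF.comp (MeasurableEquiv.measurable _)).aemeasurable]
      simp [MeasurableEquiv.piFinSuccAbove_symm_apply, Fin.insertNthEquiv]
    have hc : Measurable fun p : ℝ × (Fin n → ℝ) => (Fin.cons p.1 p.2 : Fin (n + 1) → ℝ) := by
      refine measurable_pi_lambda _ fun i => ?_
      refine Fin.cases ?_ (fun j => ?_) i
      · simpa using measurable_fst
      · simpa using! (measurable_pi_apply j).comp measurable_snd
    rw [e f hf, e g hg, e h hh]
    have hs : ∀ F : (Fin (n + 1) → ℝ) → ℝ≥0∞, Measurable F →
        Measurable fun s : ℝ => ∫⁻ x : Fin n → ℝ, F (Fin.cons s x) := fun F hF =>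
      (hF.comp hc).lintegral_prod_right'
    refine prekopa_leindler_real (hs f hf) (hs g hg) (hs h hh) ha hb hab fun s t => ?_
    have hsl : ∀ (F : (Fin (n + 1) → ℝ) → ℝ≥0∞) (s : ℝ), Measurable F →
        Measurable fun x : Fin n → ℝ => F (Fin.cons s x) := fun F s hF =>
      hF.comp (hc.comp measurable_prodMk_left)
    refine ih (hsl f s hf) (hsl g t hg) (hsl h _ hh) fun x y => ?_
    convert H (Fin.cons s x) (Fin.cons t y) using 2
    ext i
    refine Fin.cases ?_ (fun j => ?_) i <;> simp

/-- The multiplicative Brunn–Minkowski inequality in Euclidean space. -/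
theorem volume_rpow_mul_volume_rpow_le {n : ℕ} {A B S : Set (EuclideanSpace ℝ (Fin n))}
    (hA : MeasurableSet A) (hB : MeasurableSet B) (hSm : MeasurableSet S) {a b : ℝ} (ha : 0 < a)
    (hb : 0 < b) (hab : a + b = 1) (hS : ∀ x ∈ A, ∀ y ∈ B, a • x + b • y ∈ S) :
    volume A ^ a * volume B ^ b ≤ volume S := by
  have e : ∀ T : Set (EuclideanSpace ℝ (Fin n)), MeasurableSet T →
      volume T = ∫⁻ x : Fin n → ℝ, T.indicator 1 (WithLp.toLp 2 x) := by
    intro T hT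
    rw [(PiLp.volume_preserving_toLp (Fin n)).lintegral_comp (measurable_one.indicator hT),
      lintegral_indicator_one hT]
  have hm : ∀ T : Set (EuclideanSpace ℝ (Fin n)), MeasurableSet T →
      Measurable fun x : Fin n → ℝ => T.indicator (1 : EuclideanSpace ℝ (Fin n) → ℝ≥0∞) (WithLp.toLp 2 x) :=
    fun T hT => (measurable_one.indicator hT).comp (PiLp.volume_preserving_toLp (Fin n)).measurable
  rw [e A hA, e B hB, e S hSm]
  refine prekopa_leindler n (hm A hA) (hm B hB) (hm S hSm) ha hb hab fun x y => ?_
  by_cases hx : WithLp.toLp 2 x ∈ A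
  · by_cases hy : WithLp.toLp 2 y ∈ B
    · have : WithLp.toLp 2 (a • x + b • y) ∈ S := by simpa using hS _ hx _ hy
      rw [Set.indicator_of_mem hx, Set.indicator_of_mem hy, Set.indicator_of_mem this]
      simp
    · simp [hy, hb]
  · simp [hx, ha]

/-- Isoperimetric form of the Brunn–Minkowski inequality: the volume of the `h`-thickening of
an open set of finite measure. -/
theorem volume_thickening_ge {A : Set (E5)} (hA : IsOpen A)
    (hfin : volume A ≠ ∞) {h : ℝ} (hh : 0 < h) (hfin' : volume (Metric.thickening h A) ≠ ∞) :
    volume.real A + 5 * h *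
      ((volume.real (Metric.ball (0 : E5) 1)) ^ (1 / 5 : ℝ)) *
        (volume.real A) ^ (4 / 5 : ℝ) ≤ volume.real (Metric.thickening h A) := by
  set κ := (volume.real (Metric.ball (0 : E5) 1)) ^ (1 / 5 : ℝ) with hκ
  have hB1 : 0 < volume.real (Metric.ball (0 : E5) 1) :=
    ENNReal.toReal_pos (Metric.measure_ball_pos _ _ one_pos).ne' measure_ball_lt_top.ne
  have hκ5 : κ ^ 5 = volume.real (Metric.ball (0 : E5) 1) := by
    rw [hκ, ← Real.rpow_natCast, ← Real.rpow_mul hB1.le]; norm_num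
  have hκ0 : 0 < κ := Real.rpow_pos_of_pos hB1 _
  rcases eq_or_lt_of_le (measureReal_nonneg (μ := volume) (s := A)) with h0 | hpos
  · rw [← h0, Real.zero_rpow (by norm_num)]
    simp
  set x := (volume.real A) ^ (1 / 5 : ℝ) with hx
  have hx5 : x ^ 5 = volume.real A := by
    rw [hx, ← Real.rpow_natCast, ← Real.rpow_mul hpos.le]; norm_num
  have hx4 : x ^ 4 = (volume.real A) ^ (4 / 5 : ℝ) := by
    rw [hx, ← Real.rpow_natCast, ← Real.rpow_mul hpos.le]; norm_num
  have hx0 : 0 < x := Real.rpow_pos_of_pos hpos _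
  set y := κ * h with hy
  have hy0 : 0 < y := mul_pos hκ0 hh
  have hxy : 0 < x + y := add_pos hx0 hy0
  have hvA : volume (x⁻¹ • A) = 1 := by
    rw [Measure.addHaar_smul, ← ENNReal.ofReal_toReal hfin, ← ENNReal.ofReal_mul (abs_nonneg _)]
    change ENNReal.ofReal (_ * volume.real A) = 1
    rw [← hx5, finrank_euclideanSpace_fin, abs_of_pos (by positivity), ← mul_pow,
      inv_mul_cancel₀ hx0.ne']
    simp
  have hvB : volume (y⁻¹ • Metric.ball (0 : E5) h) = 1 := by
    rw [Measure.addHaar_smul, Measure.addHaar_ball _ _ hh.le,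
      ← ENNReal.ofReal_toReal measure_ball_lt_top.ne, ← ENNReal.ofReal_mul (by positivity),
      ← ENNReal.ofReal_mul (abs_nonneg _)]
    change ENNReal.ofReal (_ * (_ * volume.real _)) = 1
    rw [← hκ5, finrank_euclideanSpace_fin, abs_of_pos (by positivity), ← mul_pow, ← mul_pow, hy]
    rw [show (κ * h)⁻¹ * (h * κ) = 1 by field_simp]
    simp
  have main := volume_rpow_mul_volume_rpow_le (A := x⁻¹ • A)
    (B := y⁻¹ • Metric.ball (0 : E5) h)
    (S := (x + y)⁻¹ • Metric.thickening h A) (hA.measurableSet.const_smul₀ _)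
    (Metric.isOpen_ball.measurableSet.const_smul₀ _)
    (Metric.isOpen_thickening.measurableSet.const_smul₀ _)
    (a := x / (x + y)) (b := y / (x + y)) (by positivity) (by positivity) (by field_simp) (by
      rintro _ ⟨p, hp, rfl⟩ _ ⟨q, hq, rfl⟩
      refine ⟨p + q, ?_, ?_⟩
      · rw [Metric.mem_thickening_iff]
        exact ⟨p, hp, by simpa [dist_eq_norm] using hq⟩
      · simp only [smul_smul, smul_add]
        congr 2 <;> field_simp)
  rw [hvA, hvB, ENNReal.one_rpow, ENNReal.one_rpow, one_mul, Measure.addHaar_smul,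
    ← ENNReal.ofReal_toReal hfin', ← ENNReal.ofReal_mul (abs_nonneg _), ENNReal.one_le_ofReal,
    finrank_euclideanSpace_fin, abs_of_pos (by positivity)] at main
  change 1 ≤ _ * volume.real (Metric.thickening h A) at main
  rw [inv_pow, inv_mul_eq_div, one_le_div (by positivity)] at main
  refine le_trans ?_ main
  rw [← hx4, ← hx5]
  have : 0 ≤ 10 * x ^ 3 * y ^ 2 + 10 * x ^ 2 * y ^ 3 + 5 * x * y ^ 4 + y ^ 5 := by positivity
  nlinarith [this, hy]

/-- The volume of the unit ball of `ℝ⁵`. -/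
noncomputable def unitVol : ℝ := volume.real (Metric.ball (0 : E5) 1)

theorem unitVol_pos : 0 < unitVol :=
  ENNReal.toReal_pos (Metric.measure_ball_pos _ _ one_pos).ne' measure_ball_lt_top.ne

/-- The radius of the ball having the volume of the superlevel set `{u > t}`. -/
noncomputable def levelRad (u : E5 → ℝ) (t : ℝ) : ℝ :=
  (volume.real {x | t < u x} / unitVol) ^ (1 / 5 : ℝ)

theorem levelRad_nonneg (u : E5 → ℝ) (t : ℝ) : 0 ≤ levelRad u t :=
  Real.rpow_nonneg (div_nonneg measureReal_nonneg unitVol_pos.le) _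

theorem levelRad_pow (u : E5 → ℝ) (t : ℝ) :
    unitVol * levelRad u t ^ 5 = volume.real {x | t < u x} := by
  rw [levelRad, ← Real.rpow_natCast, ← Real.rpow_mul (div_nonneg measureReal_nonneg unitVol_pos.le)]
  norm_num
  field_simp [unitVol_pos.ne']

theorem volume_superlevel_thickening_ge {u : E5 → ℝ} (hu : Continuous u) {t : ℝ}
    (hfin : volume {x | t < u x} ≠ ∞) {h : ℝ} (hh : 0 < h)
    (hfin' : volume (Metric.thickening h {x | t < u x}) ≠ ∞) :
    volume.real {x | t < u x} + h * (5 * unitVol * levelRad u t ^ 4) ≤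
      volume.real (Metric.thickening h {x | t < u x}) := by
  refine le_trans (le_of_eq ?_) (volume_thickening_ge (isOpen_lt continuous_const hu) hfin hh hfin')
  congr 1
  have hb := unitVol_pos
  have : unitVol * levelRad u t ^ 4 =
      unitVol ^ (1 / 5 : ℝ) * volume.real {x | t < u x} ^ (4 / 5 : ℝ) := by
    rw [levelRad, ← Real.rpow_natCast,
      ← Real.rpow_mul (div_nonneg measureReal_nonneg unitVol_pos.le),
      Real.div_rpow measureReal_nonneg hb.le, mul_div_assoc', mul_comm, mul_div_assoc]
    norm_num
    rw [mul_comm]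
    congr 1
    rw [div_eq_iff (by positivity), ← Real.rpow_add hb]
    norm_num
  calc h * (5 * unitVol * levelRad u t ^ 4) = 5 * h * (unitVol * levelRad u t ^ 4) := by ring
    _ = _ := by rw [this, unitVol]; ring

/-- Nonnegative bounded differentiable Lipschitz square-integrable functions on `ℝ⁵`. -/
structure NiceFn (u : E5 → ℝ) : Prop where
  nonneg : ∀ x, 0 ≤ u x
  diff : Differentiable ℝ u
  lip : ∃ L : ℝ≥0, LipschitzWith L u
  sq : Integrable (fun x => u x ^ 2)
  bdd : ∃ B : ℝ, ∀ x, u x ≤ B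

theorem NiceFn.volume_lt_top {u : E5 → ℝ} (hu : NiceFn u) {t : ℝ} (ht : 0 < t) :
    volume {x | t < u x} < ∞ := by
  have := hu.sq.measure_gt_lt_top (ε := t ^ 2) (by positivity)
  refine lt_of_le_of_lt (measure_mono fun x (hx : t < u x) => ?_) this
  show t ^ 2 < u x ^ 2
  nlinarith

theorem levelRad_anti {u : E5 → ℝ} (hu : NiceFn u) {s t : ℝ} (hs : 0 < s) (hst : s ≤ t) :
    levelRad u t ≤ levelRad u s := by
  unfold levelRad
  have := unitVol_pos
  have h2 : volume.real {x | t < u x} ≤ volume.real {x | s < u x} :=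
    measureReal_mono (fun x (hx : t < u x) => lt_of_le_of_lt hst hx) (hu.volume_lt_top hs).ne
  gcongr

theorem measurable_levelRad (u : E5 → ℝ) : Measurable (levelRad u) := by
  unfold levelRad
  have : Measurable fun t => volume.real {x | t < u x} := by
    refine Measurable.ennreal_toReal (Antitone.measurable ?_)
    exact fun s t hst => measure_mono fun x (hx : t < u x) => lt_of_le_of_lt hst hx
  fun_prop

/-- The levels `t ∈ K` with `u x ≤ t` that are exceeded by `u` somewhere in the `h`-ball
around `x`. -/
def newLevels (u : E5 → ℝ) (K : Set ℝ) (h : ℝ) (x : E5) : Set ℝ :=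
  {t | t ∈ K ∧ u x ≤ t ∧ x ∈ Metric.thickening h {y | t < u y}}

theorem measurableSet_newLevels {u : E5 → ℝ} (hu : Continuous u) {K : Set ℝ}
    (hK : MeasurableSet K) (h : ℝ) :
    MeasurableSet {p : ℝ × E5 | p.1 ∈ newLevels u K h p.2} := by
  have h1 : MeasurableSet {p : ℝ × E5 | p.1 ∈ K} := measurable_fst hK
  have h2 : MeasurableSet {p : ℝ × E5 | u p.2 ≤ p.1} :=
    (isClosed_le (hu.comp continuous_snd) continuous_fst).measurableSet
  have h3 : IsOpen {p : ℝ × E5 | p.2 ∈ Metric.thickening h {y | p.1 < u y}} := by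
    have : {p : ℝ × E5 | p.2 ∈ Metric.thickening h {y | p.1 < u y}} =
        ⋃ y : E5, {p : ℝ × E5 | p.1 < u y ∧ dist p.2 y < h} := by
      ext p; simp [Metric.mem_thickening_iff]
    rw [this]
    exact isOpen_iUnion fun y => (isOpen_lt continuous_fst continuous_const).inter
      (isOpen_lt (continuous_snd.dist continuous_const) continuous_const)
  exact h1.inter (h2.inter h3.measurableSet)

theorem newLevels_subset {u : E5 → ℝ} {L : ℝ≥0} (hL : LipschitzWith L u) (K : Set ℝ) (h : ℝ)
    (x : E5) : newLevels u K h x ⊆ Set.Ico (u x) (u x + L * h) := by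
  rintro t ⟨-, ht, hx⟩
  obtain ⟨y, hy, hxy⟩ := Metric.mem_thickening_iff.1 hx
  refine ⟨ht, ?_⟩
  have h1 := hL.dist_le_mul y x
  rw [Real.dist_eq, dist_comm] at h1
  have h2 := (abs_le.1 h1).2
  have h3 : (L : ℝ) * dist x y ≤ L * h := by gcongr
  have : t < u y := hy
  linarith

theorem newLevels_subset_of_hasFDerivAt {u : E5 → ℝ} (K : Set ℝ) {x : E5}
    (hd : DifferentiableAt ℝ u x) {ε : ℝ} (hε : 0 < ε) :
    ∃ δ > 0, ∀ h, 0 < h → h < δ →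
      newLevels u K h x ⊆ Set.Ico (u x) (u x + (‖fderiv ℝ u x‖ + ε) * h) := by
  have := (hasFDerivAt_iff_isLittleO_nhds_zero.1 hd.hasFDerivAt).def hε
  obtain ⟨δ, hδ, H⟩ := Metric.eventually_nhds_iff.1 this
  refine ⟨δ, hδ, fun h hh hhδ => ?_⟩
  rintro t ⟨-, ht, hx⟩
  obtain ⟨y, hy, hxy⟩ := Metric.mem_thickening_iff.1 hx
  refine ⟨ht, ?_⟩
  have hy' : t < u y := hy
  have hn : ‖y - x‖ < h := by rwa [← dist_eq_norm, dist_comm]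
  have h1 := H (y := y - x) (by simpa using hn.trans hhδ)
  rw [add_sub_cancel] at h1
  have h2 := (le_abs_self _).trans (Real.norm_eq_abs _ ▸ h1)
  have h3 := (le_abs_self _).trans (Real.norm_eq_abs _ ▸ (fderiv ℝ u x).le_opNorm (y - x))
  have h4 : (‖fderiv ℝ u x‖ + ε) * ‖y - x‖ ≤ (‖fderiv ℝ u x‖ + ε) * h := by gcongr
  linarith

/-- Coarea-type inequality on compact sets of levels. -/
theorem lintegral_levelRad_le_of_isCompact {u : E5 → ℝ} (hu : NiceFn u) {K : Set ℝ}
    (hK : IsCompact K) (hK0 : K ⊆ Set.Ioi 0) :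
    ∫⁻ t in K, ENNReal.ofReal (5 * unitVol * levelRad u t ^ 4) ≤
      ∫⁻ x in u ⁻¹' K, ENNReal.ofReal ‖fderiv ℝ u x‖ := by
  rcases K.eq_empty_or_nonempty with rfl | hne
  · simp
  obtain ⟨L, hL⟩ := hu.lip
  obtain ⟨a, ha⟩ := hK.exists_isLeast hne
  have ha0 : 0 < a := hK0 ha.1
  have hc : Continuous u := hu.diff.continuous
  obtain ⟨N, hN⟩ : ∃ N : ℕ, ∀ n ≥ N, (L : ℝ) * (1 / ((n : ℝ) + 1)) ≤ a / 2 := by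
    have : Tendsto (fun n : ℕ => (L : ℝ) * (1 / ((n : ℝ) + 1))) atTop (nhds (L * 0)) :=
      tendsto_one_div_add_atTop_nhds_zero_nat.const_mul _
    rw [mul_zero] at this
    exact eventually_atTop.1 (this.eventually_le_const (by positivity))
  let h : ℕ → ℝ := fun n => 1 / (((n + N : ℕ) : ℝ) + 1)
  have hpos : ∀ n, 0 < h n := fun n => by positivity
  have hLh : ∀ n, (L : ℝ) * h n ≤ a / 2 := fun n => hN _ (Nat.le_add_left _ _)
  have hlim : Tendsto h atTop (nhds 0) :=
    (tendsto_add_atTop_iff_nat N).2 tendsto_one_div_add_atTop_nhds_zero_nat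
  have hthick : ∀ n, ∀ t ∈ K, Metric.thickening (h n) {y | t < u y} ⊆ {x | a / 2 < u x} := by
    intro n t ht x hx
    obtain ⟨y, hy, hxy⟩ := Metric.mem_thickening_iff.1 hx
    have h1 := hL.dist_le_mul y x
    rw [Real.dist_eq, dist_comm] at h1
    have h2 := (abs_le.1 h1).2
    have h3 : (L : ℝ) * dist x y ≤ L * h n := by gcongr
    have h4 := hLh n
    have h5 := ha.2 ht
    have h6 : t < u y := hy
    show a / 2 < u x
    linarith
  have hfin : volume {x | a / 2 < u x} < ∞ := hu.volume_lt_top (by positivity)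
  set F : ℕ → E5 → ℝ≥0∞ := fun n x => ENNReal.ofReal (h n)⁻¹ * volume (newLevels u K (h n) x)
    with hF
  have hmeasN : ∀ n, Measurable fun x => volume (newLevels u K (h n) x) := fun n =>
    measurable_measure_prodMk_right (measurableSet_newLevels hc hK.measurableSet (h n))
  have hFm : ∀ n, Measurable (F n) := fun n => (hmeasN n).const_mul _
  -- lower bound
  have hlow : ∀ n, ∫⁻ t in K, ENNReal.ofReal (5 * unitVol * levelRad u t ^ 4) ≤ ∫⁻ x, F n x := by
    intro n
    rw [hF, lintegral_const_mul _ (hmeasN n)]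
    have hswap : ∫⁻ x, volume (newLevels u K (h n) x) =
        ∫⁻ t : ℝ, volume {x | t ∈ newLevels u K (h n) x} := by
      have hm := measurableSet_newLevels hc hK.measurableSet (h n)
      have e1 := Measure.prod_apply (μ := (volume : Measure ℝ)) (ν := (volume : Measure E5)) hm
      have e2 := Measure.prod_apply_symm (μ := (volume : Measure ℝ)) (ν := (volume : Measure E5)) hm
      exact e2.symm.trans e1
    rw [hswap, ← lintegral_const_mul' _ _ ENNReal.ofReal_ne_top,
      ← lintegral_indicator hK.measurableSet]
    refine lintegral_mono fun t => ?_
    by_cases ht : t ∈ K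
    · rw [Set.indicator_of_mem ht]
      have e : {x | t ∈ newLevels u K (h n) x} =
          Metric.thickening (h n) {y | t < u y} \ {y | t < u y} := by
        ext x; simp [newLevels, ht, and_comm]
      have hf1 : volume (Metric.thickening (h n) {y | t < u y}) ≠ ∞ :=
        (measure_mono (hthick n t ht)).trans_lt hfin |>.ne
      have hsub : {y | t < u y} ⊆ Metric.thickening (h n) {y | t < u y} :=
        Metric.self_subset_thickening (hpos n) _
      have hf0 : volume {y | t < u y} ≠ ∞ := ne_top_of_le_ne_top hf1 (measure_mono hsub)
      have hge := volume_superlevel_thickening_ge hc hf0 (hpos n) hf1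
      have hop : MeasurableSet {y | t < u y} := (isOpen_lt continuous_const hc).measurableSet
      rw [e, ← ofReal_measureReal (measure_ne_top_of_subset Set.sdiff_subset hf1),
        measureReal_sdiff hsub hop hf1, ← ENNReal.ofReal_mul (by have := hpos n; positivity)]
      refine ENNReal.ofReal_le_ofReal ?_
      rw [le_inv_mul_iff₀ (hpos n)]
      linarith
    · rw [Set.indicator_of_notMem ht]; exact zero_le
  -- upper bound
  have hbound : ∀ n, F n ≤ᵐ[volume]
      {x | a / 2 < u x}.indicator fun _ => (L : ℝ≥0∞) := by
    intro n
    refine ae_of_all _ fun x => ?_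
    by_cases hx : a / 2 < u x
    · rw [Set.indicator_of_mem (show x ∈ {x | a / 2 < u x} from hx)]
      refine (mul_le_mul_right (measure_mono (newLevels_subset hL K (h n) x)) _).trans ?_
      rw [Real.volume_Ico, add_sub_cancel_left, ← ENNReal.ofReal_mul (by have := hpos n; positivity)]
      rw [show (h n)⁻¹ * (L * h n) = L by have := hpos n; field_simp]
      simp
    · have : newLevels u K (h n) x = ∅ := by
        refine Set.eq_empty_of_forall_notMem fun t ht => hx (hthick n t ht.1 ht.2.2)
      simp [hF, this]
  have hlims := limsup_lintegral_le _ hFm hbound (by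
    rw [lintegral_indicator_const (isOpen_lt continuous_const hc).measurableSet]
    exact (ENNReal.mul_lt_top ENNReal.coe_lt_top hfin).ne)
  have hstart : ∫⁻ t in K, ENNReal.ofReal (5 * unitVol * levelRad u t ^ 4) ≤
      limsup (fun n => ∫⁻ x, F n x) atTop :=
    le_limsup_of_frequently_le (Eventually.of_forall hlow).frequently
  refine hstart.trans (hlims.trans ?_)
  rw [← lintegral_indicator (hK.isClosed.preimage hc).measurableSet]
  refine lintegral_mono fun x => ?_
  by_cases hx : u x ∈ K
  · rw [Set.indicator_of_mem (show x ∈ u ⁻¹' K from hx)]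
    refine ENNReal.le_of_forall_pos_le_add fun ε hε _ => ?_
    have hε' : (0 : ℝ) < ε := hε
    obtain ⟨δ, hδ, H⟩ := newLevels_subset_of_hasFDerivAt K (hu.diff x) hε'
    refine limsup_le_of_le (h := ?_)
    filter_upwards [hlim.eventually_lt_const hδ] with n hn
    refine (mul_le_mul_right (measure_mono (H (h n) (hpos n) hn)) _).trans ?_
    rw [Real.volume_Ico, add_sub_cancel_left, ← ENNReal.ofReal_mul (by have := hpos n; positivity)]
    rw [show (h n)⁻¹ * ((‖fderiv ℝ u x‖ + ε) * h n) = ‖fderiv ℝ u x‖ + ε by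
      have := hpos n; field_simp, ENNReal.ofReal_add (norm_nonneg _) hε'.le]
    simp
  · rw [Set.indicator_of_notMem (show x ∉ u ⁻¹' K from hx)]
    obtain ⟨δ, hδ, H⟩ := Metric.isOpen_iff.1 hK.isClosed.isOpen_compl (u x) hx
    refine limsup_le_of_le (h := ?_)
    have hlim' : Tendsto (fun n => (L : ℝ) * h n) atTop (nhds 0) := by
      simpa using hlim.const_mul (L : ℝ)
    filter_upwards [hlim'.eventually_lt_const hδ] with n hn
    have : newLevels u K (h n) x = ∅ := by
      refine Set.eq_empty_of_forall_notMem fun t ht => ?_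
      have h1 := newLevels_subset hL K (h n) x ht
      refine H (a := t) ?_ ht.1
      rw [Metric.mem_ball, Real.dist_eq, abs_of_nonneg (by linarith [h1.1])]
      linarith [h1.2]
    simp [hF, this]

/-- Coarea-type isoperimetric inequality with an arbitrary weight. -/
theorem lintegral_mul_levelRad_le {u : E5 → ℝ} (hu : NiceFn u) {w : ℝ → ℝ≥0∞}
    (hw : Measurable w) :
    ∫⁻ t in Set.Ioi 0, w t * ENNReal.ofReal (5 * unitVol * levelRad u t ^ 4) ≤
      ∫⁻ x, w (u x) * ENNReal.ofReal ‖fderiv ℝ u x‖ := by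
  have hm1 : Measurable fun t => ENNReal.ofReal (5 * unitVol * levelRad u t ^ 4) := by
    have := measurable_levelRad u
    fun_prop
  have hum : Measurable u := hu.diff.continuous.measurable
  have hm2 : Measurable fun x => ENNReal.ofReal ‖fderiv ℝ u x‖ :=
    (measurable_fderiv ℝ u).norm.ennreal_ofReal
  set ν₂ := (volume.withDensity fun x => ENNReal.ofReal ‖fderiv ℝ u x‖).map u with hν₂
  set ν₁ := (volume.restrict (Set.Ioi 0)).withDensity
    fun t => ENNReal.ofReal (5 * unitVol * levelRad u t ^ 4) with hν₁
  have hle : ν₁ ≤ ν₂ := by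
    refine Measure.le_iff.2 fun s hs => ?_
    have hsf : SigmaFinite ν₁ := by
      rw [hν₁]; infer_instance
    have hreg : ν₁.InnerRegular := inferInstance
    have hpos : ν₁ s ≤ ν₁ (s ∩ Set.Ioi 0) := by
      rw [hν₁, withDensity_apply _ hs, withDensity_apply _ (hs.inter measurableSet_Ioi),
        Measure.restrict_restrict hs, Measure.restrict_restrict (hs.inter measurableSet_Ioi),
        Set.inter_assoc, Set.inter_self]
    refine hpos.trans ?_
    rw [(hs.inter measurableSet_Ioi).measure_eq_iSup_isCompact]
    refine iSup_le fun K => iSup_le fun hKs => iSup_le fun hK => ?_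
    have hK0 : K ⊆ Set.Ioi 0 := hKs.trans Set.inter_subset_right
    have := lintegral_levelRad_le_of_isCompact hu hK hK0
    calc ν₁ K = ∫⁻ t in K, ENNReal.ofReal (5 * unitVol * levelRad u t ^ 4) := by
          rw [hν₁, withDensity_apply _ hK.measurableSet, Measure.restrict_restrict hK.measurableSet,
            Set.inter_eq_left.2 hK0]
      _ ≤ _ := this
      _ = ν₂ K := by
          rw [hν₂, Measure.map_apply hum hK.measurableSet,
            withDensity_apply _ (hum hK.measurableSet)]
      _ ≤ ν₂ s := measure_mono (hKs.trans Set.inter_subset_left)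
  calc ∫⁻ t in Set.Ioi 0, w t * ENNReal.ofReal (5 * unitVol * levelRad u t ^ 4)
      = ∫⁻ t, w t ∂ν₁ := by
        rw [hν₁, lintegral_withDensity_eq_lintegral_mul _ hm1 hw]
        simp [mul_comm]
    _ ≤ ∫⁻ t, w t ∂ν₂ := lintegral_mono' hle le_rfl
    _ = _ := by
        rw [hν₂, lintegral_map hw hum]
        refine (lintegral_withDensity_eq_lintegral_mul _ hm2 (hw.comp hum)).trans ?_
        simp [mul_comm]

/-- The radial profile of the symmetric decreasing rearrangement. -/
noncomputable def rearr (u : E5 → ℝ) (s : ℝ) : ℝ := sSup {t | 0 < t ∧ s < levelRad u t}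

/-- The measure `5 |B₁| s⁴ ds` on the half-line, the image of Lebesgue measure on `ℝ⁵` under the
norm. -/
noncomputable def radMeasure : Measure ℝ :=
  (volume.restrict (Set.Ioi 0)).withDensity fun s => ENNReal.ofReal (5 * unitVol * s ^ 4)

theorem radMeasure_Ioo {r : ℝ} (hr : 0 ≤ r) :
    radMeasure (Set.Ioo 0 r) = ENNReal.ofReal (unitVol * r ^ 5) := by
  have hβ := unitVol_pos
  rw [radMeasure, withDensity_apply _ measurableSet_Ioo,
    Measure.restrict_restrict measurableSet_Ioo, Set.inter_eq_left.2 Set.Ioo_subset_Ioi_self,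
    ← ofReal_integral_eq_lintegral_ofReal]
  · rw [← integral_Ioc_eq_integral_Ioo, ← intervalIntegral.integral_of_le hr,
      intervalIntegral.integral_const_mul, integral_pow]
    congr 1
    norm_num
    ring
  · refine Integrable.mono_measure (ν := volume.restrict (Set.Icc 0 r)) ?_
      (Measure.restrict_mono Set.Ioo_subset_Icc_self le_rfl)
    exact (by fun_prop : Continuous fun s : ℝ => 5 * unitVol * s ^ 4).continuousOn.integrableOn_Icc
  · exact ae_of_all _ fun s => by positivity

theorem exists_lt_levelRad {u : E5 → ℝ} (hu : NiceFn u) {s t : ℝ} (ht : 0 < t) (hs : 0 ≤ s) (h : s < levelRad u t) :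
    ∃ t' > t, s < levelRad u t' := by
  have hβ := unitVol_pos
  have hvol : volume {x | t < u x} = ⨆ n : ℕ, volume {x | t + 1 / ((n : ℝ) + 1) < u x} := by
    rw [← Monotone.measure_iUnion]
    · congr 1
      ext x
      simp only [Set.mem_ofPred_eq, Set.mem_iUnion]
      constructor
      · intro hx
        obtain ⟨n, hn⟩ := exists_nat_one_div_lt (sub_pos.2 hx)
        exact ⟨n, by linarith⟩
      · rintro ⟨n, hn⟩
        have : (0 : ℝ) < 1 / ((n : ℝ) + 1) := by positivity
        linarith
    · intro m n hmn x (hx : _ < u x)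
      refine lt_of_le_of_lt ?_ hx
      have : 1 / ((n : ℝ) + 1) ≤ 1 / ((m : ℝ) + 1) := by gcongr
      linarith
  have hlt : ENNReal.ofReal (unitVol * s ^ 5) < volume {x | t < u x} := by
    rw [← ofReal_measureReal (hu.volume_lt_top ht).ne, ← levelRad_pow,
      ENNReal.ofReal_lt_ofReal_iff_of_nonneg (by positivity)]
    gcongr
  rw [hvol] at hlt
  obtain ⟨n, hn⟩ := lt_iSup_iff.1 hlt
  have hn0 : (0 : ℝ) < 1 / ((n : ℝ) + 1) := by positivity
  refine ⟨t + 1 / ((n : ℝ) + 1), by linarith, ?_⟩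
  rw [← ofReal_measureReal (hu.volume_lt_top (by linarith)).ne, ← levelRad_pow,
      ENNReal.ofReal_lt_ofReal_iff_of_nonneg (by positivity)] at hn
  exact lt_of_pow_lt_pow_left₀ 5 (levelRad_nonneg _ _) (lt_of_mul_lt_mul_left hn hβ.le)

theorem rearr_bddAbove {u : E5 → ℝ} (hu : NiceFn u) {s : ℝ} (hs : 0 ≤ s) : BddAbove {t | 0 < t ∧ s < levelRad u t} := by
  obtain ⟨B, hB⟩ := hu.bdd
  refine ⟨B, ?_⟩
  rintro t ⟨ht, hst⟩
  by_contra hlt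
  have : {x | t < u x} = ∅ := by
    ext x; simpa using (hB x).trans (not_le.1 hlt).le
  rw [levelRad, this] at hst
  simp at hst
  linarith

theorem lt_rearr_iff {u : E5 → ℝ} (hu : NiceFn u) {s t : ℝ} (hs : 0 ≤ s) (ht : 0 < t) : t < rearr u s ↔ s < levelRad u t := by
  constructor
  · intro h
    have hne : {t | 0 < t ∧ s < levelRad u t}.Nonempty := by
      by_contra hne
      rw [Set.not_nonempty_iff_eq_empty] at hne
      rw [rearr, hne, Real.sSup_empty] at h
      linarith
    obtain ⟨t', ⟨-, h2⟩, h3⟩ := exists_lt_of_lt_csSup hne h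
    exact h2.trans_le (levelRad_anti hu ht h3.le)
  · intro h
    obtain ⟨t', ht', h'⟩ := exists_lt_levelRad hu ht hs h
    exact ht'.trans_le (le_csSup (rearr_bddAbove hu hs) ⟨ht.trans ht', h'⟩)

theorem rearr_nonneg {u : E5 → ℝ} (s : ℝ) : 0 ≤ rearr u s := Real.sSup_nonneg fun _ ht => ht.1.le

theorem rearr_antitoneOn {u : E5 → ℝ} (hu : NiceFn u) : AntitoneOn (rearr u) (Set.Ioi 0) := by
  intro s hs s' hs' hss
  refine le_of_forall_lt fun t ht => ?_
  rcases le_or_gt t 0 with h0 | h0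
  · by_contra hlt
    have h1 : rearr u s = 0 := le_antisymm (by linarith) (rearr_nonneg _)
    have h2 := rearr_nonneg (u := u) s'
    have h3 : 0 < rearr u s' := by
      rcases h2.lt_or_eq with h | h
      · exact h
      · exact absurd ht (by rw [← h]; rw [h1] at hlt; exact hlt)
    have h4 := (lt_rearr_iff hu (le_of_lt hs') (half_pos h3)).1 (half_lt_self h3)
    have h5 := (lt_rearr_iff hu (le_of_lt hs) (half_pos h3)).2 (lt_of_le_of_lt hss h4)
    linarith
  · exact (lt_rearr_iff hu (le_of_lt hs) h0).2
      (lt_of_le_of_lt hss ((lt_rearr_iff hu (le_of_lt hs') h0).1 ht))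

theorem rearr_le_bound {u : E5 → ℝ} (hu : NiceFn u) : ∃ B, ∀ s, 0 < s → rearr u s ≤ B := by
  obtain ⟨B, hB⟩ := hu.bdd
  refine ⟨max B 0, fun s hs => Real.sSup_le ?_ (le_max_right _ _)⟩
  rintro t ⟨ht, hst⟩
  by_contra hlt
  have : {x | t < u x} = ∅ := by
    ext x; simpa using (hB x).trans ((le_max_left B 0).trans (not_le.1 hlt).le)
  rw [levelRad, this] at hst
  simp at hst
  linarith

theorem superlevel_rearr {u : E5 → ℝ} (hu : NiceFn u) {t : ℝ} (ht : 0 < t) :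
    {s | t < rearr u s} ∩ Set.Ioi 0 = Set.Ioo 0 (levelRad u t) := by
  ext s
  simp only [Set.mem_inter_iff, Set.mem_ofPred_eq, Set.mem_Ioi, Set.mem_Ioo]
  constructor
  · rintro ⟨h1, h2⟩
    exact ⟨h2, (lt_rearr_iff hu h2.le ht).1 h1⟩
  · rintro ⟨h1, h2⟩
    exact ⟨(lt_rearr_iff hu h1.le ht).2 h2, h1⟩

theorem radMeasure_inter_Ioi (A : Set ℝ) : radMeasure (A ∩ Set.Ioi 0) = radMeasure A := by
  have : radMeasure (Set.Ioi 0)ᶜ = 0 :=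
    withDensity_absolutelyContinuous _ _ (by
      rw [Measure.restrict_apply measurableSet_Ioi.compl, Set.compl_inter_self]; simp)
  exact measure_inter_conull this

theorem radMeasure_superlevel_rearr {u : E5 → ℝ} (hu : NiceFn u) {t : ℝ} (ht : 0 < t) :
    radMeasure {s | t < rearr u s} = volume {x | t < u x} := by
  rw [← radMeasure_inter_Ioi, superlevel_rearr hu ht, radMeasure_Ioo (levelRad_nonneg _ _),
    levelRad_pow, ofReal_measureReal (hu.volume_lt_top ht).ne]

theorem aemeasurable_rearr {u : E5 → ℝ} (hu : NiceFn u) : AEMeasurable (rearr u) radMeasure :=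
  (aemeasurable_restrict_of_antitoneOn measurableSet_Ioi (rearr_antitoneOn hu)).mono_ac
    (withDensity_absolutelyContinuous _ _)

theorem map_rearr_restrict {u : E5 → ℝ} (hu : NiceFn u) :
    (radMeasure.map (rearr u)).restrict (Set.Ioi 0) = (volume.map u).restrict (Set.Ioi 0) := by
  have hum : Measurable u := hu.diff.continuous.measurable
  have hcov : (Set.Ioi (0 : ℝ)) = ⋃ n : ℕ, Set.Ioi (1 / ((n : ℝ) + 1)) := by
    ext t
    simp only [Set.mem_Ioi, Set.mem_iUnion]
    constructor
    · exact fun ht => exists_nat_one_div_lt ht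
    · rintro ⟨n, hn⟩
      exact lt_trans (by positivity) hn
  rw [hcov, Measure.restrict_iUnion_congr]
  intro n
  have hn0 : (0 : ℝ) < 1 / ((n : ℝ) + 1) := by positivity
  have hIoi : ∀ t : ℝ, 0 < t →
      (radMeasure.map (rearr u)) (Set.Ioi t) = (volume.map u) (Set.Ioi t) := by
    intro t ht
    rw [Measure.map_apply_of_aemeasurable (aemeasurable_rearr hu) measurableSet_Ioi,
      Measure.map_apply hum measurableSet_Ioi]
    exact radMeasure_superlevel_rearr hu ht
  have hfin : (radMeasure.map (rearr u)) (Set.Ioi (1 / ((n : ℝ) + 1))) ≠ ∞ := by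
    rw [hIoi _ hn0, Measure.map_apply hum measurableSet_Ioi]
    exact (hu.volume_lt_top hn0).ne
  have : IsFiniteMeasure ((radMeasure.map (rearr u)).restrict (Set.Ioi (1 / ((n : ℝ) + 1)))) :=
    ⟨by rwa [Measure.restrict_apply_univ, lt_top_iff_ne_top]⟩
  refine ext_of_generate_finite (Set.range Set.Ioi) (borel_eq_generateFrom_Ioi ℝ ▸
    BorelSpace.measurable_eq) isPiSystem_Ioi ?_ ?_
  · rintro _ ⟨t, rfl⟩
    rw [Measure.restrict_apply measurableSet_Ioi, Measure.restrict_apply measurableSet_Ioi,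
      Set.Ioi_inter_Ioi]
    exact hIoi _ (lt_of_lt_of_le hn0 (le_max_right _ _))
  · rw [Measure.restrict_apply_univ, Measure.restrict_apply_univ]
    exact hIoi _ hn0

theorem lintegral_comp_rearr {u : E5 → ℝ} (hu : NiceFn u) {W : ℝ → ℝ≥0∞} (hW : Measurable W) (hW0 : W 0 = 0) :
    ∫⁻ s, W (rearr u s) ∂radMeasure = ∫⁻ x, W (u x) := by
  have hum : Measurable u := hu.diff.continuous.measurable
  have key : ∀ (s : ℝ), 0 ≤ s → W s = (Set.Ioi 0).indicator W s := by
    intro s hs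
    rcases hs.lt_or_eq with h | h
    · rw [Set.indicator_of_mem (show s ∈ Set.Ioi 0 from h)]
    · rw [← h]; simp [hW0]
  have hWi : Measurable ((Set.Ioi (0 : ℝ)).indicator W) := hW.indicator measurableSet_Ioi
  rw [lintegral_congr fun s => key _ (rearr_nonneg s), lintegral_congr fun x => key _ (hu.nonneg x),
    ← lintegral_map' hWi.aemeasurable (aemeasurable_rearr hu), ← lintegral_map hWi hum,
    lintegral_indicator measurableSet_Ioi, lintegral_indicator measurableSet_Ioi,
    map_rearr_restrict hu]

/-- Layer-cake formula for `∫ v u²`. -/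
theorem lintegral_mul_sq_eq {α : Type*} [MeasurableSpace α] (m : Measure α) [SFinite m] {u v : α → ℝ}
    (hu : AEMeasurable u m) (hv : AEMeasurable v m) (hu0 : ∀ x, 0 ≤ u x) (hv0 : ∀ x, 0 ≤ v x) :
    ∫⁻ x, ENNReal.ofReal (v x * u x ^ 2) ∂m = ∫⁻ t in Set.Ioi 0, ∫⁻ τ in Set.Ioi 0,
      m ({x | t < v x} ∩ {x | √τ < u x}) := by
  have hu2 : AEMeasurable (fun x => ENNReal.ofReal (u x ^ 2)) m := (hu.pow_const 2).ennreal_ofReal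
  have hac := withDensity_absolutelyContinuous m fun x => ENNReal.ofReal (u x ^ 2)
  have h1 : ∫⁻ x, ENNReal.ofReal (v x * u x ^ 2) ∂m =
      ∫⁻ x, ENNReal.ofReal (v x) ∂(m.withDensity fun x => ENNReal.ofReal (u x ^ 2)) := by
    rw [lintegral_withDensity_eq_lintegral_mul₀ hu2 hv.ennreal_ofReal]
    refine lintegral_congr fun x => ?_
    rw [Pi.mul_apply, ← ENNReal.ofReal_mul (sq_nonneg _), mul_comm]
  rw [h1, lintegral_eq_lintegral_meas_lt _ (ae_of_all _ hv0) (hv.mono_ac hac)]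
  refine lintegral_congr fun t => ?_
  have hns : NullMeasurableSet {x | t < v x} m := hv.nullMeasurable measurableSet_Ioi
  rw [withDensity_apply', lintegral_eq_lintegral_meas_lt _ (ae_of_all _ fun x => sq_nonneg _)
    (hu.pow_const 2).restrict]
  refine setLIntegral_congr_fun measurableSet_Ioi fun τ hτ => ?_
  have e : {x | τ < u x ^ 2} = {x | √τ < u x} := by
    ext x
    simp only [Set.mem_ofPred_eq]
    rw [Real.sqrt_lt (le_of_lt hτ) (hu0 x)]
  have hns2 : NullMeasurableSet {x | √τ < u x} m := hu.nullMeasurable measurableSet_Ioi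
  rw [e, Measure.restrict_apply₀ (hns2.mono_ac Measure.restrict_le_self.absolutelyContinuous),
    Set.inter_comm]

instance : SFinite radMeasure := by unfold radMeasure; infer_instance

/-- The rearrangement inequality for `∫ v u²`. -/
theorem lintegral_mul_sq_le_rearr {u v : E5 → ℝ} (hu : NiceFn u) (hv : NiceFn v) :
    ∫⁻ x, ENNReal.ofReal (v x * u x ^ 2) ≤
      ∫⁻ s, ENNReal.ofReal (rearr v s * rearr u s ^ 2) ∂radMeasure := by
  rw [lintegral_mul_sq_eq _ hu.diff.continuous.aemeasurable hv.diff.continuous.aemeasurable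
    hu.nonneg hv.nonneg, lintegral_mul_sq_eq _ (aemeasurable_rearr hu) (aemeasurable_rearr hv)
    rearr_nonneg rearr_nonneg]
  refine setLIntegral_mono' measurableSet_Ioi fun t ht => setLIntegral_mono' measurableSet_Ioi
    fun τ hτ => ?_
  have hτ' : 0 < √τ := Real.sqrt_pos.2 hτ
  rw [← radMeasure_inter_Ioi, Set.inter_inter_distrib_right, superlevel_rearr hv ht,
    superlevel_rearr hu hτ', Set.Ioo_inter_Ioo, max_self]
  rcases le_total (levelRad v t) (levelRad u √τ) with h | h
  · rw [min_eq_left h, ← superlevel_rearr hv ht, radMeasure_inter_Ioi,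
      radMeasure_superlevel_rearr hv ht]
    exact measure_mono Set.inter_subset_left
  · rw [min_eq_right h, ← superlevel_rearr hu hτ', radMeasure_inter_Ioi,
      radMeasure_superlevel_rearr hu hτ']
    exact measure_mono Set.inter_subset_right

/-- The decay profile `min (s^{-3/2}) (s^{-5/2})`. -/
noncomputable def decay (s : ℝ) : ℝ := min (s ^ (-(3 / 2) : ℝ)) (s ^ (-(5 / 2) : ℝ))

/-- The primitive `∫₀ʳ q`. -/
noncomputable def cumul (q : ℝ → ℝ) (r : ℝ) : ℝ := ∫ s in Set.Ioc 0 r, q s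

/-- Test densities for the dual formulation of the radial Dirichlet energy. -/
structure IsTest (q : ℝ → ℝ) : Prop where
  int : IntegrableOn (fun s => q s * decay s) (Set.Ioi 0)
  sq : IntegrableOn (fun r => cumul q r ^ 2 / r ^ 4) (Set.Ioi 0)

/-- The dual formulation of `∫ f'² s⁴ ds ≤ a`. -/
def EnergyLE (f : ℝ → ℝ) (a : ℝ) : Prop :=
  ∀ q, IsTest q → 2 * (∫ s in Set.Ioi 0, q s * f s) -
    (∫ r in Set.Ioi 0, cumul q r ^ 2 / r ^ 4) ≤ a

theorem decay_pos {s : ℝ} (hs : 0 < s) : 0 < decay s :=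
  lt_min (Real.rpow_pos_of_pos hs _) (Real.rpow_pos_of_pos hs _)

theorem measurable_decay : Measurable decay := by
  unfold decay
  fun_prop

theorem decay_anti {s t : ℝ} (hs : 0 < s) (hst : s ≤ t) : decay t ≤ decay s :=
  min_le_min (Real.rpow_le_rpow_of_nonpos hs hst (by norm_num))
    (Real.rpow_le_rpow_of_nonpos hs hst (by norm_num))

theorem IsTest.aestronglyMeasurable {q : ℝ → ℝ} (hq : IsTest q) :
    AEStronglyMeasurable q (volume.restrict (Set.Ioi 0)) := by
  have h := hq.int.aestronglyMeasurable.aemeasurable.div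
    (measurable_decay.aemeasurable (μ := volume.restrict (Set.Ioi 0)))
  refine (h.congr ?_).aestronglyMeasurable
  filter_upwards [self_mem_ae_restrict measurableSet_Ioi] with s hs
  have := (decay_pos hs).ne'
  simp only [Pi.div_apply]
  field_simp

theorem IsTest.integrableOn_mul {q f : ℝ → ℝ} (hq : IsTest q) {C : ℝ}
    (hf : AEStronglyMeasurable f (volume.restrict (Set.Ioi 0)))
    (hC : ∀ s, 0 < s → |f s| ≤ C * decay s) :
    IntegrableOn (fun s => q s * f s) (Set.Ioi 0) := by
  refine (hq.int.const_mul C).mono (hq.aestronglyMeasurable.mul hf) ?_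
  filter_upwards [self_mem_ae_restrict measurableSet_Ioi] with s hs
  have h1 := hC s hs
  have hC0 : 0 ≤ C * decay s := (abs_nonneg _).trans h1
  rw [norm_mul, Real.norm_eq_abs, Real.norm_eq_abs, Real.norm_eq_abs, mul_left_comm, abs_mul,
    abs_of_nonneg hC0]
  gcongr

theorem IsTest.integrableOn_Ioc {q : ℝ → ℝ} (hq : IsTest q) (r : ℝ) :
    IntegrableOn q (Set.Ioc 0 r) := by
  rcases le_or_gt r 0 with hr | hr
  · simp [Set.Ioc_eq_empty (not_lt.2 hr)]
  have h1 : IntegrableOn (fun s => (decay r)⁻¹ * (q s * decay s)) (Set.Ioc 0 r) :=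
    (hq.int.mono_set Set.Ioc_subset_Ioi_self).const_mul _
  refine Integrable.mono h1
    (hq.aestronglyMeasurable.mono_measure (Measure.restrict_mono Set.Ioc_subset_Ioi_self le_rfl)) ?_
  filter_upwards [self_mem_ae_restrict measurableSet_Ioc] with s hs
  have h2 := decay_anti hs.1 hs.2
  have h3 := decay_pos hr
  have h4 := decay_pos hs.1
  rw [norm_mul, norm_mul, Real.norm_of_nonneg (inv_nonneg.2 h3.le), Real.norm_of_nonneg h4.le,
    mul_left_comm, inv_mul_eq_div]
  exact le_mul_of_one_le_right (norm_nonneg _) ((one_le_div h3).2 h2)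

theorem continuous_cumul {q : ℝ → ℝ} (hq : ∀ r, IntegrableOn q (Set.Ioc 0 r)) :
    Continuous (cumul q) := by
  have hi : ∀ a b : ℝ, IntervalIntegrable ((Set.Ioi 0).indicator q) volume a b := by
    intro a b
    have : IntegrableOn ((Set.Ioi 0).indicator q) (Set.Ioc (min a b) (max a b)) := by
      rw [IntegrableOn, integrable_indicator_iff measurableSet_Ioi, IntegrableOn,
        Measure.restrict_restrict measurableSet_Ioi]
      exact (hq (max a b)).mono_set fun x hx => ⟨hx.1, hx.2.2⟩
    exact intervalIntegrable_iff.2 this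
  have e : cumul q = fun r => ∫ s in (0 : ℝ)..r, (Set.Ioi 0).indicator q s := by
    ext r
    rcases le_or_gt 0 r with hr | hr
    · rw [intervalIntegral.integral_of_le hr, cumul]
      exact setIntegral_congr_fun measurableSet_Ioc fun s hs =>
        (Set.indicator_of_mem (show s ∈ Set.Ioi 0 from hs.1) q).symm
    · rw [intervalIntegral.integral_of_ge hr.le, cumul, Set.Ioc_eq_empty (not_lt.2 hr.le)]
      have : ∫ s in Set.Ioc r 0, (Set.Ioi 0).indicator q s = ∫ s in Set.Ioc r 0, (0 : ℝ) :=
        setIntegral_congr_fun measurableSet_Ioc fun s hs =>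
          Set.indicator_of_notMem (s := Set.Ioi (0 : ℝ)) (not_lt.2 hs.2) q
      simp [this]
  rw [e]
  exact intervalIntegral.continuous_primitive hi 0

theorem cumul_of_nonpos (q : ℝ → ℝ) {r : ℝ} (hr : r ≤ 0) : cumul q r = 0 := by
  rw [cumul, Set.Ioc_eq_empty (not_lt.2 hr)]; simp

/-- Monotone functions with finite mass decay like `s^{-5/2}`. -/
theorem sq_mul_pow_le_of_antitoneOn {f : ℝ → ℝ} (hf : AntitoneOn f (Set.Ioi 0))
    (hf0 : ∀ s, 0 < s → 0 ≤ f s)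
    (hi : IntegrableOn (fun s => f s ^ 2 * s ^ 4) (Set.Ioi 0)) {r : ℝ} (hr : 0 < r) :
    f r ^ 2 * r ^ 5 ≤ 5 * ∫ s in Set.Ioi 0, f s ^ 2 * s ^ 4 := by
  have h1 : ∫ s in Set.Ioc 0 r, f r ^ 2 * s ^ 4 ≤ ∫ s in Set.Ioi 0, f s ^ 2 * s ^ 4 := by
    refine le_trans (setIntegral_mono_on ?_ (hi.mono_set Set.Ioc_subset_Ioi_self) measurableSet_Ioc
      fun s hs => ?_) (setIntegral_mono_set hi (ae_of_all _ fun s => by positivity)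
        (ae_of_all _ Set.Ioc_subset_Ioi_self))
    · exact (by fun_prop : Continuous fun s : ℝ => f r ^ 2 * s ^ 4).integrableOn_Ioc
    · have := hf hs.1 hr hs.2
      have := hf0 r hr
      gcongr
  rw [← intervalIntegral.integral_of_le hr.le, intervalIntegral.integral_const_mul,
    integral_pow] at h1
  norm_num at h1
  linarith

theorem le_rpow_of_sq_mul_le {x r A : ℝ} (hx : 0 ≤ x) (hr : 0 < r) {n : ℕ} (h : x ^ 2 * r ^ n ≤ A) :
    x ≤ √A * r ^ (-(n / 2 : ℝ)) := by
  have hA : 0 ≤ A := le_trans (by positivity) h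
  refine (pow_le_pow_iff_left₀ hx (by positivity) two_ne_zero).1 ?_
  rw [mul_pow, Real.sq_sqrt hA, ← Real.rpow_natCast (r ^ _), ← Real.rpow_mul hr.le]
  rw [show (-(n / 2 : ℝ) * (2 : ℕ)) = -(n : ℝ) by push_cast; ring, Real.rpow_neg hr.le,
    Real.rpow_natCast, ← div_eq_mul_inv, le_div_iff₀ (by positivity)]
  exact h

theorem le_decay_of_bounds {f : ℝ → ℝ} {A B : ℝ} (hf0 : ∀ s, 0 < s → 0 ≤ f s)
    (h3 : ∀ s, 0 < s → f s ^ 2 * s ^ 3 ≤ A) (h5 : ∀ s, 0 < s → f s ^ 2 * s ^ 5 ≤ B) :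
    ∀ s, 0 < s → |f s| ≤ max √A √B * decay s := by
  intro s hs
  rw [abs_of_nonneg (hf0 s hs), decay, mul_min_of_nonneg _ _ (by positivity)]
  refine le_min ?_ ?_
  · refine (le_rpow_of_sq_mul_le (hf0 s hs) hs (h3 s hs)).trans ?_
    push_cast
    gcongr
    exact le_max_left _ _
  · refine (le_rpow_of_sq_mul_le (hf0 s hs) hs (h5 s hs)).trans ?_
    push_cast
    gcongr
    exact le_max_right _ _

theorem lintegral_radMeasure {W : ℝ → ℝ≥0∞} (hW : AEMeasurable W (volume.restrict (Set.Ioi 0))) :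
    ∫⁻ s, W s ∂radMeasure = ∫⁻ s in Set.Ioi 0, ENNReal.ofReal (5 * unitVol * s ^ 4) * W s := by
  rw [radMeasure, lintegral_withDensity_eq_lintegral_mul₀ (by fun_prop) hW]
  rfl

theorem aemeasurable_rearr_restrict {u : E5 → ℝ} (hu : NiceFn u) :
    AEMeasurable (rearr u) (volume.restrict (Set.Ioi 0)) :=
  aemeasurable_restrict_of_antitoneOn measurableSet_Ioi (rearr_antitoneOn hu)

theorem lintegral_rearr_sq {u : E5 → ℝ} (hu : NiceFn u) :
    ∫⁻ s in Set.Ioi 0, ENNReal.ofReal (rearr u s ^ 2 * s ^ 4) =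
      ENNReal.ofReal ((∫ x, u x ^ 2) / (5 * unitVol)) := by
  have hβ := unitVol_pos
  have h := lintegral_comp_rearr hu (W := fun t => ENNReal.ofReal (t ^ 2)) (by fun_prop) (by simp)
  rw [lintegral_radMeasure ((aemeasurable_rearr_restrict hu).pow_const 2).ennreal_ofReal,
    ← ofReal_integral_eq_lintegral_ofReal hu.sq (ae_of_all _ fun x => sq_nonneg _)] at h
  have e : ∫⁻ s in Set.Ioi 0, ENNReal.ofReal (5 * unitVol * s ^ 4) * ENNReal.ofReal (rearr u s ^ 2) =
      ENNReal.ofReal (5 * unitVol) * ∫⁻ s in Set.Ioi 0, ENNReal.ofReal (rearr u s ^ 2 * s ^ 4) := by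
    rw [← lintegral_const_mul' _ _ ENNReal.ofReal_ne_top]
    refine lintegral_congr fun s => ?_
    rw [← ENNReal.ofReal_mul (by positivity), ← ENNReal.ofReal_mul (by positivity)]
    congr 1
    ring
  rw [e] at h
  rw [ENNReal.ofReal_div_of_pos (by positivity), ← h, mul_comm,
    ENNReal.mul_div_cancel_right (by simpa using hβ) ENNReal.ofReal_ne_top]

theorem integrableOn_rearr_sq {u : E5 → ℝ} (hu : NiceFn u) :
    IntegrableOn (fun s => rearr u s ^ 2 * s ^ 4) (Set.Ioi 0) := by
  refine ⟨(((aemeasurable_rearr_restrict hu).pow_const 2).mul (by fun_prop)).aestronglyMeasurable, ?_⟩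
  rw [hasFiniteIntegral_iff_ofReal (ae_of_all _ fun s => by positivity), lintegral_rearr_sq hu]
  exact ENNReal.ofReal_lt_top

theorem integral_rearr_sq {u : E5 → ℝ} (hu : NiceFn u) :
    ∫ s in Set.Ioi 0, rearr u s ^ 2 * s ^ 4 = (∫ x, u x ^ 2) / (5 * unitVol) := by
  have hβ := unitVol_pos
  rw [integral_eq_lintegral_of_nonneg_ae (ae_of_all _ fun s => by positivity)
    (integrableOn_rearr_sq hu).aestronglyMeasurable, lintegral_rearr_sq hu, ENNReal.toReal_ofReal]
  exact div_nonneg (integral_nonneg fun x => sq_nonneg _) (by positivity)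

theorem rearr_le_decay {u : E5 → ℝ} (hu : NiceFn u) :
    ∃ C, ∀ s, 0 < s → |rearr u s| ≤ C * decay s := by
  obtain ⟨B, hB⟩ := rearr_le_bound hu
  have h5 : ∀ s, 0 < s → rearr u s ^ 2 * s ^ 5 ≤ 5 * ∫ s in Set.Ioi 0, rearr u s ^ 2 * s ^ 4 :=
    fun s hs => sq_mul_pow_le_of_antitoneOn (rearr_antitoneOn hu) (fun s _ => rearr_nonneg s)
      (integrableOn_rearr_sq hu) hs
  refine ⟨_, le_decay_of_bounds
    (A := max (B ^ 2) (5 * ∫ s in Set.Ioi 0, rearr u s ^ 2 * s ^ 4))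
    (fun s _ => rearr_nonneg s) (fun s hs => ?_) h5⟩
  rcases le_total s 1 with h | h
  · refine le_trans ?_ (le_max_left _ _)
    have h1 := hB s hs
    have h2 := rearr_nonneg (u := u) s
    calc rearr u s ^ 2 * s ^ 3 ≤ B ^ 2 * 1 := by
          gcongr
          exact pow_le_one₀ hs.le h
      _ = B ^ 2 := mul_one _
  · refine le_trans ?_ ((h5 s hs).trans (le_max_right _ _))
    gcongr
    norm_num

theorem integral_cumul_levelRad {u : E5 → ℝ} (hu : NiceFn u) {q : ℝ → ℝ} (hq : IsTest q) :
    IntegrableOn (fun t => cumul q (levelRad u t)) (Set.Ioi 0) ∧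
    ∫ t in Set.Ioi 0, cumul q (levelRad u t) = ∫ s in Set.Ioi 0, q s * rearr u s := by
  obtain ⟨C, hC⟩ := rearr_le_decay hu
  have hqf : IntegrableOn (fun s => q s * rearr u s) (Set.Ioi 0) :=
    hq.integrableOn_mul (aemeasurable_rearr_restrict hu).aestronglyMeasurable hC
  set S : Set (ℝ × ℝ) := {p | p.1 < levelRad u p.2} with hS
  have hSm : MeasurableSet S :=
    measurableSet_lt measurable_fst ((measurable_levelRad u).comp measurable_snd)
  set G : ℝ × ℝ → ℝ := S.indicator fun p => q p.1 with hG
  set m := (volume : Measure ℝ).restrict (Set.Ioi 0) with hm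
  have hGm : AEStronglyMeasurable G (m.prod m) :=
    (hq.aestronglyMeasurable.comp_fst).indicator hSm
  have hset : ∀ s, 0 < s → {t | s < levelRad u t} ∩ Set.Ioi 0 = Set.Ioo 0 (rearr u s) := by
    intro s hs
    ext t
    simp only [Set.mem_inter_iff, Set.mem_ofPred_eq, Set.mem_Ioi, Set.mem_Ioo]
    exact ⟨fun h => ⟨h.2, (lt_rearr_iff hu hs.le h.2).2 h.1⟩,
      fun h => ⟨(lt_rearr_iff hu hs.le h.1).1 h.2, h.1⟩⟩
  have hGs : ∀ s, (fun t => G (s, t)) = {t | s < levelRad u t}.indicator fun _ => q s := by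
    intro s; rfl
  have hmeasset : ∀ s, MeasurableSet {t | s < levelRad u t} := fun s =>
    measurableSet_lt measurable_const (measurable_levelRad u)
  have hInt : ∀ (s c : ℝ), 0 < s →
      ∫ t, {t | s < levelRad u t}.indicator (fun _ => c) t ∂m = c * rearr u s := by
    intro s c hs
    rw [integral_indicator (hmeasset s), hm, Measure.restrict_restrict (hmeasset s), hset s hs,
      setIntegral_const, measureReal_def, Real.volume_Ioo, sub_zero,
      ENNReal.toReal_ofReal (rearr_nonneg s), smul_eq_mul, mul_comm]
  have hGi : Integrable G (m.prod m) := by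
    rw [integrable_prod_iff hGm]
    constructor
    · filter_upwards [self_mem_ae_restrict measurableSet_Ioi] with s hs
      rw [hGs, integrable_indicator_iff (hmeasset s), IntegrableOn, hm,
        Measure.restrict_restrict (hmeasset s), hset s hs]
      exact integrableOn_const (by simp) (by simp)
    · refine hqf.norm.congr ?_
      filter_upwards [self_mem_ae_restrict measurableSet_Ioi] with s hs
      have : (fun t => ‖G (s, t)‖) = {t | s < levelRad u t}.indicator fun _ => ‖q s‖ := by
        ext t
        rw [congrFun (hGs s) t, norm_indicator_eq_indicator_norm]
      rw [this, hInt s _ hs, norm_mul, Real.norm_of_nonneg (rearr_nonneg s)]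
  have hslice : ∀ t, ∫ s, G (s, t) ∂m = cumul q (levelRad u t) := by
    intro t
    have : (fun s => G (s, t)) = (Set.Iio (levelRad u t)).indicator q := by
      ext s; rfl
    rw [this, integral_indicator measurableSet_Iio, hm, Measure.restrict_restrict measurableSet_Iio,
      Set.inter_comm, Set.Ioi_inter_Iio, cumul, integral_Ioc_eq_integral_Ioo]
  constructor
  · have := hGi.integral_prod_right
    simp only [hslice] at this
    exact this
  · have e1 := integral_prod G hGi
    have e2 := integral_prod_symm G hGi
    rw [e2] at e1
    simp only [hslice] at e1
    rw [e1]
    refine setIntegral_congr_fun measurableSet_Ioi fun s hs => ?_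
    simp only [hGs]
    exact hInt s _ hs

theorem levelRad_rearr_eq {u : E5 → ℝ} (hu : NiceFn u) {s : ℝ} (hs : 0 < s) (hf : 0 < rearr u s)
    (hat : volume {x | u x = rearr u s} = 0) : levelRad u (rearr u s) = s := by
  set t := rearr u s with ht
  have hle : levelRad u t ≤ s := by
    by_contra h
    exact lt_irrefl t ((lt_rearr_iff hu hs.le hf).2 (not_le.1 h))
  refine le_antisymm hle (not_lt.1 fun hlt => ?_)
  have h1 := lintegral_comp_rearr hu (W := ({t} : Set ℝ).indicator 1)
    (measurable_one.indicator (measurableSet_singleton t)) (by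
      rw [Set.indicator_of_notMem]; simpa using hf.ne)
  have h2 : ∫⁻ x, ({t} : Set ℝ).indicator (1 : ℝ → ℝ≥0∞) (u x) = 0 := by
    have : (fun x => ({t} : Set ℝ).indicator (1 : ℝ → ℝ≥0∞) (u x)) =
        {x | u x = t}.indicator 1 := by ext x; rfl
    rw [this, lintegral_indicator_one₀]
    · exact hat
    · exact (isClosed_eq hu.diff.continuous continuous_const).measurableSet.nullMeasurableSet
  have hm : AEMeasurable (fun s => ({t} : Set ℝ).indicator (1 : ℝ → ℝ≥0∞) (rearr u s))
      radMeasure :=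
    (measurable_one.indicator (measurableSet_singleton t)).comp_aemeasurable (aemeasurable_rearr hu)
  rw [h2, lintegral_eq_zero_iff' hm] at h1
  have h3 : radMeasure (Set.Ioo 0 s \ Set.Ioo 0 (levelRad u t)) = 0 := by
    refine measure_mono_null ?_ (ae_iff.1 h1)
    rintro s' ⟨⟨h0, hs'⟩, hns⟩
    have hge : levelRad u t ≤ s' := not_lt.1 fun h => hns ⟨h0, h⟩
    have : rearr u s' = t := by
      refine le_antisymm (not_lt.1 fun h => ?_) (rearr_antitoneOn hu h0 hs hs'.le)
      exact absurd ((lt_rearr_iff hu h0.le hf).1 h) (not_lt.2 hge)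
    simp [this]
  have h4 : Set.Ioo 0 (levelRad u t) ⊆ Set.Ioo 0 s := Set.Ioo_subset_Ioo_right hle
  have h5 : radMeasure (Set.Ioo 0 s) ≤ radMeasure (Set.Ioo 0 (levelRad u t)) := by
    calc radMeasure (Set.Ioo 0 s) ≤ radMeasure ((Set.Ioo 0 s \ Set.Ioo 0 (levelRad u t)) ∪
          Set.Ioo 0 (levelRad u t)) := measure_mono fun x hx => by
            by_cases h : x ∈ Set.Ioo 0 (levelRad u t)
            · exact Or.inr h
            · exact Or.inl ⟨hx, h⟩
      _ ≤ _ := (measure_union_le _ _).trans (by rw [h3, zero_add])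
  rw [radMeasure_Ioo hs.le, radMeasure_Ioo (levelRad_nonneg _ _)] at h5
  have hβ := unitVol_pos
  have h6 := (ENNReal.ofReal_le_ofReal_iff (by have := levelRad_nonneg u t; positivity)).1 h5
  have h7 : levelRad u t ^ 5 < s ^ 5 := pow_lt_pow_left₀ hlt (levelRad_nonneg _ _) (by norm_num)
  nlinarith

theorem ofReal_integral_le_lintegral {α : Type*} [MeasurableSpace α] {μ : Measure α} {f : α → ℝ}
    (hf : Integrable f μ) : ENNReal.ofReal (∫ x, f x ∂μ) ≤ ∫⁻ x, ENNReal.ofReal (f x) ∂μ := by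
  calc ENNReal.ofReal (∫ x, f x ∂μ) ≤ ENNReal.ofReal (∫ x, max (f x) 0 ∂μ) :=
        ENNReal.ofReal_le_ofReal (integral_mono hf hf.pos_part fun x => le_max_left _ _)
    _ = ∫⁻ x, ENNReal.ofReal (max (f x) 0) ∂μ :=
        ofReal_integral_eq_lintegral_ofReal hf.pos_part (ae_of_all _ fun x => le_max_right _ _)
    _ = _ := by simp

theorem two_mul_ofReal (a : ℝ) : (2 : ℝ≥0∞) * ENNReal.ofReal a = ENNReal.ofReal (2 * a) := by
  rw [ENNReal.ofReal_mul (by norm_num)]; simp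

/-- Pólya–Szegő inequality in dual form. -/
theorem energyLE_rearr {u : E5 → ℝ} (hu : NiceFn u)
    (hg : Integrable fun x => ‖fderiv ℝ u x‖ ^ 2) :
    EnergyLE (rearr u) ((∫ x, ‖fderiv ℝ u x‖ ^ 2) / (5 * unitVol)) := by
  intro q hq
  have hβ := unitVol_pos
  obtain ⟨hi, he⟩ := integral_cumul_levelRad hu hq
  have hum : Measurable u := hu.diff.continuous.measurable
  set A : Set ℝ := {t | 0 < volume {x | u x = t}} with hA
  have hAc : A.Countable := Measure.countable_meas_level_set_pos hum
  have hθm : Measurable fun s => cumul q s / s ^ 4 :=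
    (continuous_cumul hq.integrableOn_Ioc).measurable.div (by fun_prop)
  set w : ℝ → ℝ := (Aᶜ ∩ Set.Ioi 0).indicator fun t =>
    max (cumul q (levelRad u t) / levelRad u t ^ 4) 0 with hw
  have hwm : Measurable w :=
    ((hθm.comp (measurable_levelRad u)).max measurable_const).indicator
      (hAc.measurableSet.compl.inter measurableSet_Ioi)
  have hw0 : ∀ t, 0 ≤ w t := fun t => Set.indicator_nonneg (fun _ _ => le_max_right _ _) _
  have hgm : Measurable fun x => ‖fderiv ℝ u x‖ := (measurable_fderiv ℝ u).norm
  have B := lintegral_mul_levelRad_le hu (w := fun t => ENNReal.ofReal (w t)) hwm.ennreal_ofReal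
  -- the left side
  have L : ENNReal.ofReal (5 * unitVol * ∫ s in Set.Ioi 0, q s * rearr u s) ≤
      ∫⁻ t in Set.Ioi 0, ENNReal.ofReal (w t) *
        ENNReal.ofReal (5 * unitVol * levelRad u t ^ 4) := by
    rw [← he, ← integral_const_mul]
    refine (ofReal_integral_le_lintegral (hi.const_mul _)).trans (lintegral_mono_ae ?_)
    have hA0 : ∀ᵐ t ∂(volume.restrict (Set.Ioi (0 : ℝ))), t ∉ A :=
      ae_restrict_of_ae (measure_eq_zero_iff_ae_notMem.1 (hAc.measure_zero volume))
    filter_upwards [hA0, self_mem_ae_restrict measurableSet_Ioi] with t htA ht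
    rw [← ENNReal.ofReal_mul (hw0 t)]
    refine ENNReal.ofReal_le_ofReal ?_
    rw [hw, Set.indicator_of_mem (show t ∈ Aᶜ ∩ Set.Ioi 0 from ⟨htA, ht⟩)]
    rcases (levelRad_nonneg u t).eq_or_lt with h0 | h0
    · rw [← h0, cumul_of_nonpos q le_rfl]; simp
    · have : cumul q (levelRad u t) =
          cumul q (levelRad u t) / levelRad u t ^ 4 * levelRad u t ^ 4 := by field_simp
      calc 5 * unitVol * cumul q (levelRad u t)
          = 5 * unitVol * (cumul q (levelRad u t) / levelRad u t ^ 4 * levelRad u t ^ 4) := by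
            rw [← this]
        _ ≤ 5 * unitVol * (max (cumul q (levelRad u t) / levelRad u t ^ 4) 0 *
              levelRad u t ^ 4) := by
            gcongr; exact le_max_left _ _
        _ = _ := by ring
  -- the right side
  have hw2 : ∫⁻ x, ENNReal.ofReal (w (u x) ^ 2) ≤
      ENNReal.ofReal (5 * unitVol * ∫ r in Set.Ioi 0, cumul q r ^ 2 / r ^ 4) := by
    have hm : AEMeasurable (fun s => ENNReal.ofReal (w (rearr u s) ^ 2))
        (volume.restrict (Set.Ioi 0)) :=
      (hwm.pow_const 2).ennreal_ofReal.comp_aemeasurable (aemeasurable_rearr_restrict hu)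
    rw [← lintegral_comp_rearr hu (W := fun t => ENNReal.ofReal (w t ^ 2)) (by fun_prop)
      (by simp [hw]), lintegral_radMeasure hm,
      ← integral_const_mul, ofReal_integral_eq_lintegral_ofReal (hq.sq.const_mul _)
        (ae_of_all _ fun s => by positivity)]
    refine setLIntegral_mono' measurableSet_Ioi fun s hs => ?_
    have hs' : (0 : ℝ) < s := hs
    rw [← ENNReal.ofReal_mul (by positivity)]
    refine ENNReal.ofReal_le_ofReal ?_
    rw [mul_assoc]
    refine mul_le_mul_of_nonneg_left ?_ (by positivity)
    by_cases hmem : rearr u s ∈ Aᶜ ∩ Set.Ioi 0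
    · rw [hw, Set.indicator_of_mem hmem, levelRad_rearr_eq hu hs hmem.2 (by
        have h := hmem.1; simpa [hA] using h)]
      have h1 : max (cumul q s / s ^ 4) 0 ^ 2 ≤ (cumul q s / s ^ 4) ^ 2 := by
        rcases le_total (cumul q s / s ^ 4) 0 with h | h
        · rw [max_eq_right h]; simp; positivity
        · rw [max_eq_left h]
      calc s ^ 4 * max (cumul q s / s ^ 4) 0 ^ 2 ≤ s ^ 4 * (cumul q s / s ^ 4) ^ 2 := by gcongr
        _ = _ := by field_simp
    · rw [hw, Set.indicator_of_notMem hmem]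
      simp only [ne_eq, OfNat.ofNat_ne_zero, not_false_eq_true, zero_pow, mul_zero]
      positivity
  have R : 2 * ∫⁻ x, ENNReal.ofReal (w (u x)) * ENNReal.ofReal ‖fderiv ℝ u x‖ ≤
      (∫⁻ x, ENNReal.ofReal (w (u x) ^ 2)) + ∫⁻ x, ENNReal.ofReal (‖fderiv ℝ u x‖ ^ 2) := by
    rw [← lintegral_const_mul' _ _ (by simp), ← lintegral_add_right _ (by fun_prop)]
    refine lintegral_mono fun x => ?_
    rw [← ENNReal.ofReal_mul (hw0 _), ← ENNReal.ofReal_add (by positivity) (by positivity)]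
    rw [two_mul_ofReal]
    refine ENNReal.ofReal_le_ofReal ?_
    nlinarith [sq_nonneg (w (u x) - ‖fderiv ℝ u x‖)]
  have hfin : 2 * ENNReal.ofReal (5 * unitVol * ∫ s in Set.Ioi 0, q s * rearr u s) ≤
      ENNReal.ofReal (5 * unitVol * (∫ r in Set.Ioi 0, cumul q r ^ 2 / r ^ 4) +
        ∫ x, ‖fderiv ℝ u x‖ ^ 2) := by
    refine (mul_le_mul_right (L.trans B) 2).trans (R.trans ?_)
    rw [ENNReal.ofReal_add (mul_nonneg (by positivity) (integral_nonneg fun r => by positivity))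
      (integral_nonneg fun x => by positivity),
      ofReal_integral_eq_lintegral_ofReal hg (ae_of_all _ fun x => by positivity)]
    exact add_le_add_left hw2 _
  rw [two_mul_ofReal,
    ENNReal.ofReal_le_ofReal_iff (add_nonneg
      (mul_nonneg (by positivity) (integral_nonneg fun r => by positivity))
      (integral_nonneg fun x => by positivity))] at hfin
  rw [le_div_iff₀ (by positivity)]
  linarith

/-- The solution of `r⁴F'' + 4r³F' = k² r⁴ F` that is regular at the origin. -/
noncomputable def greenI (k r : ℝ) : ℝ := (k * r * Real.cosh (k * r) - Real.sinh (k * r)) / r ^ 3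

/-- The solution of `r⁴F'' + 4r³F' = k² r⁴ F` that decays at infinity. -/
noncomputable def greenK (k r : ℝ) : ℝ := Real.exp (-(k * r)) * (1 + k * r) / r ^ 3

/-- The flux `r⁴ greenI'`. -/
noncomputable def fluxI (k r : ℝ) : ℝ :=
  (k * r) ^ 2 * Real.sinh (k * r) - 3 * (k * r) * Real.cosh (k * r) + 3 * Real.sinh (k * r)

/-- The flux `-r⁴ greenK'`. -/
noncomputable def fluxK (k r : ℝ) : ℝ := Real.exp (-(k * r)) * ((k * r) ^ 2 + 3 * (k * r) + 3)

section Green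

variable {k : ℝ}

theorem hasDerivAt_greenI {r : ℝ} (hr : 0 < r) :
    HasDerivAt (greenI k) (fluxI k r / r ^ 4) r := by
  have h1 : HasDerivAt (fun r => k * r) k r := by simpa using (hasDerivAt_id r).const_mul k
  have h2 := ((h1.mul h1.cosh).sub h1.sinh).div (hasDerivAt_pow 3 r) (by positivity)
  refine h2.congr_deriv ?_
  unfold fluxI
  simp only [Pi.mul_apply, Pi.sub_apply]
  field_simp
  push_cast
  ring

theorem hasDerivAt_greenK {r : ℝ} (hr : 0 < r) :
    HasDerivAt (greenK k) (-fluxK k r / r ^ 4) r := by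
  have h1 : HasDerivAt (fun r => k * r) k r := by simpa using (hasDerivAt_id r).const_mul k
  have h2 := (h1.neg.exp.mul (h1.const_add 1)).div (hasDerivAt_pow 3 r) (by positivity)
  refine h2.congr_deriv ?_
  unfold fluxK
  simp only [Pi.mul_apply, Pi.neg_apply]
  field_simp
  push_cast
  ring

theorem hasDerivAt_fluxI {r : ℝ} (_hr : 0 < r) :
    HasDerivAt (fluxI k) (k ^ 2 * (r ^ 4 * greenI k r)) r := by
  have h1 : HasDerivAt (fun r => k * r) k r := by simpa using (hasDerivAt_id r).const_mul k
  have h2 := (((h1.pow 2).mul h1.sinh).sub ((h1.const_mul 3).mul h1.cosh)).add (h1.sinh.const_mul 3)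
  refine h2.congr_deriv ?_
  unfold greenI
  simp only [Pi.pow_apply]
  field_simp
  push_cast
  ring

theorem hasDerivAt_fluxK {r : ℝ} (_hr : 0 < r) :
    HasDerivAt (fluxK k) (-(k ^ 2 * (r ^ 4 * greenK k r))) r := by
  have h1 : HasDerivAt (fun r => k * r) k r := by simpa using (hasDerivAt_id r).const_mul k
  have h2 := h1.neg.exp.mul (((h1.pow 2).add (h1.const_mul 3)).add_const 3)
  refine h2.congr_deriv ?_
  unfold greenK
  simp only [Pi.add_apply, Pi.neg_apply, Pi.pow_apply]
  field_simp
  push_cast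
  ring

theorem green_wronskian {r : ℝ} (hr : 0 < r) :
    fluxI k r * greenK k r + greenI k r * fluxK k r = k ^ 3 := by
  have h := Real.cosh_add_sinh (k * r)
  have h' : Real.exp (-(k * r)) * Real.exp (k * r) = 1 := by rw [← Real.exp_add]; simp
  rw [← h] at h'
  unfold fluxI greenK greenI fluxK
  field_simp
  linear_combination (k * r) ^ 3 * h'


theorem greenI_nonneg (hk : 0 < k) {r : ℝ} (hr : 0 < r) : 0 ≤ greenI k r := by
  have key : MonotoneOn (fun x : ℝ => x * Real.cosh x - Real.sinh x) (Set.Ici 0) := by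
    refine monotoneOn_of_hasDerivWithinAt_nonneg (f' := fun x => x * Real.sinh x)
      (convex_Ici 0) (by fun_prop) (fun x _ => ?_) fun x hx => ?_
    · refine HasDerivAt.hasDerivWithinAt ?_
      refine (((hasDerivAt_id x).mul (Real.hasDerivAt_cosh x)).sub
        (Real.hasDerivAt_sinh x)).congr_deriv ?_
      simp
    · rw [interior_Ici] at hx
      exact mul_nonneg hx.le (Real.sinh_nonneg_iff.2 hx.le)
  have h := key (Set.self_mem_Ici) (show k * r ∈ Set.Ici 0 from (mul_pos hk hr).le) (mul_pos hk hr).le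
  simp only [Real.cosh_zero, Real.sinh_zero, zero_mul, sub_zero] at h
  exact div_nonneg h (by positivity)

theorem greenK_pos (hk : 0 < k) {r : ℝ} (hr : 0 < r) : 0 < greenK k r := by
  unfold greenK; positivity

theorem fluxK_pos (hk : 0 < k) {r : ℝ} (hr : 0 ≤ r) : 0 < fluxK k r := by
  unfold fluxK; positivity

theorem continuous_fluxI : Continuous (fluxI k) := by unfold fluxI; fun_prop

theorem continuous_fluxK : Continuous (fluxK k) := by unfold fluxK; fun_prop

theorem continuousOn_greenI : ContinuousOn (greenI k) (Set.Ioi 0) := fun _ hr =>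
  (hasDerivAt_greenI hr).continuousAt.continuousWithinAt

theorem continuousOn_greenK : ContinuousOn (greenK k) (Set.Ioi 0) := fun _ hr =>
  (hasDerivAt_greenK hr).continuousAt.continuousWithinAt

theorem fluxI_nonneg (hk : 0 < k) {r : ℝ} (hr : 0 ≤ r) : 0 ≤ fluxI k r := by
  have key : MonotoneOn (fluxI k) (Set.Ici 0) := by
    refine monotoneOn_of_hasDerivWithinAt_nonneg (f' := fun r => k ^ 2 * (r ^ 4 * greenI k r))
      (convex_Ici 0) continuous_fluxI.continuousOn (fun x hx => ?_) fun x hx => ?_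
    · rw [interior_Ici] at hx; exact (hasDerivAt_fluxI hx).hasDerivWithinAt
    · rw [interior_Ici] at hx
      have := greenI_nonneg hk hx
      positivity
  have h := key (Set.self_mem_Ici) hr hr
  simpa [fluxI] using h

theorem fluxK_antitoneOn (hk : 0 < k) : AntitoneOn (fluxK k) (Set.Ici 0) := by
  refine antitoneOn_of_hasDerivWithinAt_nonpos (f' := fun r => -(k ^ 2 * (r ^ 4 * greenK k r)))
    (convex_Ici 0) continuous_fluxK.continuousOn (fun x hx => ?_) fun x hx => ?_
  · rw [interior_Ici] at hx; exact (hasDerivAt_fluxK hx).hasDerivWithinAt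
  · rw [interior_Ici] at hx
    have := greenK_pos hk hx
    have h : 0 ≤ k ^ 2 * (x ^ 4 * greenK k x) := by positivity
    linarith

theorem fluxK_le_three (hk : 0 < k) {r : ℝ} (hr : 0 ≤ r) : fluxK k r ≤ 3 := by
  have h := fluxK_antitoneOn hk Set.self_mem_Ici hr hr
  simpa [fluxK] using h

theorem greenI_le (hk : 0 < k) {s r : ℝ} (hs : 0 < s) (hsr : s ≤ r) :
    greenI k s ≤ k ^ 3 / fluxK k r := by
  have hr := hs.trans_le hsr
  rw [le_div_iff₀ (fluxK_pos hk hr.le)]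
  calc greenI k s * fluxK k r ≤ greenI k s * fluxK k s :=
        mul_le_mul_of_nonneg_left (fluxK_antitoneOn hk hs.le hr.le hsr) (greenI_nonneg hk hs)
    _ ≤ fluxI k s * greenK k s + greenI k s * fluxK k s :=
        le_add_of_nonneg_left (mul_nonneg (fluxI_nonneg hk hs.le) (greenK_pos hk hs).le)
    _ = k ^ 3 := green_wronskian hs

theorem tendsto_fluxK (hk : 0 < k) : Tendsto (fluxK k) atTop (𝓝 0) := by
  have h1 : Tendsto (fun r : ℝ => k * r) atTop atTop := tendsto_id.const_mul_atTop hk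
  have h2 := (((Real.tendsto_pow_mul_exp_neg_atTop_nhds_zero 2).add
    ((Real.tendsto_pow_mul_exp_neg_atTop_nhds_zero 1).const_mul 3)).add
    ((Real.tendsto_pow_mul_exp_neg_atTop_nhds_zero 0).const_mul 3)).comp h1
  simp only [mul_zero, add_zero] at h2
  refine h2.congr fun r => ?_
  simp only [Function.comp_apply, fluxK]
  ring

theorem integrableOn_greenK (hk : 0 < k) {r : ℝ} (hr : 0 < r) :
    IntegrableOn (fun s => s ^ 4 * greenK k s) (Set.Ioi r) ∧
      ∫ s in Set.Ioi r, s ^ 4 * greenK k s = fluxK k r / k ^ 2 := by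
  have hd : ∀ x ∈ Set.Ici r, HasDerivAt (fluxK k) (-(k ^ 2 * (x ^ 4 * greenK k x))) x :=
    fun x hx => hasDerivAt_fluxK (hr.trans_le hx)
  have hn : ∀ x ∈ Set.Ioi r, -(k ^ 2 * (x ^ 4 * greenK k x)) ≤ 0 := fun x hx => by
    have hx0 : 0 < x := hr.trans hx
    have := greenK_pos hk hx0
    have h : 0 ≤ k ^ 2 * (x ^ 4 * greenK k x) := by positivity
    linarith
  have h1 := integrableOn_Ioi_deriv_of_nonpos' hd hn (tendsto_fluxK hk)
  have h2 := integral_Ioi_of_hasDerivAt_of_nonpos' hd hn (tendsto_fluxK hk)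
  constructor
  · have h3 := h1.const_mul (-(k ^ 2)⁻¹)
    refine h3.congr (ae_of_all _ fun s => ?_)
    field_simp
  · rw [integral_neg, integral_const_mul] at h2
    rw [eq_div_iff (by positivity)]
    linarith

theorem integral_greenI (hk : 0 < k) {r : ℝ} (hr : 0 < r) :
    IntegrableOn (fun s => s ^ 4 * greenI k s) (Set.Ioc 0 r) ∧
      ∫ s in Set.Ioc 0 r, s ^ 4 * greenI k s = fluxI k r / k ^ 2 := by
  have e : (fun s => s ^ 4 * greenI k s) =
      fun s => s * (k * s * Real.cosh (k * s) - Real.sinh (k * s)) := by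
    ext s
    unfold greenI
    rcases eq_or_ne s 0 with rfl | h
    · simp
    · field_simp
  have hi : IntervalIntegrable (fun s => s ^ 4 * greenI k s) volume 0 r := by
    rw [e]; exact Continuous.intervalIntegrable (by fun_prop) _ _
  refine ⟨(intervalIntegrable_iff_integrableOn_Ioc_of_le hr.le).1 hi, ?_⟩
  rw [← intervalIntegral.integral_of_le hr.le]
  have h := intervalIntegral.integral_eq_sub_of_hasDerivAt_of_le hr.le
    (continuous_fluxI (k := k)).continuousOn (fun x hx => hasDerivAt_fluxI hx.1) (hi.const_mul _)
  rw [intervalIntegral.integral_const_mul] at h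
  rw [eq_div_iff (by positivity)]
  simp only [fluxI, mul_zero, Real.sinh_zero] at h ⊢
  linarith

end Green

/-- `F` solves `-r⁴F'' - 4r³F' + k² r⁴ F = r⁴ h` with flux `Θ = -r⁴F'`, `F` and `Θ` being nonnegative. -/
structure IsPotential (k : ℝ) (h F Θ : ℝ → ℝ) : Prop where
  contF : ContinuousOn F (Set.Ioi 0)
  contΘ : ContinuousOn Θ (Set.Ioi 0)
  F_nonneg : ∀ r, 0 < r → 0 ≤ F r
  Θ_nonneg : ∀ r, 0 < r → 0 ≤ Θ r
  F_sub : ∀ a b, 0 < a → a ≤ b → F a - F b = ∫ s in a..b, Θ s / s ^ 4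
  Θ_sub : ∀ a b, 0 < a → a ≤ b → Θ b - Θ a = ∫ s in a..b, s ^ 4 * (h s - k ^ 2 * F s)
  Θ_zero : Tendsto Θ (𝓝[>] 0) (𝓝 0)

theorem countable_discontinuity {h : ℝ → ℝ} (hh : AntitoneOn h (Set.Ioi 0)) :
    {x | 0 < x ∧ ¬ContinuousAt h x}.Countable := by
  refine (hh.neg.countable_not_continuousWithinAt).mono ?_
  rintro x ⟨hx, hc⟩
  refine ⟨hx, fun h' => hc ?_⟩
  have h2 : ContinuousAt (fun x => -h x) x := h'.continuousAt (Ioi_mem_nhds hx)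
  exact h2.neg.congr (Eventually.of_forall fun y => neg_neg _)

theorem exists_isPotential {k : ℝ} (hk : 0 < k) {h : ℝ → ℝ} (hh : AntitoneOn h (Set.Ioi 0))
    (h0 : ∀ s, 0 < s → 0 ≤ h s) (hi : ∀ r, IntegrableOn (fun s => s ^ 4 * h s) (Set.Ioc 0 r)) :
    ∃ F Θ : ℝ → ℝ, IsPotential k h F Θ := by
  have hhm : AEStronglyMeasurable h (volume.restrict (Set.Ioi 0)) :=
    (aemeasurable_restrict_of_antitoneOn measurableSet_Ioi hh).aestronglyMeasurable
  have hIm : AEStronglyMeasurable (greenI k) (volume.restrict (Set.Ioi 0)) :=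
    continuousOn_greenI.aestronglyMeasurable measurableSet_Ioi
  have hKm : AEStronglyMeasurable (greenK k) (volume.restrict (Set.Ioi 0)) :=
    continuousOn_greenK.aestronglyMeasurable measurableSet_Ioi
  set p : ℝ → ℝ := fun s => s ^ 4 * greenI k s * h s with hp
  set q : ℝ → ℝ := fun s => s ^ 4 * greenK k s * h s with hq
  have hpm : AEStronglyMeasurable p (volume.restrict (Set.Ioi 0)) :=
    ((continuous_pow 4).aestronglyMeasurable.mul hIm).mul hhm
  have hqm : AEStronglyMeasurable q (volume.restrict (Set.Ioi 0)) :=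
    ((continuous_pow 4).aestronglyMeasurable.mul hKm).mul hhm
  have hp0 : ∀ s, 0 < s → 0 ≤ p s := fun s hs =>
    mul_nonneg (mul_nonneg (by positivity) (greenI_nonneg hk hs)) (h0 s hs)
  have hq0 : ∀ s, 0 < s → 0 ≤ q s := fun s hs =>
    mul_nonneg (mul_nonneg (by positivity) (greenK_pos hk hs).le) (h0 s hs)
  have hple : ∀ r s, 0 < s → s ≤ r → p s ≤ k ^ 3 / fluxK k r * (s ^ 4 * h s) := fun r s hs hsr => by
    have h1 := mul_le_mul_of_nonneg_right (greenI_le hk hs hsr)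
      (mul_nonneg (pow_nonneg hs.le 4) (h0 s hs))
    calc p s = greenI k s * (s ^ 4 * h s) := by rw [hp]; ring
      _ ≤ _ := h1
  have hpi : ∀ r, IntegrableOn p (Set.Ioc 0 r) := fun r => by
    refine ((hi r).const_mul (k ^ 3 / fluxK k r)).mono'
      (hpm.mono_measure (Measure.restrict_mono Set.Ioc_subset_Ioi_self le_rfl)) ?_
    filter_upwards [self_mem_ae_restrict measurableSet_Ioc] with s hs
    rw [Real.norm_of_nonneg (hp0 s hs.1)]
    exact hple r s hs.1 hs.2
  have hqle : ∀ r s, 0 < r → r ≤ s → q s ≤ h r * (s ^ 4 * greenK k s) := fun r s hr hrs => by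
    have hs := hr.trans_le hrs
    have := mul_le_mul_of_nonneg_left (hh hr hs hrs)
      (mul_nonneg (pow_nonneg hs.le 4) (greenK_pos hk hs).le)
    calc q s = s ^ 4 * greenK k s * h s := rfl
      _ ≤ s ^ 4 * greenK k s * h r := this
      _ = _ := by ring
  have hqi : ∀ r, 0 < r → IntegrableOn q (Set.Ioi r) := fun r hr => by
    refine ((integrableOn_greenK hk hr).1.const_mul (h r)).mono'
      (hqm.mono_measure (Measure.restrict_mono (Set.Ioi_subset_Ioi hr.le) le_rfl)) ?_
    filter_upwards [self_mem_ae_restrict measurableSet_Ioi] with s hs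
    rw [Real.norm_of_nonneg (hq0 s (hr.trans hs))]
    exact hqle r s hr (le_of_lt hs)
  set X : ℝ → ℝ := fun r => ∫ s in (0)..r, p s with hX
  set Y : ℝ → ℝ := fun r => (∫ s in Set.Ioi 1, q s) - ∫ s in (1)..r, q s with hY
  have hXeq : ∀ r, 0 < r → X r = ∫ s in Set.Ioc 0 r, p s := fun r hr =>
    intervalIntegral.integral_of_le hr.le
  have hpI : ∀ r, 0 < r → IntervalIntegrable p volume 0 r := fun r hr =>
    (intervalIntegrable_iff_integrableOn_Ioc_of_le hr.le).2 (hpi r)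
  have hqI : ∀ a b, 0 < a → 0 < b → IntervalIntegrable q volume a b := fun a b ha hb => by
    rw [intervalIntegrable_iff]
    exact (hqi (min a b / 2) (by positivity)).mono_set fun x hx => by
      have := hx.1
      have h2 : 0 < min a b := lt_min ha hb
      simp only [Set.mem_Ioi]
      linarith
  have hYeq : ∀ r, 0 < r → Y r = ∫ s in Set.Ioi r, q s := fun r hr => by
    have := intervalIntegral.integral_Ioi_sub_Ioi' (hqi 1 one_pos) (hqi r hr)
    simp only [hY]
    linarith
  have hX0 : ∀ r, 0 < r → 0 ≤ X r := fun r hr => by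
    rw [hXeq r hr]; exact setIntegral_nonneg measurableSet_Ioc fun s hs => hp0 s hs.1
  have hY0 : ∀ r, 0 < r → 0 ≤ Y r := fun r hr => by
    rw [hYeq r hr]; exact setIntegral_nonneg measurableSet_Ioi fun s hs => hq0 s (hr.trans hs)
  have hXc : ContinuousOn X (Set.Ioi 0) := fun r hr => by
    have hr' : (0 : ℝ) < r := hr
    have h1 := intervalIntegral.continuousOn_primitive_interval (μ := volume) (f := p) (a := 0)
      (b := r + 1) (by rw [Set.uIcc_of_le (by linarith), integrableOn_Icc_iff_integrableOn_Ioc]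
                       exact hpi _)
    rw [Set.uIcc_of_le (by linarith)] at h1
    exact (h1.continuousAt (Icc_mem_nhds hr' (by linarith))).continuousWithinAt
  have hYc : ContinuousOn Y (Set.Ioi 0) := fun r hr => by
    have hr' : (0 : ℝ) < r := hr
    have h1 := intervalIntegral.continuousOn_primitive_interval' (μ := volume) (f := q) (a := 1)
      (b₁ := min 1 r / 2) (b₂ := max 1 r + 1)
      (hqI _ _ (by positivity) (by positivity)) (by
        rw [Set.uIcc_of_le (by linarith [min_le_max (a := 1) (b := r), lt_min one_pos hr'])]
        exact ⟨by linarith [min_le_left 1 r, lt_min one_pos hr'], by linarith [le_max_left 1 r]⟩)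
    rw [Set.uIcc_of_le (by linarith [min_le_max (a := 1) (b := r), lt_min one_pos hr'])] at h1
    have h2 := h1.continuousAt (Icc_mem_nhds (x := r)
      (by linarith [min_le_right 1 r, lt_min one_pos hr']) (by linarith [le_max_right 1 r]))
    exact (continuousAt_const.sub h2).continuousWithinAt
  set D : Set ℝ := {x | 0 < x ∧ ¬ContinuousAt h x} with hD
  have hDc : D.Countable := countable_discontinuity hh
  have hXd : ∀ r, 0 < r → r ∉ D → HasDerivAt X (p r) r := fun r hr hrD => by
    have hc : ContinuousAt h r := by by_contra hc; exact hrD ⟨hr, hc⟩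
    refine intervalIntegral.integral_hasDerivAt_right (hpI r hr)
      ⟨Set.Ioi 0, Ioi_mem_nhds hr, hpm⟩ ?_
    exact (((continuous_pow 4).continuousAt).mul (hasDerivAt_greenI hr).continuousAt).mul hc
  have hYd : ∀ r, 0 < r → r ∉ D → HasDerivAt Y (-q r) r := fun r hr hrD => by
    have hc : ContinuousAt h r := by by_contra hc; exact hrD ⟨hr, hc⟩
    refine (intervalIntegral.integral_hasDerivAt_right (hqI 1 r one_pos hr)
      ⟨Set.Ioi 0, Ioi_mem_nhds hr, hqm⟩ ?_).const_sub _
    exact (((continuous_pow 4).continuousAt).mul (hasDerivAt_greenK hr).continuousAt).mul hc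
  set F : ℝ → ℝ := fun r => (k ^ 3)⁻¹ * (greenK k r * X r + greenI k r * Y r) with hF
  set Θ : ℝ → ℝ := fun r => (k ^ 3)⁻¹ * (fluxK k r * X r - fluxI k r * Y r) with hΘ
  have hFc : ContinuousOn F (Set.Ioi 0) := continuousOn_const.mul
    ((continuousOn_greenK.mul hXc).add (continuousOn_greenI.mul hYc))
  have hΘc : ContinuousOn Θ (Set.Ioi 0) := continuousOn_const.mul
    ((continuous_fluxK.continuousOn.mul hXc).sub (continuous_fluxI.continuousOn.mul hYc))
  have hXge : ∀ r, 0 < r → h r * (fluxI k r / k ^ 2) ≤ X r := fun r hr => by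
    rw [hXeq r hr, ← (integral_greenI hk hr).2, ← integral_const_mul]
    refine setIntegral_mono_on ((integral_greenI hk hr).1.const_mul _) (hpi r) measurableSet_Ioc
      fun s hs => ?_
    have := mul_le_mul_of_nonneg_left (hh hs.1 hr hs.2)
      (mul_nonneg (pow_nonneg hs.1.le 4) (greenI_nonneg hk hs.1))
    calc h r * (s ^ 4 * greenI k s) = s ^ 4 * greenI k s * h r := by ring
      _ ≤ _ := this
  have hYle : ∀ r, 0 < r → Y r ≤ h r * (fluxK k r / k ^ 2) := fun r hr => by
    rw [hYeq r hr, ← (integrableOn_greenK hk hr).2, ← integral_const_mul]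
    exact setIntegral_mono_on (hqi r hr) ((integrableOn_greenK hk hr).1.const_mul _)
      measurableSet_Ioi fun s hs => hqle r s hr (le_of_lt hs)
  refine ⟨F, Θ, hFc, hΘc, fun r hr => ?_, fun r hr => ?_, fun a b ha hab => ?_,
    fun a b ha hab => ?_, ?_⟩
  · exact mul_nonneg (by positivity) (add_nonneg (mul_nonneg (greenK_pos hk hr).le (hX0 r hr))
      (mul_nonneg (greenI_nonneg hk hr) (hY0 r hr)))
  · refine mul_nonneg (by positivity) (sub_nonneg.2 ?_)
    calc fluxI k r * Y r ≤ fluxI k r * (h r * (fluxK k r / k ^ 2)) :=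
          mul_le_mul_of_nonneg_left (hYle r hr) (fluxI_nonneg hk hr.le)
      _ = fluxK k r * (h r * (fluxI k r / k ^ 2)) := by ring
      _ ≤ fluxK k r * X r := mul_le_mul_of_nonneg_left (hXge r hr) (fluxK_pos hk hr.le).le
  · have hsub : Set.uIcc a b ⊆ Set.Ioi 0 := by
      rw [Set.uIcc_of_le hab]; exact fun x hx => ha.trans_le hx.1
    have := integral_eq_of_hasDerivAt_off_countable F (fun s => -(Θ s / s ^ 4)) hDc
      (hFc.mono hsub) (fun r hr => ?_) ?_
    · rw [intervalIntegral.integral_neg] at this; linarith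
    · have hr0 : 0 < r := by
        have := hr.1.1; rw [min_eq_left hab] at this; exact ha.trans this
      refine ((((hasDerivAt_greenK hr0).mul (hXd r hr0 hr.2)).add
        ((hasDerivAt_greenI hr0).mul (hYd r hr0 hr.2))).const_mul (k ^ 3)⁻¹).congr_deriv ?_
      simp only [hΘ, hp, hq]
      ring
    · refine ContinuousOn.intervalIntegrable ?_
      exact ((hΘc.mono hsub).div (continuousOn_pow 4)
        fun x hx => pow_ne_zero 4 (hsub hx).ne').neg
  · have hsub : Set.uIcc a b ⊆ Set.Ioi 0 := by
      rw [Set.uIcc_of_le hab]; exact fun x hx => ha.trans_le hx.1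
    refine (integral_eq_of_hasDerivAt_off_countable Θ _ hDc
      (hΘc.mono hsub) (fun r hr => ?_) ?_).symm
    · have hr0 : 0 < r := by
        have := hr.1.1; rw [min_eq_left hab] at this; exact ha.trans this
      refine ((((hasDerivAt_fluxK hr0).mul (hXd r hr0 hr.2)).sub
        ((hasDerivAt_fluxI hr0).mul (hYd r hr0 hr.2))).const_mul (k ^ 3)⁻¹).congr_deriv ?_
      have hw := green_wronskian (k := k) hr0
      have : h r = (k ^ 3)⁻¹ * (fluxI k r * greenK k r + greenI k r * fluxK k r) * h r := by
        rw [hw]; field_simp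
      rw [this]
      simp only [hF, hp, hq]
      ring
    · have h1 : IntervalIntegrable (fun s => s ^ 4 * h s) volume a b :=
        (intervalIntegrable_iff_integrableOn_Ioc_of_le hab).2
          ((hi b).mono_set (Set.Ioc_subset_Ioc_left ha.le))
      have h2 : IntervalIntegrable (fun s => s ^ 4 * (k ^ 2 * F s)) volume a b :=
        ((continuousOn_pow 4).mul (continuousOn_const.mul (hFc.mono hsub))).intervalIntegrable
      simpa only [mul_sub] using h1.sub h2
  · have hXt : Tendsto X (𝓝[>] 0) (𝓝 0) := by
      have h1 := intervalIntegral.continuousOn_primitive_interval (μ := volume) (f := p) (a := 0)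
        (b := 1) (by rw [Set.uIcc_of_le (by linarith), integrableOn_Icc_iff_integrableOn_Ioc]
                     exact hpi _)
      rw [Set.uIcc_of_le zero_le_one] at h1
      have h2 := (h1 0 (by simp)).tendsto
      simp only [intervalIntegral.integral_same] at h2
      refine h2.mono_left ?_
      rw [← nhdsWithin_Ioc_eq_nhdsGT (zero_lt_one' ℝ)]
      exact nhdsWithin_mono _ Set.Ioc_subset_Icc_self
    have hub : Tendsto (fun r => (k ^ 3)⁻¹ * (3 * X r)) (𝓝[>] 0) (𝓝 0) := by
      simpa using (hXt.const_mul 3).const_mul (k ^ 3)⁻¹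
    refine tendsto_of_tendsto_of_tendsto_of_le_of_le' tendsto_const_nhds hub ?_ ?_
    · filter_upwards [self_mem_nhdsWithin] with r hr
      have hr : 0 < r := hr
      refine mul_nonneg (by positivity) (sub_nonneg.2 ?_)
      calc fluxI k r * Y r ≤ fluxI k r * (h r * (fluxK k r / k ^ 2)) :=
            mul_le_mul_of_nonneg_left (hYle r hr) (fluxI_nonneg hk hr.le)
        _ = fluxK k r * (h r * (fluxI k r / k ^ 2)) := by ring
        _ ≤ fluxK k r * X r := mul_le_mul_of_nonneg_left (hXge r hr) (fluxK_pos hk hr.le).le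
    · filter_upwards [self_mem_nhdsWithin] with r hr
      have hr : 0 < r := hr
      refine mul_le_mul_of_nonneg_left ?_ (by positivity)
      have h1 := mul_le_mul_of_nonneg_right (fluxK_le_three hk hr.le) (hX0 r hr)
      have h2 := mul_nonneg (fluxI_nonneg hk hr.le) (hY0 r hr)
      linarith

theorem integrableOn_Ioi_of_le_rpow {g : ℝ → ℝ} {C a b : ℝ}
    (hg : AEStronglyMeasurable g (volume.restrict (Set.Ioi 0))) (ha : -1 < a) (hb : b < -1)
    (h1 : ∀ s, 0 < s → s ≤ 1 → |g s| ≤ C * s ^ a) (h2 : ∀ s, 1 ≤ s → |g s| ≤ C * s ^ b) :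
    IntegrableOn g (Set.Ioi 0) := by
  rw [← Set.Ioc_union_Ioi_eq_Ioi zero_le_one, integrableOn_union]
  constructor
  · have hi : IntegrableOn (fun s : ℝ => s ^ a) (Set.Ioc 0 1) :=
      (intervalIntegrable_iff_integrableOn_Ioc_of_le zero_le_one).1
        (intervalIntegral.intervalIntegrable_rpow' ha)
    refine (hi.const_mul C).mono'
      (hg.mono_measure (Measure.restrict_mono Set.Ioc_subset_Ioi_self le_rfl)) ?_
    filter_upwards [self_mem_ae_restrict measurableSet_Ioc] with s hs
    exact h1 s hs.1 hs.2
  · have hi : IntegrableOn (fun s : ℝ => s ^ b) (Set.Ioi 1) := integrableOn_Ioi_rpow_of_lt hb one_pos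
    refine (hi.const_mul C).mono'
      (hg.mono_measure (Measure.restrict_mono (Set.Ioi_subset_Ioi zero_le_one) le_rfl)) ?_
    filter_upwards [self_mem_ae_restrict measurableSet_Ioi] with s hs
    exact h2 s (le_of_lt hs)

theorem decay_le_left (s : ℝ) : decay s ≤ s ^ (-(3 / 2) : ℝ) := min_le_left _ _

theorem decay_le_right (s : ℝ) : decay s ≤ s ^ (-(5 / 2) : ℝ) := min_le_right _ _

theorem pow_four_mul_decay_sq_le {s : ℝ} (hs : 0 < s) : s ^ 4 * decay s ^ 2 ≤ s := by
  calc s ^ 4 * decay s ^ 2 ≤ s ^ 4 * (s ^ (-(3 / 2) : ℝ)) ^ 2 := by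
        have := decay_le_left s; have := (decay_pos hs).le; gcongr
    _ = s := by
        rw [← Real.rpow_natCast, ← Real.rpow_natCast, ← Real.rpow_mul hs.le, ← Real.rpow_add hs]
        norm_num

theorem pow_four_mul_decay_sq_le_inv {s : ℝ} (hs : 0 < s) : s ^ 4 * decay s ^ 2 ≤ s ^ (-1 : ℝ) := by
  calc s ^ 4 * decay s ^ 2 ≤ s ^ 4 * (s ^ (-(5 / 2) : ℝ)) ^ 2 := by
        have := decay_le_right s; have := (decay_pos hs).le; gcongr
    _ = s ^ (-1 : ℝ) := by
        rw [← Real.rpow_natCast, ← Real.rpow_natCast, ← Real.rpow_mul hs.le, ← Real.rpow_add hs]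
        norm_num

theorem pow_four_mul_decay_sq_le_rpow {s : ℝ} (hs : 0 < s) :
    s ^ 4 * decay s ^ 2 ≤ s ^ (-(1 / 2) : ℝ) := by
  rcases le_total s 1 with h | h
  · refine (pow_four_mul_decay_sq_le hs).trans (h.trans ?_)
    exact Real.one_le_rpow_of_pos_of_le_one_of_nonpos hs h (by norm_num)
  · exact (pow_four_mul_decay_sq_le_inv hs).trans
      (Real.rpow_le_rpow_of_exponent_le h (by norm_num))

theorem integrableOn_pow_four_mul_of_le_decay_sq {h : ℝ → ℝ} {C : ℝ}
    (hh : AEStronglyMeasurable h (volume.restrict (Set.Ioi 0)))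
    (hC : ∀ s, 0 < s → |h s| ≤ C * decay s ^ 2) (r : ℝ) :
    IntegrableOn (fun s => s ^ 4 * h s) (Set.Ioc 0 r) := by
  have hb : IntegrableOn (fun s : ℝ => C * s) (Set.Ioc 0 r) :=
    (continuous_const.mul continuous_id).integrableOn_Ioc
  refine hb.mono' (((continuous_pow 4).aestronglyMeasurable.mul hh).mono_measure
    (Measure.restrict_mono Set.Ioc_subset_Ioi_self le_rfl)) ?_
  filter_upwards [self_mem_ae_restrict measurableSet_Ioc] with s hs
  have hC0 : 0 ≤ C := by
    have := (abs_nonneg _).trans (hC s hs.1)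
    exact nonneg_of_mul_nonneg_left this (pow_pos (decay_pos hs.1) 2)
  have h4 : (0:ℝ) ≤ s ^ 4 := by positivity
  rw [norm_mul, Real.norm_of_nonneg h4, Real.norm_eq_abs]
  calc s ^ 4 * |h s| ≤ s ^ 4 * (C * decay s ^ 2) := by gcongr; exact hC s hs.1
    _ = C * (s ^ 4 * decay s ^ 2) := by ring
    _ ≤ C * s := by gcongr; exact pow_four_mul_decay_sq_le hs.1

namespace IsPotential

variable {k : ℝ} {h F Θ : ℝ → ℝ}

theorem antitoneOn (H : IsPotential k h F Θ) : AntitoneOn F (Set.Ioi 0) := fun a ha b _ hab => by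
  have h1 := H.F_sub a b ha hab
  have h2 : 0 ≤ ∫ s in a..b, Θ s / s ^ 4 := intervalIntegral.integral_nonneg hab fun s hs =>
    div_nonneg (H.Θ_nonneg s (lt_of_lt_of_le ha hs.1)) (by have := ha; positivity)
  linarith

theorem measurable_F (H : IsPotential k h F Θ) :
    AEStronglyMeasurable F (volume.restrict (Set.Ioi 0)) :=
  H.contF.aestronglyMeasurable measurableSet_Ioi

theorem measurable_Θ (H : IsPotential k h F Θ) :
    AEStronglyMeasurable Θ (volume.restrict (Set.Ioi 0)) :=
  H.contΘ.aestronglyMeasurable measurableSet_Ioi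

theorem flux_le_cumul (H : IsPotential k h F Θ) (h0 : ∀ s, 0 < s → 0 ≤ h s)
    (hi : ∀ r, IntegrableOn (fun s => s ^ 4 * h s) (Set.Ioc 0 r)) {r : ℝ} (hr : 0 < r) :
    Θ r ≤ cumul (fun s => s ^ 4 * h s) r := by
  have key : ∀ a, 0 < a → a ≤ r → Θ r ≤ Θ a + cumul (fun s => s ^ 4 * h s) r := fun a ha har => by
    have h1 := H.Θ_sub a r ha har
    have hI : IntervalIntegrable (fun s => s ^ 4 * h s) volume a r :=
      (intervalIntegrable_iff_integrableOn_Ioc_of_le har).2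
        ((hi r).mono_set (Set.Ioc_subset_Ioc_left ha.le))
    have hsub : Set.uIcc a r ⊆ Set.Ioi 0 := by
      rw [Set.uIcc_of_le har]; exact fun x hx => ha.trans_le hx.1
    have h2 : IntervalIntegrable (fun s => s ^ 4 * (k ^ 2 * F s)) volume a r :=
      ((continuousOn_pow 4).mul (continuousOn_const.mul (H.contF.mono hsub))).intervalIntegrable
    have h3 : ∫ s in a..r, s ^ 4 * (h s - k ^ 2 * F s) ≤ ∫ s in a..r, s ^ 4 * h s := by
      refine intervalIntegral.integral_mono_on har (by simpa only [mul_sub] using hI.sub h2) hI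
        fun s hs => ?_
      have := H.F_nonneg s (ha.trans_le hs.1)
      have : 0 ≤ s ^ 4 * (k ^ 2 * F s) := by positivity
      rw [mul_sub]; linarith
    have h4 : ∫ s in a..r, s ^ 4 * h s ≤ cumul (fun s => s ^ 4 * h s) r := by
      rw [intervalIntegral.integral_of_le har]
      refine setIntegral_mono_set (hi r) ?_ (Set.Ioc_subset_Ioc_left ha.le).eventuallyLE
      filter_upwards [self_mem_ae_restrict measurableSet_Ioc] with s hs
      exact mul_nonneg (by positivity) (h0 s hs.1)
    linarith
  have hlim : Tendsto (fun a => Θ a + cumul (fun s => s ^ 4 * h s) r) (𝓝[>] 0)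
      (𝓝 (0 + cumul (fun s => s ^ 4 * h s) r)) := H.Θ_zero.add_const _
  rw [zero_add] at hlim
  refine ge_of_tendsto hlim ?_
  filter_upwards [Ioc_mem_nhdsGT hr] with a ha
  exact key a ha.1 ha.2

theorem flux_eq_cumul (H : IsPotential k h F Θ)
    (hi : ∀ r, IntegrableOn (fun s => s ^ 4 * (h s - k ^ 2 * F s)) (Set.Ioc 0 r))
    {r : ℝ} (hr : 0 < r) :
    Θ r = cumul (fun s => s ^ 4 * (h s - k ^ 2 * F s)) r := by
  have hc : Tendsto (fun a => cumul (fun s => s ^ 4 * (h s - k ^ 2 * F s)) a) (𝓝[>] 0) (𝓝 0) := by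
    have := (continuous_cumul hi).tendsto 0
    rw [cumul_of_nonpos _ le_rfl] at this
    exact this.mono_left nhdsWithin_le_nhds
  have hlim : Tendsto (fun a => Θ a - cumul (fun s => s ^ 4 * (h s - k ^ 2 * F s)) a)
      (𝓝[>] 0) (𝓝 0) := by simpa using H.Θ_zero.sub hc
  have key : ∀ a, 0 < a → a ≤ r → Θ a - cumul (fun s => s ^ 4 * (h s - k ^ 2 * F s)) a =
      Θ r - cumul (fun s => s ^ 4 * (h s - k ^ 2 * F s)) r := fun a ha har => by
    have h1 := H.Θ_sub a r ha har
    rw [intervalIntegral.integral_of_le har] at h1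
    have h2 : cumul (fun s => s ^ 4 * (h s - k ^ 2 * F s)) r =
        cumul (fun s => s ^ 4 * (h s - k ^ 2 * F s)) a +
          ∫ s in Set.Ioc a r, s ^ 4 * (h s - k ^ 2 * F s) := by
      unfold cumul
      rw [← setIntegral_union (Set.Ioc_disjoint_Ioc_of_le le_rfl) measurableSet_Ioc (hi a)
        ((hi r).mono_set (Set.Ioc_subset_Ioc_left ha.le)), Set.Ioc_union_Ioc_eq_Ioc ha.le har]
    linarith
  have h3 : Tendsto (fun a => Θ a - cumul (fun s => s ^ 4 * (h s - k ^ 2 * F s)) a)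
      (𝓝[>] 0) (𝓝 (Θ r - cumul (fun s => s ^ 4 * (h s - k ^ 2 * F s)) r)) := by
    refine tendsto_const_nhds.congr' ?_
    filter_upwards [Ioc_mem_nhdsGT hr] with a ha
    exact (key a ha.1 ha.2).symm
  have := tendsto_nhds_unique hlim h3
  linarith

end IsPotential

theorem cumul_le_rpow {q : ℝ → ℝ} {C β r : ℝ} (hβ : 0 < β) (hr : 0 ≤ r)
    (hi : IntegrableOn q (Set.Ioc 0 r)) (hq : ∀ s, 0 < s → s ≤ r → q s ≤ C * s ^ (β - 1)) :
    cumul q r ≤ C / β * r ^ β := by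
  have h1 : IntervalIntegrable (fun s : ℝ => s ^ (β - 1)) volume 0 r :=
    intervalIntegral.intervalIntegrable_rpow' (by linarith)
  have h2 : IntegrableOn (fun s : ℝ => C * s ^ (β - 1)) (Set.Ioc 0 r) :=
    ((intervalIntegrable_iff_integrableOn_Ioc_of_le hr).1 h1).const_mul C
  calc cumul q r ≤ ∫ s in Set.Ioc 0 r, C * s ^ (β - 1) :=
        setIntegral_mono_on hi h2 measurableSet_Ioc fun s hs => hq s hs.1 hs.2
    _ = C * ∫ s in (0)..r, s ^ (β - 1) := by
        rw [integral_const_mul, intervalIntegral.integral_of_le hr]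
    _ = C / β * r ^ β := by
        rw [integral_rpow (Or.inl (by linarith)), sub_add_cancel, Real.zero_rpow hβ.ne']
        ring

namespace IsPotential

variable {k : ℝ} {h F Θ : ℝ → ℝ}

theorem le_of_flux_le (H : IsPotential k h F Θ) {C β : ℝ} (hβ : β ≠ 3)
    (hΘ : ∀ s, 0 < s → s ≤ 1 → Θ s ≤ C * s ^ β) {r : ℝ} (hr : 0 < r) (hr1 : r ≤ 1) :
    F r ≤ F 1 + C * ((1 - r ^ (β - 3)) / (β - 3)) := by
  have h1 := H.F_sub r 1 hr hr1
  have hsub : Set.uIcc r 1 ⊆ Set.Ioi 0 := by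
    rw [Set.uIcc_of_le hr1]; exact fun x hx => hr.trans_le hx.1
  have hI : IntervalIntegrable (fun s => Θ s / s ^ 4) volume r 1 :=
    ((H.contΘ.mono hsub).div (continuousOn_pow 4)
      fun x hx => pow_ne_zero 4 (hsub hx).ne').intervalIntegrable
  have h0 : (0 : ℝ) ∉ Set.uIcc r 1 := fun h => lt_irrefl (0 : ℝ) (hsub h)
  have hJ : IntervalIntegrable (fun s : ℝ => C * s ^ (β - 4)) volume r 1 :=
    (intervalIntegral.intervalIntegrable_rpow (Or.inr h0)).const_mul _
  have h2 : ∫ s in r..1, Θ s / s ^ 4 ≤ ∫ s in r..1, C * s ^ (β - 4) := by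
    refine intervalIntegral.integral_mono_on hr1 hI hJ fun s hs => ?_
    have hs0 : 0 < s := hr.trans_le hs.1
    rw [Real.rpow_sub hs0, div_le_iff₀ (by positivity)]
    calc Θ s ≤ C * s ^ β := hΘ s hs0 hs.2
      _ = _ := by
        rw [show (4 : ℝ) = ((4 : ℕ) : ℝ) by norm_num, Real.rpow_natCast]; field_simp
  rw [intervalIntegral.integral_const_mul,
    integral_rpow (Or.inr ⟨fun h => hβ (by linarith), h0⟩), Real.one_rpow,
    show β - 4 + 1 = β - 3 by ring] at h2
  linarith

/-- Size bounds for the potential of a source dominated by `decay ^ 2`. -/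
theorem bounds (H : IsPotential k h F Θ) (hk : 0 < k) {C : ℝ} (hC0 : 0 ≤ C)
    (hh : AEStronglyMeasurable h (volume.restrict (Set.Ioi 0)))
    (h0 : ∀ s, 0 < s → 0 ≤ h s) (hC : ∀ s, 0 < s → h s ≤ C * decay s ^ 2) :
    ∃ C' : ℝ, 0 ≤ C' ∧ (∀ r, 0 < r → Θ r ≤ C' * r ^ (2 : ℝ)) ∧
      (∀ r, 0 < r → Θ r ≤ C' * r ^ (1 / 2 : ℝ)) ∧ (∀ r, 0 < r → r ≤ 1 → F r ≤ C' * r ^ (-1 : ℝ)) ∧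
      (∀ r, 0 < r → F r ≤ C' * r ^ (-(9 / 2) : ℝ)) := by
  have habs : ∀ s, 0 < s → |h s| ≤ C * decay s ^ 2 := fun s hs => by
    rw [abs_of_nonneg (h0 s hs)]; exact hC s hs
  have hi := integrableOn_pow_four_mul_of_le_decay_sq hh habs
  have hc2 : ∀ r, 0 < r → cumul (fun s => s ^ 4 * h s) r ≤ C / 2 * r ^ (2 : ℝ) := fun r hr => by
    refine cumul_le_rpow two_pos hr.le (hi r) fun s hs _ => ?_
    calc s ^ 4 * h s ≤ s ^ 4 * (C * decay s ^ 2) := by gcongr; exact hC s hs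
      _ = C * (s ^ 4 * decay s ^ 2) := by ring
      _ ≤ C * s := by gcongr; exact pow_four_mul_decay_sq_le hs
      _ = _ := by norm_num
  have hc1 : ∀ r, 0 < r → cumul (fun s => s ^ 4 * h s) r ≤ C / (1 / 2) * r ^ (1 / 2 : ℝ) :=
    fun r hr => by
      refine cumul_le_rpow (by norm_num) hr.le (hi r) fun s hs _ => ?_
      calc s ^ 4 * h s ≤ s ^ 4 * (C * decay s ^ 2) := by gcongr; exact hC s hs
        _ = C * (s ^ 4 * decay s ^ 2) := by ring
        _ ≤ C * s ^ (-(1 / 2) : ℝ) := by gcongr; exact pow_four_mul_decay_sq_le_rpow hs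
        _ = _ := by norm_num
  have hΘ2 : ∀ r, 0 < r → Θ r ≤ C / 2 * r ^ (2 : ℝ) := fun r hr =>
    (H.flux_le_cumul h0 hi hr).trans (hc2 r hr)
  have hΘ1 : ∀ r, 0 < r → Θ r ≤ C / (1 / 2) * r ^ (1 / 2 : ℝ) := fun r hr =>
    (H.flux_le_cumul h0 hi hr).trans (hc1 r hr)
  have hF1 : ∀ r, 0 < r → r ≤ 1 → F r ≤ (F 1 + C / 2) * r ^ (-1 : ℝ) := fun r hr hr1 => by
    have h1 := H.le_of_flux_le (C := C / 2) (β := 2) (by norm_num) (fun s hs _ => hΘ2 s hs) hr hr1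
    have h2 : 1 ≤ r ^ (-1 : ℝ) :=
      Real.one_le_rpow_of_pos_of_le_one_of_nonpos hr hr1 (by norm_num)
    have h3 : (1 - r ^ ((2 : ℝ) - 3)) / (2 - 3) = r ^ (-1 : ℝ) - 1 := by
      norm_num; ring
    rw [h3] at h1
    have := H.F_nonneg 1 one_pos
    nlinarith
  have hF4 : ∀ r, 0 < r → IntegrableOn (fun s => s ^ 4 * (k ^ 2 * F s)) (Set.Ioc 0 r) :=
    fun r hr => by
    have hb : IntegrableOn (fun s : ℝ => k ^ 2 * ((F 1 + C / 2) * s ^ 3 + F 1 * s ^ 4))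
      (Set.Ioc 0 r) := Continuous.integrableOn_Ioc (by fun_prop)
    refine hb.mono' (((continuous_pow 4).aestronglyMeasurable.mul
      (H.measurable_F.const_mul _)).mono_measure
      (Measure.restrict_mono Set.Ioc_subset_Ioi_self le_rfl)) ?_
    filter_upwards [self_mem_ae_restrict measurableSet_Ioc] with s hs
    have hs0 := hs.1
    have hF0 := H.F_nonneg s hs0
    have hF10 := H.F_nonneg 1 one_pos
    rw [Real.norm_of_nonneg (by positivity)]
    rcases le_total s 1 with h1 | h1
    · have h2 := hF1 s hs0 h1
      rw [Real.rpow_neg_one] at h2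
      calc s ^ 4 * (k ^ 2 * F s) ≤ s ^ 4 * (k ^ 2 * ((F 1 + C / 2) * s⁻¹)) := by gcongr
        _ = k ^ 2 * ((F 1 + C / 2) * s ^ 3) := by field_simp
        _ ≤ _ := by gcongr; exact le_add_of_nonneg_right (by positivity)
    · have h2 := H.antitoneOn (Set.mem_Ioi.2 one_pos) (Set.mem_Ioi.2 hs0) h1
      calc s ^ 4 * (k ^ 2 * F s) ≤ s ^ 4 * (k ^ 2 * F 1) := by gcongr
        _ = k ^ 2 * (F 1 * s ^ 4) := by ring
        _ ≤ _ := by gcongr; exact le_add_of_nonneg_left (by positivity)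
  have hF2 : ∀ r, 0 < r → F r ≤ 10 * C / k ^ 2 * r ^ (-(9 / 2) : ℝ) := fun r hr => by
    have hq : ∀ r, IntegrableOn (fun s => s ^ 4 * (h s - k ^ 2 * F s)) (Set.Ioc 0 r) := fun r => by
      rcases le_or_gt r 0 with h | h
      · simp [Set.Ioc_eq_empty (not_lt.2 h)]
      · simp only [mul_sub]
        exact (hi r).sub (hF4 r h)
    have h1 := H.flux_eq_cumul hq hr
    have h2 : cumul (fun s => s ^ 4 * (h s - k ^ 2 * F s)) r =
        cumul (fun s => s ^ 4 * h s) r - cumul (fun s => s ^ 4 * (k ^ 2 * F s)) r := by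
      unfold cumul
      simp only [mul_sub]
      exact integral_sub (hi r) (hF4 r hr)
    have h3 : k ^ 2 * F r * (r ^ 5 / 5) ≤ cumul (fun s => s ^ 4 * (k ^ 2 * F s)) r := by
      have e : ∫ s in Set.Ioc 0 r, s ^ 4 = r ^ 5 / 5 := by
        rw [← intervalIntegral.integral_of_le hr.le, integral_pow]; norm_num
      rw [← e, ← integral_const_mul]
      refine setIntegral_mono_on (Continuous.integrableOn_Ioc (by fun_prop)) (hF4 r hr)
        measurableSet_Ioc fun s hs => ?_
      have h5 := H.antitoneOn (Set.mem_Ioi.2 hs.1) (Set.mem_Ioi.2 hr) hs.2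
      calc k ^ 2 * F r * s ^ 4 ≤ k ^ 2 * F s * s ^ 4 := by gcongr
        _ = _ := by ring
    have h4 := hc1 r hr
    have h6 := H.Θ_nonneg r hr
    have h7 : k ^ 2 * F r * (r ^ 5 / 5) ≤ C / (1 / 2) * r ^ (1 / 2 : ℝ) := by linarith
    have h8 : r ^ (-(9 / 2) : ℝ) = r ^ (1 / 2 : ℝ) / r ^ 5 := by
      rw [← Real.rpow_natCast, ← Real.rpow_sub hr]; norm_num
    rw [h8, div_mul_div_comm, le_div_iff₀ (by positivity)]
    linarith
  have hF10 := H.F_nonneg 1 one_pos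
  refine ⟨2 * C + F 1 + 10 * C / k ^ 2, by positivity, fun r hr => (hΘ2 r hr).trans ?_,
    fun r hr => (hΘ1 r hr).trans ?_, fun r hr hr1 => (hF1 r hr hr1).trans ?_,
    fun r hr => (hF2 r hr).trans ?_⟩
  all_goals
    have hx : 0 ≤ 10 * C / k ^ 2 := by positivity
    refine mul_le_mul_of_nonneg_right ?_ (by positivity)
    linarith

end IsPotential

/-- Decreasing sources dominated by `decay ^ 2`. -/
structure IsSource (h : ℝ → ℝ) : Prop where
  anti : AntitoneOn h (Set.Ioi 0)
  nonneg : ∀ s, 0 < s → 0 ≤ h s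
  le : ∃ C, 0 ≤ C ∧ ∀ s, 0 < s → h s ≤ C * decay s ^ 2

theorem IsSource.measurable {h : ℝ → ℝ} (hh : IsSource h) :
    AEStronglyMeasurable h (volume.restrict (Set.Ioi 0)) :=
  (aemeasurable_restrict_of_antitoneOn measurableSet_Ioi hh.anti).aestronglyMeasurable

theorem IsSource.integrableOn_Ioc {h : ℝ → ℝ} (hh : IsSource h) (r : ℝ) :
    IntegrableOn (fun s => s ^ 4 * h s) (Set.Ioc 0 r) := by
  obtain ⟨C, -, hC⟩ := hh.le
  exact integrableOn_pow_four_mul_of_le_decay_sq hh.measurable (C := C)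
    (fun s hs => by rw [abs_of_nonneg (hh.nonneg s hs)]; exact hC s hs) r

theorem IsSource.exists_isPotential {h : ℝ → ℝ} (hh : IsSource h) {k : ℝ} (hk : 0 < k) :
    ∃ F Θ : ℝ → ℝ, IsPotential k h F Θ :=
  _root_.exists_isPotential hk hh.anti hh.nonneg hh.integrableOn_Ioc

theorem decay_of_le_one {s : ℝ} (hs : 0 < s) (h : s ≤ 1) : decay s = s ^ (-(3 / 2) : ℝ) :=
  min_eq_left (Real.rpow_le_rpow_of_exponent_ge hs h (by norm_num))

theorem decay_of_one_le {s : ℝ} (h : 1 ≤ s) : decay s = s ^ (-(5 / 2) : ℝ) :=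
  min_eq_right (Real.rpow_le_rpow_of_exponent_le h (by norm_num))

theorem rpow_mul_rpow {s : ℝ} (hs : 0 < s) (a b : ℝ) : s ^ a * s ^ b = s ^ (a + b) :=
  (Real.rpow_add hs a b).symm

theorem pow_four_eq_rpow (s : ℝ) : s ^ 4 = s ^ (4 : ℝ) := by
  rw [show (4 : ℝ) = ((4 : ℕ) : ℝ) by norm_num, Real.rpow_natCast]

/-- The functions `decay ^ 3 * s ^ 4` are integrable. -/
theorem integrableOn_decay_cube : IntegrableOn (fun s => decay s ^ 3 * s ^ 4) (Set.Ioi 0) := by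
  refine integrableOn_Ioi_of_le_rpow (C := 1) (a := -(1 / 2)) (b := -(7 / 2))
    (((measurable_decay.pow_const 3).mul (measurable_id.pow_const 4)).aestronglyMeasurable)
    (by norm_num) (by norm_num) (fun s hs h1 => ?_) fun s h1 => ?_
  · have := decay_pos hs
    rw [abs_of_nonneg (by positivity), decay_of_le_one hs h1, ← Real.rpow_natCast,
      ← Real.rpow_mul hs.le, pow_four_eq_rpow, rpow_mul_rpow hs]
    norm_num
  · have hs : 0 < s := by linarith
    have := decay_pos hs
    rw [abs_of_nonneg (by positivity), decay_of_one_le h1, ← Real.rpow_natCast,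
      ← Real.rpow_mul hs.le, pow_four_eq_rpow, rpow_mul_rpow hs]
    norm_num

namespace IsPotential

variable {k : ℝ} {h F Θ : ℝ → ℝ}

theorem le_decay (H : IsPotential k h F Θ) (hk : 0 < k) (hh : IsSource h) :
    ∃ C, 0 ≤ C ∧ ∀ s, 0 < s → F s ≤ C * decay s := by
  obtain ⟨C, hC0, hC⟩ := hh.le
  obtain ⟨C', h0, -, -, h1, h2⟩ := H.bounds hk hC0 hh.measurable hh.nonneg hC
  refine ⟨C', h0, fun s hs => ?_⟩
  rcases le_total s 1 with hs1 | hs1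
  · rw [decay_of_le_one hs hs1]
    refine (h1 s hs hs1).trans (mul_le_mul_of_nonneg_left ?_ h0)
    exact Real.rpow_le_rpow_of_exponent_ge hs hs1 (by norm_num)
  · rw [decay_of_one_le hs1]
    refine (h2 s hs).trans (mul_le_mul_of_nonneg_left ?_ h0)
    exact Real.rpow_le_rpow_of_exponent_le hs1 (by norm_num)

theorem integrableOn_mul_decay (H : IsPotential k h F Θ) (hk : 0 < k) (hh : IsSource h) :
    IntegrableOn (fun s => F s * decay s * s ^ 4) (Set.Ioi 0) := by
  obtain ⟨C, hC0, hC⟩ := hh.le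
  obtain ⟨C', h0, -, -, h1, h2⟩ := H.bounds hk hC0 hh.measurable hh.nonneg hC
  refine integrableOn_Ioi_of_le_rpow (C := C') (a := 3 / 2) (b := -3)
    ((H.measurable_F.mul measurable_decay.aestronglyMeasurable).mul
      (continuous_pow 4).aestronglyMeasurable)
    (by norm_num) (by norm_num) (fun s hs hs1 => ?_) fun s hs1 => ?_
  · have := decay_pos hs
    have := H.F_nonneg s hs
    rw [abs_of_nonneg (by positivity), decay_of_le_one hs hs1, pow_four_eq_rpow]
    calc F s * s ^ (-(3 / 2) : ℝ) * s ^ (4 : ℝ)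
        ≤ C' * s ^ (-1 : ℝ) * s ^ (-(3 / 2) : ℝ) * s ^ (4 : ℝ) := by
          gcongr; exact h1 s hs hs1
      _ = _ := by
          rw [mul_assoc, mul_assoc, rpow_mul_rpow hs, rpow_mul_rpow hs]; norm_num
  · have hs : 0 < s := by linarith
    have := decay_pos hs
    have := H.F_nonneg s hs
    rw [abs_of_nonneg (by positivity), decay_of_one_le hs1, pow_four_eq_rpow]
    calc F s * s ^ (-(5 / 2) : ℝ) * s ^ (4 : ℝ)
        ≤ C' * s ^ (-(9 / 2) : ℝ) * s ^ (-(5 / 2) : ℝ) * s ^ (4 : ℝ) := by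
          gcongr; exact h2 s hs
      _ = _ := by
          rw [mul_assoc, mul_assoc, rpow_mul_rpow hs, rpow_mul_rpow hs]; norm_num

theorem integrableOn_sq (H : IsPotential k h F Θ) (hk : 0 < k) (hh : IsSource h) :
    IntegrableOn (fun s => F s ^ 2 * s ^ 4) (Set.Ioi 0) := by
  obtain ⟨C, hC0, hC⟩ := H.le_decay hk hh
  refine ((H.integrableOn_mul_decay hk hh).const_mul C).mono'
    ((H.measurable_F.pow 2).mul (continuous_pow 4).aestronglyMeasurable) ?_
  filter_upwards [self_mem_ae_restrict measurableSet_Ioi] with s hs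
  have hF := H.F_nonneg s hs
  rw [Real.norm_of_nonneg (by positivity)]
  calc F s ^ 2 * s ^ 4 = F s * F s * s ^ 4 := by ring
    _ ≤ F s * (C * decay s) * s ^ 4 := by gcongr; exact hC s hs
    _ = _ := by ring

theorem integrableOn_flux_sq (H : IsPotential k h F Θ) (hk : 0 < k) (hh : IsSource h) :
    IntegrableOn (fun s => Θ s ^ 2 / s ^ 4) (Set.Ioi 0) := by
  obtain ⟨C, hC0, hC⟩ := hh.le
  obtain ⟨C', h0, h1, h2, -, -⟩ := H.bounds hk hC0 hh.measurable hh.nonneg hC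
  refine integrableOn_Ioi_of_le_rpow (C := C' ^ 2) (a := 0) (b := -3)
    ((H.measurable_Θ.pow 2).aemeasurable.div (by fun_prop)).aestronglyMeasurable
    (by norm_num) (by norm_num) (fun s hs hs1 => ?_) fun s hs1 => ?_
  · have hΘ := H.Θ_nonneg s hs
    rw [abs_of_nonneg (by positivity), div_le_iff₀ (by positivity)]
    calc Θ s ^ 2 ≤ (C' * s ^ (2 : ℝ)) ^ 2 := by gcongr; exact h1 s hs
      _ = _ := by rw [Real.rpow_zero, mul_pow, Real.rpow_two]; ring
  · have hs : 0 < s := by linarith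
    have hΘ := H.Θ_nonneg s hs
    rw [abs_of_nonneg (by positivity), div_le_iff₀ (by positivity)]
    calc Θ s ^ 2 ≤ (C' * s ^ (1 / 2 : ℝ)) ^ 2 := by gcongr; exact h2 s hs
      _ = _ := by
        rw [mul_pow, pow_four_eq_rpow, mul_assoc, rpow_mul_rpow hs, ← Real.rpow_natCast,
          ← Real.rpow_natCast, ← Real.rpow_mul hs.le]
        norm_num

theorem integrableOn_charge_mul_decay (H : IsPotential k h F Θ) (hk : 0 < k) (hh : IsSource h) :
    IntegrableOn (fun s => s ^ 4 * (h s - k ^ 2 * F s) * decay s) (Set.Ioi 0) := by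
  obtain ⟨C, hC0, hC⟩ := hh.le
  have h1 : IntegrableOn (fun s => s ^ 4 * h s * decay s) (Set.Ioi 0) := by
    refine (integrableOn_decay_cube.const_mul C).mono'
      (((continuous_pow 4).aestronglyMeasurable.mul hh.measurable).mul
        measurable_decay.aestronglyMeasurable) ?_
    filter_upwards [self_mem_ae_restrict measurableSet_Ioi] with s hs
    have h0 := hh.nonneg s hs
    have hd := decay_pos hs
    rw [Real.norm_of_nonneg (by positivity)]
    calc s ^ 4 * h s * decay s ≤ s ^ 4 * (C * decay s ^ 2) * decay s := by gcongr; exact hC s hs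
      _ = _ := by ring
  refine (h1.sub ((H.integrableOn_mul_decay hk hh).const_mul (k ^ 2))).congr
    (ae_of_all _ fun s => ?_)
  simp only [Pi.sub_apply]
  ring

theorem integrableOn_charge_Ioc (H : IsPotential k h F Θ) (hk : 0 < k) (hh : IsSource h) (r : ℝ) :
    IntegrableOn (fun s => s ^ 4 * (h s - k ^ 2 * F s)) (Set.Ioc 0 r) := by
  have h1 := H.integrableOn_charge_mul_decay hk hh
  rcases le_or_gt r 0 with hr | hr
  · simp [Set.Ioc_eq_empty (not_lt.2 hr)]
  have hm : AEStronglyMeasurable (fun s => s ^ 4 * (h s - k ^ 2 * F s))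
      (volume.restrict (Set.Ioi 0)) := (continuous_pow 4).aestronglyMeasurable.mul
        (hh.measurable.sub (H.measurable_F.const_mul _))
  refine Integrable.mono ((h1.mono_set Set.Ioc_subset_Ioi_self).const_mul (decay r)⁻¹)
    (hm.mono_measure (Measure.restrict_mono Set.Ioc_subset_Ioi_self le_rfl)) ?_
  filter_upwards [self_mem_ae_restrict measurableSet_Ioc] with s hs
  have hd := decay_pos hr
  have hds := decay_pos hs.1
  have hle : 1 ≤ (decay r)⁻¹ * decay s := by
    rw [← div_eq_inv_mul, le_div_iff₀ hd, one_mul]; exact decay_anti hs.1 hs.2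
  rw [norm_mul (decay r)⁻¹, norm_mul _ (decay s), Real.norm_of_nonneg hds.le,
    Real.norm_of_nonneg (inv_nonneg.2 hd.le), mul_left_comm]
  exact le_mul_of_one_le_right (norm_nonneg _) hle

theorem cumul_charge (H : IsPotential k h F Θ) (hk : 0 < k) (hh : IsSource h) {r : ℝ}
    (hr : 0 < r) : cumul (fun s => s ^ 4 * (h s - k ^ 2 * F s)) r = Θ r :=
  (H.flux_eq_cumul (H.integrableOn_charge_Ioc hk hh) hr).symm

theorem isTest (H : IsPotential k h F Θ) (hk : 0 < k) (hh : IsSource h) :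
    IsTest fun s => s ^ 4 * (h s - k ^ 2 * F s) where
  int := H.integrableOn_charge_mul_decay hk hh
  sq := (H.integrableOn_flux_sq hk hh).congr_fun (fun r hr => by
    simp only [H.cumul_charge hk hh hr]) measurableSet_Ioi

theorem eq_integral_Ioi (H : IsPotential k h F Θ) (hk : 0 < k) (hh : IsSource h) {s : ℝ}
    (hs : 0 < s) : IntegrableOn (fun r => Θ r / r ^ 4) (Set.Ioi s) ∧
      F s = ∫ r in Set.Ioi s, Θ r / r ^ 4 := by
  obtain ⟨C, hC0, hC⟩ := hh.le
  obtain ⟨C', h0, h1, h2, -, h4⟩ := H.bounds hk hC0 hh.measurable hh.nonneg hC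
  have hi : IntegrableOn (fun r => Θ r / r ^ 4) (Set.Ioi s) := by
    refine ((integrableOn_Ioi_rpow_of_lt (a := -2) (by norm_num) hs).const_mul C').mono'
      ((H.measurable_Θ.aemeasurable.div (by fun_prop)).aestronglyMeasurable.mono_measure
        (Measure.restrict_mono (Set.Ioi_subset_Ioi hs.le) le_rfl)) ?_
    filter_upwards [self_mem_ae_restrict measurableSet_Ioi] with r hr
    have hr0 : 0 < r := hs.trans hr
    have hΘ := H.Θ_nonneg r hr0
    rw [Real.norm_of_nonneg (by positivity), div_le_iff₀ (by positivity), pow_four_eq_rpow,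
      mul_assoc, rpow_mul_rpow hr0]
    norm_num
    simpa using h1 r hr0
  refine ⟨hi, ?_⟩
  have hF0 : Tendsto F atTop (𝓝 0) := by
    have hub : Tendsto (fun r : ℝ => C' * r ^ (-(9 / 2) : ℝ)) atTop (𝓝 0) := by
      simpa using (tendsto_rpow_neg_atTop (y := 9 / 2) (by norm_num)).const_mul C'
    refine tendsto_of_tendsto_of_tendsto_of_le_of_le' tendsto_const_nhds hub ?_ ?_
    · filter_upwards [eventually_gt_atTop 0] with r hr using H.F_nonneg r hr
    · filter_upwards [eventually_gt_atTop 0] with r hr using h4 r hr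
  have hlim := intervalIntegral_tendsto_integral_Ioi s hi tendsto_id
  have hlim2 : Tendsto (fun b => F s - F b) atTop (𝓝 (F s - 0)) := hF0.const_sub _
  rw [sub_zero] at hlim2
  refine tendsto_nhds_unique hlim2 (hlim.congr' ?_)
  filter_upwards [eventually_ge_atTop s] with b hb
  exact (H.F_sub s b hs hb).symm

end IsPotential

theorem cumul_add {p q : ℝ → ℝ} {r : ℝ} (hp : IntegrableOn p (Set.Ioc 0 r))
    (hq : IntegrableOn q (Set.Ioc 0 r)) :
    cumul (fun s => p s + q s) r = cumul p r + cumul q r := integral_add hp hq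

theorem cumul_const_mul (c : ℝ) (q : ℝ → ℝ) (r : ℝ) :
    cumul (fun s => c * q s) r = c * cumul q r := integral_const_mul _ _

theorem IsTest.const_mul {q : ℝ → ℝ} (hq : IsTest q) (c : ℝ) : IsTest fun s => c * q s where
  int := by
    simp only [mul_assoc]
    exact hq.int.const_mul c
  sq := by
    simp only [cumul_const_mul, mul_pow, mul_div_assoc]
    exact hq.sq.const_mul _

theorem IsTest.integrableOn_cumul_mul {p q : ℝ → ℝ} (hp : IsTest p) (hq : IsTest q) :
    IntegrableOn (fun r => cumul p r * cumul q r / r ^ 4) (Set.Ioi 0) := by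
  refine (hp.sq.add hq.sq).mono' ?_ (ae_of_all _ fun r => ?_)
  · exact (((continuous_cumul hp.integrableOn_Ioc).mul
      (continuous_cumul hq.integrableOn_Ioc)).measurable.div (by fun_prop)).aestronglyMeasurable
  · have h4 : (0:ℝ) ≤ r ^ 4 := by positivity
    simp only [Pi.add_apply]
    rw [norm_div, Real.norm_of_nonneg h4, ← add_div]
    gcongr
    rw [Real.norm_eq_abs, abs_le]
    constructor <;> nlinarith [sq_nonneg (cumul p r - cumul q r), sq_nonneg (cumul p r + cumul q r)]

theorem IsTest.add {p q : ℝ → ℝ} (hp : IsTest p) (hq : IsTest q) :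
    IsTest fun s => p s + q s where
  int := by
    simp only [add_mul]
    exact hp.int.add hq.int
  sq := by
    refine ((hp.sq.add ((hp.integrableOn_cumul_mul hq).const_mul 2)).add hq.sq).congr
      (ae_of_all _ fun r => ?_)
    simp only [Pi.add_apply]
    rw [cumul_add (hp.integrableOn_Ioc r) (hq.integrableOn_Ioc r)]
    ring

theorem IsTest.energy_add {p q : ℝ → ℝ} (hp : IsTest p) (hq : IsTest q) :
    ∫ r in Set.Ioi 0, cumul (fun s => p s + q s) r ^ 2 / r ^ 4 =
      (∫ r in Set.Ioi 0, cumul p r ^ 2 / r ^ 4) +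
      2 * (∫ r in Set.Ioi 0, cumul p r * cumul q r / r ^ 4) +
      ∫ r in Set.Ioi 0, cumul q r ^ 2 / r ^ 4 := by
  have i1 := (hp.integrableOn_cumul_mul hq).const_mul 2
  have i2 : IntegrableOn (fun r => cumul p r ^ 2 / r ^ 4 + 2 * (cumul p r * cumul q r / r ^ 4))
    (Set.Ioi 0) := hp.sq.add i1
  rw [← integral_const_mul, ← integral_add hp.sq i1, ← integral_add i2 hq.sq]
  refine integral_congr_ae (ae_of_all _ fun r => ?_)
  simp only [cumul_add (hp.integrableOn_Ioc r) (hq.integrableOn_Ioc r)]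
  ring

theorem isTest_zero : IsTest fun _ => 0 where
  int := by simp
  sq := by simp [cumul]

theorem EnergyLE.nonneg {f : ℝ → ℝ} {a : ℝ} (hf : EnergyLE f a) : 0 ≤ a := by
  simpa [cumul] using hf _ isTest_zero

theorem EnergyLE.const_mul {f : ℝ → ℝ} {a : ℝ} (hf : EnergyLE f a) (c : ℝ) :
    EnergyLE (fun s => c * f s) (c ^ 2 * a) := by
  intro q hq
  rcases eq_or_ne c 0 with rfl | hc
  · have : 0 ≤ ∫ r in Set.Ioi 0, cumul q r ^ 2 / r ^ 4 := integral_nonneg fun r => by positivity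
    simpa using this
  · have h := hf _ (hq.const_mul c⁻¹)
    have e1 : ∫ s in Set.Ioi 0, c⁻¹ * q s * f s = (c ^ 2)⁻¹ * ∫ s in Set.Ioi 0, q s * (c * f s) := by
      rw [← integral_const_mul]
      congr 1; ext s; field_simp
    have e2 : ∫ r in Set.Ioi 0, cumul (fun s => c⁻¹ * q s) r ^ 2 / r ^ 4 =
        (c ^ 2)⁻¹ * ∫ r in Set.Ioi 0, cumul q r ^ 2 / r ^ 4 := by
      rw [← integral_const_mul]
      congr 1; ext s; rw [cumul_const_mul]; ring
    rw [e1, e2] at h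
    have hc2 : 0 < c ^ 2 := by positivity
    have := mul_le_mul_of_nonneg_left h hc2.le
    rwa [mul_sub, mul_left_comm, mul_inv_cancel_left₀ hc2.ne', mul_inv_cancel_left₀ hc2.ne'] at this

namespace IsPotential

variable {k : ℝ} {h F Θ : ℝ → ℝ}

theorem integral_mul_eq (H : IsPotential k h F Θ) (hk : 0 < k) (hh : IsSource h) {q : ℝ → ℝ}
    (hq : IsTest q) :
    ∫ s in Set.Ioi 0, q s * F s = ∫ r in Set.Ioi 0, cumul q r * Θ r / r ^ 4 := by
  set μ := volume.restrict (Set.Ioi (0 : ℝ)) with hμ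
  obtain ⟨C, hC0, hC⟩ := H.le_decay hk hh
  have hTm : AEStronglyMeasurable (fun r => Θ r / r ^ 4) μ :=
    (H.measurable_Θ.aemeasurable.div (by fun_prop)).aestronglyMeasurable
  set G : ℝ → ℝ → ℝ := fun s r => {z : ℝ × ℝ | z.1 < z.2}.indicator
    (fun z => q z.1 * (Θ z.2 / z.2 ^ 4)) (s, r) with hG
  have hGm : AEStronglyMeasurable (Function.uncurry G) (μ.prod μ) := by
    refine AEStronglyMeasurable.indicator ?_ (measurableSet_lt measurable_fst measurable_snd)
    exact (hq.aestronglyMeasurable.comp_fst).mul (hTm.comp_snd)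
  have hGs : ∀ s r, G s r = (Set.Ioi s).indicator (fun r => q s * (Θ r / r ^ 4)) r := by
    intro s r; simp only [hG, Set.indicator]; rfl
  have hrestr : ∀ s, 0 < s → μ.restrict (Set.Ioi s) = volume.restrict (Set.Ioi s) := fun s hs => by
    rw [hμ, Measure.restrict_restrict measurableSet_Ioi,
      Set.inter_eq_left.2 (Set.Ioi_subset_Ioi hs.le)]
  have hin : ∀ s, 0 < s → ∫ r, G s r ∂μ = q s * F s := fun s hs => by
    simp only [hGs]
    rw [integral_indicator measurableSet_Ioi, hrestr s hs, integral_const_mul,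
      (H.eq_integral_Ioi hk hh hs).2]
  have hInt : Integrable (Function.uncurry G) (μ.prod μ) := by
    rw [integrable_prod_iff hGm]
    constructor
    · filter_upwards [self_mem_ae_restrict measurableSet_Ioi] with s hs
      have : (fun r => Function.uncurry G (s, r)) =
          (Set.Ioi s).indicator (fun r => q s * (Θ r / r ^ 4)) := by ext r; exact hGs s r
      rw [this, integrable_indicator_iff measurableSet_Ioi, IntegrableOn, hrestr s hs]
      exact (H.eq_integral_Ioi hk hh hs).1.const_mul _
    · have h1 := (hq.integrableOn_mul H.measurable_F (C := C) fun s hs => by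
        rw [abs_of_nonneg (H.F_nonneg s hs)]; exact hC s hs).norm
      refine h1.congr ?_
      filter_upwards [self_mem_ae_restrict measurableSet_Ioi] with s hs
      have : ∀ r, ‖Function.uncurry G (s, r)‖ =
          (Set.Ioi s).indicator (fun r => ‖q s‖ * (Θ r / r ^ 4)) r := fun r => by
        change ‖G s r‖ = _
        rw [hGs]
        by_cases hr : r ∈ Set.Ioi s
        · rw [Set.indicator_of_mem hr, Set.indicator_of_mem hr, norm_mul,
            Real.norm_of_nonneg (div_nonneg (H.Θ_nonneg r (lt_trans hs hr)) (by positivity))]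
        · simp [Set.indicator_of_notMem hr]
      simp only [this]
      rw [integral_indicator measurableSet_Ioi, hrestr s hs, integral_const_mul,
        ← (H.eq_integral_Ioi hk hh hs).2, norm_mul, Real.norm_of_nonneg (H.F_nonneg s hs)]
  have hsw := integral_integral_swap hInt
  rw [← setIntegral_congr_fun measurableSet_Ioi fun s hs => hin s hs, hsw]
  refine setIntegral_congr_fun measurableSet_Ioi fun r hr => ?_
  have : ∀ s, G s r = (Set.Iio r).indicator (fun s => q s * (Θ r / r ^ 4)) s := by
    intro s; simp only [hG, Set.indicator]; rfl
  simp only [this]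
  rw [integral_indicator measurableSet_Iio, hμ, Measure.restrict_restrict measurableSet_Iio,
    integral_mul_const, mul_div_assoc, cumul, Set.Iio_inter_Ioi, integral_Ioc_eq_integral_Ioo]

theorem energy_add (H : IsPotential k h F Θ) (hk : 0 < k) (hh : IsSource h) {f : ℝ → ℝ} {a C : ℝ}
    (hf : EnergyLE f a) (hfm : AEStronglyMeasurable f (volume.restrict (Set.Ioi 0)))
    (hC : ∀ s, 0 < s → |f s| ≤ C * decay s) (t : ℝ) :
    EnergyLE (fun s => f s + t * F s)
      (a + 2 * t * (∫ s in Set.Ioi 0, s ^ 4 * (h s - k ^ 2 * F s) * f s) +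
        t ^ 2 * ∫ s in Set.Ioi 0, s ^ 4 * (h s - k ^ 2 * F s) * F s) := by
  intro q hq
  obtain ⟨C', hC0', hC'⟩ := H.le_decay hk hh
  have hC'' : ∀ s, 0 < s → |F s| ≤ C' * decay s := fun s hs => by
    rw [abs_of_nonneg (H.F_nonneg s hs)]; exact hC' s hs
  set p : ℝ → ℝ := fun s => s ^ 4 * (h s - k ^ 2 * F s) with hp
  have hpt : IsTest p := H.isTest hk hh
  have hcp : ∀ r, r ∈ Set.Ioi (0 : ℝ) → cumul p r = Θ r := fun r hr => H.cumul_charge hk hh hr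
  have hB : ∀ q, IsTest q → ∫ s in Set.Ioi 0, q s * F s =
      ∫ r in Set.Ioi 0, cumul q r * cumul p r / r ^ 4 := fun q hq => by
    rw [H.integral_mul_eq hk hh hq]
    exact setIntegral_congr_fun measurableSet_Ioi fun r hr => by simp only [hcp r hr]
  -- write `q = q' + t p`
  set q' : ℝ → ℝ := fun s => q s + -t * p s with hq'
  have hq't : IsTest q' := hq.add (hpt.const_mul (-t))
  have hqe : q = fun s => q' s + t * p s := by ext s; simp only [hq']; ring
  have e1 : ∫ s in Set.Ioi 0, q s * (f s + t * F s) =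
      (∫ s in Set.Ioi 0, q' s * f s) + t * (∫ s in Set.Ioi 0, p s * f s) +
      t * (∫ s in Set.Ioi 0, q' s * F s) + t ^ 2 * ∫ s in Set.Ioi 0, p s * F s := by
    have i1 := hq't.integrableOn_mul hfm hC
    have i2 := (hpt.integrableOn_mul hfm hC).const_mul t
    have i3 := (hq't.integrableOn_mul H.measurable_F hC'').const_mul t
    have i4 := (hpt.integrableOn_mul H.measurable_F hC'').const_mul (t ^ 2)
    have i12 : IntegrableOn (fun s => q' s * f s + t * (p s * f s)) (Set.Ioi 0) := i1.add i2
    have i123 : IntegrableOn (fun s => q' s * f s + t * (p s * f s) + t * (q' s * F s))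
      (Set.Ioi 0) := i12.add i3
    rw [← integral_const_mul, ← integral_const_mul, ← integral_const_mul, ← integral_add i1 i2,
      ← integral_add i12 i3, ← integral_add i123 i4]
    refine integral_congr_ae (ae_of_all _ fun s => ?_)
    simp only [hqe]
    ring
  have e2 : ∫ r in Set.Ioi 0, cumul q r ^ 2 / r ^ 4 =
      (∫ r in Set.Ioi 0, cumul q' r ^ 2 / r ^ 4) + 2 * (t * ∫ s in Set.Ioi 0, q' s * F s) +
        t ^ 2 * ∫ s in Set.Ioi 0, p s * F s := by
    rw [hqe, hq't.energy_add (hpt.const_mul t), hB q' hq't, hB p hpt]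
    simp only [cumul_const_mul]
    congr 1
    · congr 2
      rw [← integral_const_mul]
      congr 1; ext r; ring
    · rw [← integral_const_mul]
      congr 1; ext r; ring
  have h1 := hf q' hq't
  rw [e1, e2]
  linarith

theorem energy_charge (H : IsPotential k h F Θ) (hk : 0 < k) (hh : IsSource h) :
    ∫ r in Set.Ioi 0, cumul (fun s => s ^ 4 * (h s - k ^ 2 * F s)) r ^ 2 / r ^ 4 =
      ∫ s in Set.Ioi 0, s ^ 4 * (h s - k ^ 2 * F s) * F s := by
  rw [H.integral_mul_eq hk hh (H.isTest hk hh)]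
  exact setIntegral_congr_fun measurableSet_Ioi fun r hr => by
    simp only [H.cumul_charge hk hh hr]; ring

end IsPotential

theorem cumul_indicator_Ioc_le {r s : ℝ} (hr : 0 < r) (l : ℝ) (hl : 0 ≤ l) :
    0 ≤ cumul ((Set.Ioc r (2 * r)).indicator fun _ => l) s ∧
    cumul ((Set.Ioc r (2 * r)).indicator fun _ => l) s ≤ (Set.Ioi r).indicator (fun _ => l * r) s := by
  rw [cumul, setIntegral_indicator measurableSet_Ioc, setIntegral_const, smul_eq_mul]
  constructor
  · positivity
  · by_cases hs : r < s
    · rw [Set.indicator_of_mem (show s ∈ Set.Ioi r from hs), mul_comm]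
      gcongr
      calc volume.real (Set.Ioc 0 s ∩ Set.Ioc r (2 * r)) ≤ volume.real (Set.Ioc r (2 * r)) :=
            measureReal_mono Set.inter_subset_right (by simp)
        _ = r := by rw [Real.volume_real_Ioc_of_le (by linarith)]; ring
    · rw [Set.indicator_of_notMem (show s ∉ Set.Ioi r from hs)]
      have : Set.Ioc 0 s ∩ Set.Ioc r (2 * r) = ∅ := by
        ext x; simp only [Set.mem_inter_iff, Set.mem_Ioc, Set.mem_empty_iff_false, iff_false]
        rintro ⟨⟨_, h1⟩, h2, _⟩; exact hs (h2.trans_le h1)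
      simp [this]

theorem integrableOn_Ioi_inv_pow_four {r : ℝ} (hr : 0 < r) :
    IntegrableOn (fun s : ℝ => s ^ (-4 : ℝ)) (Set.Ioi r) ∧
      ∫ s in Set.Ioi r, s ^ (-4 : ℝ) = (3 * r ^ 3)⁻¹ := by
  refine ⟨integrableOn_Ioi_rpow_of_lt (by norm_num) hr, ?_⟩
  rw [integral_Ioi_rpow_of_lt (by norm_num) hr]
  have : r ^ (-4 + 1 : ℝ) = (r ^ 3)⁻¹ := by
    rw [show (-4 + 1 : ℝ) = -(3 : ℕ) by norm_num, Real.rpow_neg hr.le, Real.rpow_natCast]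
  rw [this]; field_simp; norm_num

theorem isTest_indicator_Ioc {r l : ℝ} (hr : 0 < r) (hl : 0 ≤ l) :
    IsTest ((Set.Ioc r (2 * r)).indicator fun _ => l) ∧
    ∫ s in Set.Ioi 0, cumul ((Set.Ioc r (2 * r)).indicator fun _ => l) s ^ 2 / s ^ 4 ≤
      l ^ 2 / (3 * r) := by
  set q := (Set.Ioc r (2 * r)).indicator fun _ => l with hq
  obtain ⟨hi4, he4⟩ := integrableOn_Ioi_inv_pow_four hr
  have hqi : Integrable q := (integrable_indicator_iff measurableSet_Ioc).2
    (integrableOn_const (by simp))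
  have hb : Integrable ((Set.Ioi r).indicator fun s => (l * r) ^ 2 * s ^ (-4 : ℝ))
      (volume.restrict (Set.Ioi 0)) :=
    ((integrable_indicator_iff measurableSet_Ioi).2 (hi4.const_mul _)).integrableOn
  have hle : ∀ s : ℝ, 0 < s → cumul q s ^ 2 / s ^ 4 ≤
      (Set.Ioi r).indicator (fun s => (l * r) ^ 2 * s ^ (-4 : ℝ)) s := fun s hs => by
    obtain ⟨h0, h1⟩ := cumul_indicator_Ioc_le (s := s) hr l hl
    by_cases hs' : s ∈ Set.Ioi r
    · rw [Set.indicator_of_mem hs'] at h1 ⊢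
      have e : s ^ (-4 : ℝ) = (s ^ 4)⁻¹ := by
        rw [show (-4 : ℝ) = -(4 : ℕ) by norm_num, Real.rpow_neg hs.le, Real.rpow_natCast]
      rw [e, ← div_eq_mul_inv]
      gcongr
    · rw [Set.indicator_of_notMem hs'] at h1 ⊢
      rw [show cumul q s = 0 from le_antisymm h1 h0]; simp
  have hsq : IntegrableOn (fun s => cumul q s ^ 2 / s ^ 4) (Set.Ioi 0) := by
    refine hb.mono' ?_ ?_
    · exact (((continuous_cumul fun r => hqi.integrableOn).pow 2).measurable.div
        (by fun_prop)).aestronglyMeasurable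
    · filter_upwards [self_mem_ae_restrict measurableSet_Ioi] with s hs
      rw [Real.norm_of_nonneg (by positivity)]; exact hle s hs
  refine ⟨⟨?_, hsq⟩, ?_⟩
  · refine ((hqi.const_mul (decay r)).integrableOn).mono' ?_ ?_
    · exact (hqi.aestronglyMeasurable.mul measurable_decay.aestronglyMeasurable).restrict
    · refine ae_of_all _ fun s => ?_
      by_cases hs' : s ∈ Set.Ioc r (2 * r)
      · rw [hq, Set.indicator_of_mem hs', norm_mul, Real.norm_of_nonneg hl,
          Real.norm_of_nonneg (decay_pos (hr.trans hs'.1)).le, mul_comm]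
        gcongr
        exact decay_anti hr hs'.1.le
      · simp [hq, Set.indicator_of_notMem hs']
  · calc _ ≤ ∫ s in Set.Ioi 0, (Set.Ioi r).indicator (fun s => (l * r) ^ 2 * s ^ (-4 : ℝ)) s :=
        setIntegral_mono_on hsq hb measurableSet_Ioi fun s hs => hle s hs
      _ = (l * r) ^ 2 * (3 * r ^ 3)⁻¹ := by
        rw [setIntegral_indicator measurableSet_Ioi,
          Set.inter_eq_right.2 (Set.Ioi_subset_Ioi hr.le), integral_const_mul, he4]
      _ = _ := by field_simp

theorem EnergyLE.sq_mul_pow_le {f : ℝ → ℝ} {a r : ℝ} (hf : EnergyLE f a) (h0 : ∀ s, 0 < s → 0 ≤ f s)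
    (ha : AntitoneOn f (Set.Ioi 0)) (hr : 0 < r) : f r ^ 2 * r ^ 3 ≤ 3 * a := by
  obtain ⟨t, rfl⟩ : ∃ t, r = 2 * t := ⟨r / 2, by ring⟩
  have ht : 0 < t := by linarith
  have hf2 := h0 _ hr
  set l := 3 * t ^ 2 * f (2 * t) with hl
  have hl0 : 0 ≤ l := by positivity
  obtain ⟨hq, hE⟩ := isTest_indicator_Ioc ht hl0
  have h1 := hf _ hq
  have h2 : l * (t * f (2 * t)) ≤
      ∫ s in Set.Ioi 0, (Set.Ioc t (2 * t)).indicator (fun _ => l) s * f s := by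
    have : (fun s => (Set.Ioc t (2 * t)).indicator (fun _ => l) s * f s) =
        (Set.Ioc t (2 * t)).indicator fun s => l * f s := by
      ext s; by_cases hs : s ∈ Set.Ioc t (2 * t)
      · simp [Set.indicator_of_mem hs]
      · simp [Set.indicator_of_notMem hs]
    rw [this, setIntegral_indicator measurableSet_Ioc, Set.inter_eq_right.2
      (Set.Ioc_subset_Ioi_self.trans (Set.Ioi_subset_Ioi ht.le)), integral_const_mul]
    gcongr
    have hc : IntegrableOn f (Set.Ioc t (2 * t)) :=
      ((ha.mono fun x hx => ht.trans_le hx.1).integrableOn_isCompact isCompact_Icc).mono_set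
        Set.Ioc_subset_Icc_self
    calc t * f (2 * t) = ∫ s in Set.Ioc t (2 * t), f (2 * t) := by
          rw [setIntegral_const, Real.volume_real_Ioc_of_le (by linarith), smul_eq_mul]; ring
      _ ≤ _ := setIntegral_mono_on (integrableOn_const (by simp)) hc measurableSet_Ioc
          fun s hs => ha (ht.trans hs.1) hr hs.2
  have h3 : l ^ 2 / (3 * t) = 3 * t ^ 3 * f (2 * t) ^ 2 := by rw [hl]; field_simp
  have h4 : l * (t * f (2 * t)) = 3 * t ^ 3 * f (2 * t) ^ 2 := by rw [hl]; ring
  have : 0 ≤ a := hf.nonneg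
  rw [h3] at hE; rw [h4] at h2
  nlinarith

/-- Helly's selection theorem on the half-line. -/
theorem helly_selection {F : ℕ → ℝ → ℝ} {B : ℝ → ℝ} (ha : ∀ n, AntitoneOn (F n) (Set.Ioi 0))
    (h0 : ∀ n s, 0 < s → 0 ≤ F n s) (hB : ∀ n s, 0 < s → F n s ≤ B s) :
    ∃ (φ : ℕ → ℕ) (f : ℝ → ℝ), StrictMono φ ∧ AntitoneOn f (Set.Ioi 0) ∧
      ∀ᵐ s ∂volume.restrict (Set.Ioi (0 : ℝ)), Tendsto (fun n => F (φ n) s) atTop (𝓝 (f s)) := by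
  set x : ℕ → {q : ℚ // 0 < q} → ℝ := fun n q => F n ((q : ℚ) : ℝ) with hx
  have hpos : ∀ q : {q : ℚ // 0 < q}, (0 : ℝ) < ((q : ℚ) : ℝ) := fun q => by exact_mod_cast q.2
  have hc : IsCompact (Set.pi Set.univ fun q : {q : ℚ // 0 < q} => Set.Icc 0 (B ((q : ℚ) : ℝ))) :=
    isCompact_univ_pi fun q => isCompact_Icc
  obtain ⟨l, -, φ, hφ, hl⟩ := hc.tendsto_subseq (x := x) fun n q _ =>
    ⟨h0 n _ (hpos q), hB n _ (hpos q)⟩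
  rw [tendsto_pi_nhds] at hl
  set f : ℝ → ℝ := fun s => limsup (fun n => F (φ n) s) atTop with hf
  have hbd : ∀ s, 0 < s → IsBoundedUnder (· ≤ ·) atTop fun n => F (φ n) s := fun s hs =>
    isBoundedUnder_of ⟨B s, fun n => hB _ _ hs⟩
  have hbd' : ∀ s, 0 < s → IsCoboundedUnder (· ≤ ·) atTop fun n => F (φ n) s := fun s hs =>
    (isBoundedUnder_of ⟨0, fun n => h0 _ _ hs⟩ :
      IsBoundedUnder (· ≥ ·) atTop fun n => F (φ n) s).isCoboundedUnder_le
  have hfa : AntitoneOn f (Set.Ioi 0) := fun s hs t ht hst =>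
    limsup_le_limsup (Eventually.of_forall fun n => ha (φ n) hs ht hst) (hbd' t ht) (hbd s hs)
  have hfq : ∀ q : {q : ℚ // 0 < q}, Tendsto (fun n => F (φ n) ((q : ℚ) : ℝ)) atTop
      (𝓝 (f ((q : ℚ) : ℝ))) := fun q => by
    have h1 : Tendsto (fun n => F (φ n) ((q : ℚ) : ℝ)) atTop (𝓝 (l q)) := hl q
    rw [show f ((q : ℚ) : ℝ) = l q from h1.limsup_eq]
    exact h1
  refine ⟨φ, f, hφ, hfa, ?_⟩
  have hcount := hfa.countable_not_continuousWithinAt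
  filter_upwards [self_mem_ae_restrict measurableSet_Ioi,
    hcount.ae_notMem (volume.restrict (Set.Ioi 0))] with s hs hns
  have hs' : (0 : ℝ) < s := hs
  have hcs : ContinuousAt f s := by
    have : ContinuousWithinAt f (Set.Ioi 0) s := by
      by_contra hh; exact hns ⟨hs, hh⟩
    exact this.continuousAt (Ioi_mem_nhds hs)
  rw [tendsto_order]
  constructor
  · intro y hy
    obtain ⟨e, he, hee⟩ := Metric.mem_nhds_iff.1 (hcs.eventually (lt_mem_nhds hy))
    obtain ⟨q, hq1, hq2⟩ := exists_rat_btwn (show s < s + e by linarith)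
    have hq0 : 0 < q := by exact_mod_cast hs'.trans hq1
    have hyq : y < f q := hee (by rw [Metric.mem_ball, Real.dist_eq, abs_of_pos] <;> linarith)
    filter_upwards [(hfq ⟨q, hq0⟩).eventually (lt_mem_nhds hyq)] with n hn
    exact hn.trans_le (ha _ hs (hs'.trans hq1) hq1.le)
  · intro y hy
    obtain ⟨e, he, hee⟩ := Metric.mem_nhds_iff.1 (hcs.eventually (gt_mem_nhds hy))
    obtain ⟨q, hq1, hq2⟩ := exists_rat_btwn (show max 0 (s - e) < s from max_lt hs' (by linarith))
    have hq0' : (0 : ℝ) < q := (le_max_left _ _).trans_lt hq1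
    have hq1' : s - e < q := (le_max_right _ _).trans_lt hq1
    have hq0 : 0 < q := by exact_mod_cast hq0'
    have hyq : f q < y := hee (by
      rw [Metric.mem_ball, Real.dist_eq, abs_of_neg] <;> linarith)
    filter_upwards [(hfq ⟨q, hq0⟩).eventually (gt_mem_nhds hyq)] with n hn
    exact (ha _ hq0' hs hq2.le).trans_lt hn

/-- Decreasing profiles with radial Dirichlet energy at most `a` and radial mass at most `m`. -/
structure AdmFn (f : ℝ → ℝ) (a m : ℝ) : Prop where
  nonneg : ∀ s, 0 < s → 0 ≤ f s
  anti : AntitoneOn f (Set.Ioi 0)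
  energy : EnergyLE f a
  sq : IntegrableOn (fun s => f s ^ 2 * s ^ 4) (Set.Ioi 0)
  mass : ∫ s in Set.Ioi 0, f s ^ 2 * s ^ 4 ≤ m

namespace AdmFn

variable {f : ℝ → ℝ} {a m : ℝ}

theorem le_decay (H : AdmFn f a m) {A M : ℝ} (hA : a ≤ A) (hM : m ≤ M) :
    ∀ s, 0 < s → |f s| ≤ max √(3 * A) √(5 * M) * decay s :=
  le_decay_of_bounds H.nonneg
    (fun s hs => (H.energy.sq_mul_pow_le H.nonneg H.anti hs).trans (by linarith))
    fun s hs => (sq_mul_pow_le_of_antitoneOn H.anti H.nonneg H.sq hs).trans (by linarith [H.mass])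

theorem exists_le_decay (H : AdmFn f a m) : ∃ C, 0 ≤ C ∧ ∀ s, 0 < s → |f s| ≤ C * decay s :=
  ⟨_, by positivity, H.le_decay le_rfl le_rfl⟩

theorem measurable (H : AdmFn f a m) : AEStronglyMeasurable f (volume.restrict (Set.Ioi 0)) :=
  (aemeasurable_restrict_of_antitoneOn measurableSet_Ioi H.anti).aestronglyMeasurable

theorem a_nonneg (H : AdmFn f a m) : 0 ≤ a := H.energy.nonneg

theorem m_nonneg (H : AdmFn f a m) : 0 ≤ m :=
  (integral_nonneg fun s => by positivity).trans H.mass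

theorem const_mul (H : AdmFn f a m) {c : ℝ} (hc : 0 ≤ c) :
    AdmFn (fun s => c * f s) (c ^ 2 * a) (c ^ 2 * m) where
  nonneg s hs := mul_nonneg hc (H.nonneg s hs)
  anti s hs t ht hst := mul_le_mul_of_nonneg_left (H.anti hs ht hst) hc
  energy := H.energy.const_mul c
  sq := by
    simp only [mul_pow, mul_assoc]
    exact H.sq.const_mul _
  mass := by
    simp only [mul_pow, mul_assoc]
    rw [integral_const_mul]
    exact mul_le_mul_of_nonneg_left H.mass (sq_nonneg c)

end AdmFn

theorem admFn_of_tendsto {F : ℕ → ℝ → ℝ} {f : ℝ → ℝ} {α μ : ℕ → ℝ} {a m : ℝ}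
    (h : ∀ n, AdmFn (F n) (α n) (μ n)) (ha : Tendsto α atTop (𝓝 a)) (hm : Tendsto μ atTop (𝓝 m))
    (hf : AntitoneOn f (Set.Ioi 0))
    (hl : ∀ᵐ s ∂volume.restrict (Set.Ioi (0 : ℝ)), Tendsto (fun n => F n s) atTop (𝓝 (f s))) :
    AdmFn f a m := by
  obtain ⟨A, hA⟩ := ha.bddAbove_range
  obtain ⟨M, hM⟩ := hm.bddAbove_range
  have hA' : ∀ n, α n ≤ A := fun n => hA ⟨n, rfl⟩
  have hM' : ∀ n, μ n ≤ M := fun n => hM ⟨n, rfl⟩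
  have hfm : AEStronglyMeasurable f (volume.restrict (Set.Ioi 0)) :=
    (aemeasurable_restrict_of_antitoneOn measurableSet_Ioi hf).aestronglyMeasurable
  have h0 : ∀ s, 0 < s → 0 ≤ f s := fun s hs => by
    rw [ae_restrict_iff' measurableSet_Ioi] at hl
    have hne : ∃ t ∈ Set.Ioi s, Tendsto (fun n => F n t) atTop (𝓝 (f t)) := by
      by_contra! hno
      have h1 := measure_mono_null (s := Set.Ioi s) (fun t ht => ?_) (ae_iff.1 hl)
      · simp at h1
      · exact fun htt => hno t ht (htt (hs.trans ht))
    obtain ⟨t, ht, htt⟩ := hne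
    exact (ge_of_tendsto' htt fun n => (h n).nonneg t (hs.trans ht)).trans
      (hf hs (hs.trans ht) (le_of_lt ht))
  have hmass : ∫⁻ s in Set.Ioi 0, ENNReal.ofReal (f s ^ 2 * s ^ 4) ≤ ENNReal.ofReal m := by
    calc _ ≤ ∫⁻ s in Set.Ioi 0, liminf (fun n => ENNReal.ofReal (F n s ^ 2 * s ^ 4)) atTop := by
          refine lintegral_mono_ae ?_
          filter_upwards [hl] with s hs
          exact (ENNReal.tendsto_ofReal ((hs.pow 2).mul_const _)).liminf_eq.ge
      _ ≤ liminf (fun n => ∫⁻ s in Set.Ioi 0, ENNReal.ofReal (F n s ^ 2 * s ^ 4)) atTop :=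
          lintegral_liminf_le' fun n => (h n).sq.aestronglyMeasurable.aemeasurable.ennreal_ofReal
      _ ≤ liminf (fun n => ENNReal.ofReal (μ n)) atTop := by
          refine liminf_le_liminf (Eventually.of_forall fun n => ?_)
          rw [← ofReal_integral_eq_lintegral_ofReal (h n).sq (ae_of_all _ fun s => by positivity)]
          exact ENNReal.ofReal_le_ofReal (h n).mass
      _ = _ := (ENNReal.tendsto_ofReal hm).liminf_eq
  have hsq : IntegrableOn (fun s => f s ^ 2 * s ^ 4) (Set.Ioi 0) := by
    refine ⟨(hfm.pow 2).mul (by fun_prop), ?_⟩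
    rw [hasFiniteIntegral_iff_ofReal (ae_of_all _ fun s => by positivity)]
    exact hmass.trans_lt ENNReal.ofReal_lt_top
  refine ⟨h0, hf, fun q hq => ?_, hsq, ?_⟩
  · have ht : Tendsto (fun n => ∫ s in Set.Ioi 0, q s * F n s) atTop
        (𝓝 (∫ s in Set.Ioi 0, q s * f s)) := by
      refine tendsto_integral_of_dominated_convergence
        (fun s => max √(3 * A) √(5 * M) * ‖q s * decay s‖)
        (fun n => hq.aestronglyMeasurable.mul (h n).measurable) (hq.int.norm.const_mul _) ?_ ?_
      · intro n
        filter_upwards [self_mem_ae_restrict measurableSet_Ioi] with s hs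
        have h1 := (h n).le_decay (hA' n) (hM' n) s hs
        rw [norm_mul, norm_mul, Real.norm_of_nonneg (decay_pos hs).le, mul_left_comm]
        gcongr
        exact h1
      · filter_upwards [hl] with s hs using hs.const_mul _
    exact le_of_tendsto_of_tendsto' ((ht.const_mul 2).sub_const _) ha fun n => (h n).energy q hq
  · rw [integral_eq_lintegral_of_nonneg_ae (ae_of_all _ fun s => by positivity)
      hsq.aestronglyMeasurable]
    exact ENNReal.toReal_le_of_le_ofReal (ge_of_tendsto' hm fun n => (h n).m_nonneg) hmass

/-- The radial form of the interaction functional. -/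
noncomputable def radPot (f g : ℝ → ℝ) : ℝ := ∫ s in Set.Ioi 0, g s * f s ^ 2 * s ^ 4

/-- Pairs of profiles whose quadratic functional is at most `N`. -/
def AdmPair (ω : ℝ) (f g : ℝ → ℝ) (N : ℝ) : Prop :=
  ∃ a b m n, AdmFn f a m ∧ AdmFn g b n ∧ a + b / 2 + ω * m + 2 * ω * n ≤ N

theorem abs_radPot_integrand_le {f g : ℝ → ℝ} {C s : ℝ} (hs : 0 < s) (hC : 0 ≤ C)
    (hf : |f s| ≤ C * decay s) (hg : |g s| ≤ C * decay s) :
    ‖g s * f s ^ 2 * s ^ 4‖ ≤ C ^ 3 * (decay s ^ 3 * s ^ 4) := by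
  have hd := decay_pos hs
  rw [norm_mul, norm_mul, norm_pow, norm_pow, Real.norm_eq_abs, Real.norm_eq_abs,
    Real.norm_of_nonneg hs.le]
  calc |g s| * |f s| ^ 2 * s ^ 4 ≤ C * decay s * (C * decay s) ^ 2 * s ^ 4 := by gcongr
    _ = _ := by ring

theorem integrableOn_radPot {f g : ℝ → ℝ} {C : ℝ}
    (hfm : AEStronglyMeasurable f (volume.restrict (Set.Ioi 0)))
    (hgm : AEStronglyMeasurable g (volume.restrict (Set.Ioi 0))) (hC : 0 ≤ C)
    (hf : ∀ s, 0 < s → |f s| ≤ C * decay s) (hg : ∀ s, 0 < s → |g s| ≤ C * decay s) :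
    IntegrableOn (fun s => g s * f s ^ 2 * s ^ 4) (Set.Ioi 0) := by
  refine (integrableOn_decay_cube.const_mul (C ^ 3)).mono'
    ((hgm.mul (hfm.pow 2)).mul (by fun_prop)) ?_
  filter_upwards [self_mem_ae_restrict measurableSet_Ioi] with s hs
  exact abs_radPot_integrand_le hs hC (hf s hs) (hg s hs)

theorem AdmPair.integrableOn_radPot {ω : ℝ} {f g : ℝ → ℝ} {N : ℝ} (h : AdmPair ω f g N) :
    IntegrableOn (fun s => g s * f s ^ 2 * s ^ 4) (Set.Ioi 0) := by
  obtain ⟨a, b, m, n, hf, hg, -⟩ := h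
  obtain ⟨C, hC, hfC⟩ := hf.exists_le_decay
  obtain ⟨D, hD, hgD⟩ := hg.exists_le_decay
  refine _root_.integrableOn_radPot hf.measurable hg.measurable (C := max C D) (by positivity)
    (fun s hs => (hfC s hs).trans ?_) (fun s hs => (hgD s hs).trans ?_)
  · have := decay_pos hs; gcongr; exact le_max_left _ _
  · have := decay_pos hs; gcongr; exact le_max_right _ _

theorem AdmPair.const_mul {ω : ℝ} {f g : ℝ → ℝ} {N c : ℝ} (h : AdmPair ω f g N) (hc : 0 ≤ c) :
    AdmPair ω (fun s => c * f s) (fun s => c * g s) (c ^ 2 * N) := by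
  obtain ⟨a, b, m, n, hf, hg, hN⟩ := h
  refine ⟨_, _, _, _, hf.const_mul hc, hg.const_mul hc, ?_⟩
  nlinarith [sq_nonneg c]

theorem radPot_const_mul (c : ℝ) (f g : ℝ → ℝ) :
    radPot (fun s => c * f s) (fun s => c * g s) = c ^ 3 * radPot f g := by
  rw [radPot, radPot, ← integral_const_mul]
  congr 1; ext s; ring

theorem exists_maximizer {ω : ℝ} (hω : 0 < ω) : ∃ f g, AdmPair ω f g 1 ∧
    ∀ f' g', AdmPair ω f' g' 1 → radPot f' g' ≤ radPot f g := by
  set S : Set ℝ := {p | ∃ f g, AdmPair ω f g 1 ∧ radPot f g = p} with hS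
  set C := max √(3 * 2) √(5 * (1 / ω)) with hC
  have hC0 : 0 ≤ C := by positivity
  have hbounds : ∀ {a b m n : ℝ} {f g : ℝ → ℝ}, AdmFn f a m → AdmFn g b n →
      a + b / 2 + ω * m + 2 * ω * n ≤ 1 → a ≤ 2 ∧ b ≤ 2 ∧ m ≤ 1 / ω ∧ n ≤ 1 / ω := by
    intro a b m n f g hf hg h
    have h1 := hf.a_nonneg
    have h2 := hg.a_nonneg
    have h3 := mul_nonneg hω.le hf.m_nonneg
    have h4 := mul_nonneg hω.le hg.m_nonneg
    refine ⟨by linarith, by linarith, ?_, ?_⟩ <;> rw [le_div_iff₀ hω] <;> linarith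
  have hne : S.Nonempty := by
    have hz : AdmFn (fun _ => 0) 0 0 := ⟨fun _ _ => le_rfl, fun _ _ _ _ _ => le_rfl, fun q hq => by
      simpa using integral_nonneg fun r => by positivity, by simp, by simp⟩
    exact ⟨_, _, _, ⟨0, 0, 0, 0, hz, hz, by simp⟩, rfl⟩
  have hbdd : BddAbove S := by
    refine ⟨C ^ 3 * ∫ s in Set.Ioi 0, decay s ^ 3 * s ^ 4, ?_⟩
    rintro _ ⟨f, g, hp, rfl⟩
    have hp' := hp
    obtain ⟨a, b, m, n, hf, hg, hN⟩ := hp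
    obtain ⟨ha, hb, hm, hn⟩ := hbounds hf hg hN
    rw [← integral_const_mul]
    exact setIntegral_mono_on hp'.integrableOn_radPot (integrableOn_decay_cube.const_mul _)
      measurableSet_Ioi fun s hs => (le_abs_self _).trans
        (abs_radPot_integrand_le hs hC0 (hf.le_decay ha hm s hs) (hg.le_decay hb hn s hs))
  obtain ⟨p, -, hp, hpS⟩ := exists_seq_tendsto_sSup hne hbdd
  choose F G hFG hP using hpS
  choose a b m n hF hG hN using hFG
  have hb := fun i => hbounds (hF i) (hG i) (hN i)
  obtain ⟨φ, f, hφ, hfa, hfl⟩ := helly_selection (F := F) (B := fun s => C * decay s)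
    (fun i => (hF i).anti) (fun i => (hF i).nonneg) fun i s hs => (le_abs_self _).trans
      ((hF i).le_decay (hb i).1 (hb i).2.2.1 s hs)
  obtain ⟨φ', g, hφ', hga, hgl⟩ := helly_selection (F := fun i => G (φ i)) (B := fun s => C * decay s)
    (fun i => (hG _).anti) (fun i => (hG _).nonneg) fun i s hs => (le_abs_self _).trans
      ((hG _).le_decay (hb _).2.1 (hb _).2.2.2 s hs)
  have hcomp : IsCompact (Set.Icc (0 : ℝ) 2 ×ˢ Set.Icc (0 : ℝ) 2 ×ˢ Set.Icc (0 : ℝ) (1 / ω) ×ˢ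
      Set.Icc (0 : ℝ) (1 / ω)) :=
    isCompact_Icc.prod (isCompact_Icc.prod (isCompact_Icc.prod isCompact_Icc))
  obtain ⟨⟨a', b', m', n'⟩, -, φ'', hφ'', hl⟩ := hcomp.tendsto_subseq
    (x := fun i => (a (φ (φ' i)), b (φ (φ' i)), m (φ (φ' i)), n (φ (φ' i)))) fun i =>
      ⟨⟨(hF _).a_nonneg, (hb _).1⟩, ⟨(hG _).a_nonneg, (hb _).2.1⟩, ⟨(hF _).m_nonneg, (hb _).2.2.1⟩,
        ⟨(hG _).m_nonneg, (hb _).2.2.2⟩⟩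
  have la : Tendsto (fun i => a (φ (φ' (φ'' i)))) atTop (𝓝 a') := hl.fst_nhds
  have lb : Tendsto (fun i => b (φ (φ' (φ'' i)))) atTop (𝓝 b') := hl.snd_nhds.fst_nhds
  have lm : Tendsto (fun i => m (φ (φ' (φ'' i)))) atTop (𝓝 m') := hl.snd_nhds.snd_nhds.fst_nhds
  have ln : Tendsto (fun i => n (φ (φ' (φ'' i)))) atTop (𝓝 n') := hl.snd_nhds.snd_nhds.snd_nhds
  have lf : ∀ᵐ s ∂volume.restrict (Set.Ioi (0 : ℝ)),
      Tendsto (fun i => F (φ (φ' (φ'' i))) s) atTop (𝓝 (f s)) := by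
    filter_upwards [hfl] with s hs using hs.comp (hφ'.comp hφ'').tendsto_atTop
  have lg : ∀ᵐ s ∂volume.restrict (Set.Ioi (0 : ℝ)),
      Tendsto (fun i => G (φ (φ' (φ'' i))) s) atTop (𝓝 (g s)) := by
    filter_upwards [hgl] with s hs using hs.comp hφ''.tendsto_atTop
  refine ⟨f, g, ⟨a', b', m', n', admFn_of_tendsto (fun i => hF _) la lm hfa lf,
    admFn_of_tendsto (fun i => hG _) lb ln hga lg, ?_⟩, fun f' g' h' => ?_⟩
  · exact le_of_tendsto' (((la.add (lb.div_const 2)).add (lm.const_mul ω)).add (ln.const_mul (2 * ω)))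
      fun i => hN _
  · have l1 : Tendsto (fun i => radPot (F (φ (φ' (φ'' i)))) (G (φ (φ' (φ'' i))))) atTop
        (𝓝 (radPot f g)) := by
      refine tendsto_integral_of_dominated_convergence (fun s => C ^ 3 * (decay s ^ 3 * s ^ 4))
        (fun i => ((hG _).measurable.mul ((hF _).measurable.pow 2)).mul (by fun_prop))
        (integrableOn_decay_cube.const_mul _) (fun i => ?_) ?_
      · filter_upwards [self_mem_ae_restrict measurableSet_Ioi] with s hs
        exact abs_radPot_integrand_le hs hC0 ((hF _).le_decay (hb _).1 (hb _).2.2.1 s hs)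
          ((hG _).le_decay (hb _).2.1 (hb _).2.2.2 s hs)
      · filter_upwards [lf, lg] with s h1 h2 using (h2.mul (h1.pow 2)).mul_const _
    simp only [hP] at l1
    rw [tendsto_nhds_unique l1 (hp.comp (hφ.comp (hφ'.comp hφ'')).tendsto_atTop)]
    exact le_csSup hbdd ⟨f', g', h', rfl⟩

theorem IsSource.integrableOn_mul {h f : ℝ → ℝ} (hh : IsSource h) {C : ℝ}
    (hfm : AEStronglyMeasurable f (volume.restrict (Set.Ioi 0)))
    (hC : ∀ s, 0 < s → |f s| ≤ C * decay s) :
    IntegrableOn (fun s => s ^ 4 * h s * f s) (Set.Ioi 0) := by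
  obtain ⟨D, hD0, hD⟩ := hh.le
  refine (integrableOn_decay_cube.const_mul (D * C)).mono'
    (((continuous_pow 4).aestronglyMeasurable.mul hh.measurable).mul hfm) ?_
  filter_upwards [self_mem_ae_restrict measurableSet_Ioi] with s hs
  have hs' : 0 < s := hs
  have hd := decay_pos hs
  rw [norm_mul, norm_mul, Real.norm_of_nonneg (hh.nonneg s hs), norm_pow, Real.norm_of_nonneg hs'.le,
    Real.norm_eq_abs]
  have h0 := hh.nonneg s hs
  calc s ^ 4 * h s * |f s| ≤ s ^ 4 * (D * decay s ^ 2) * (C * decay s) := by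
        gcongr
        · exact hD s hs
        · exact hC s hs
    _ = _ := by ring

theorem integrableOn_mul_of_sq {f F : ℝ → ℝ} (hfm : AEStronglyMeasurable f (volume.restrict (Set.Ioi 0)))
    (hFm : AEStronglyMeasurable F (volume.restrict (Set.Ioi 0)))
    (hf : IntegrableOn (fun s => f s ^ 2 * s ^ 4) (Set.Ioi 0))
    (hF : IntegrableOn (fun s => F s ^ 2 * s ^ 4) (Set.Ioi 0)) :
    IntegrableOn (fun s => F s * f s * s ^ 4) (Set.Ioi 0) := by
  refine (hf.add hF).mono' ((hFm.mul hfm).mul (continuous_pow 4).aestronglyMeasurable)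
    (ae_of_all _ fun s => ?_)
  simp only [Pi.add_apply]
  rw [norm_mul, Real.norm_of_nonneg (by positivity : (0:ℝ) ≤ s ^ 4), ← add_mul]
  gcongr
  rw [Real.norm_eq_abs, abs_le]
  constructor <;> nlinarith [sq_nonneg (f s - F s), sq_nonneg (f s + F s)]

namespace IsPotential

variable {k : ℝ} {h F Θ : ℝ → ℝ}

theorem exists_abs_le_decay (H : IsPotential k h F Θ) (hk : 0 < k) (hh : IsSource h) :
    ∃ C, 0 ≤ C ∧ ∀ s, 0 < s → |F s| ≤ C * decay s := by
  obtain ⟨C, hC0, hC⟩ := H.le_decay hk hh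
  exact ⟨C, hC0, fun s hs => by rw [abs_of_nonneg (H.F_nonneg s hs)]; exact hC s hs⟩

theorem integral_charge_mul (H : IsPotential k h F Θ) (hk : 0 < k) (hh : IsSource h) {f : ℝ → ℝ}
    {C : ℝ} (hfm : AEStronglyMeasurable f (volume.restrict (Set.Ioi 0)))
    (hC : ∀ s, 0 < s → |f s| ≤ C * decay s)
    (hf : IntegrableOn (fun s => f s ^ 2 * s ^ 4) (Set.Ioi 0)) :
    ∫ s in Set.Ioi 0, s ^ 4 * (h s - k ^ 2 * F s) * f s =
      (∫ s in Set.Ioi 0, s ^ 4 * h s * f s) - k ^ 2 * ∫ s in Set.Ioi 0, F s * f s * s ^ 4 := by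
  rw [← integral_const_mul, ← integral_sub (hh.integrableOn_mul hfm hC)
    ((integrableOn_mul_of_sq hfm H.measurable_F hf (H.integrableOn_sq hk hh)).const_mul _)]
  congr 1; ext s; ring

theorem integral_sq_add (H : IsPotential k h F Θ) (hk : 0 < k) (hh : IsSource h) {f : ℝ → ℝ}
    (hfm : AEStronglyMeasurable f (volume.restrict (Set.Ioi 0)))
    (hf : IntegrableOn (fun s => f s ^ 2 * s ^ 4) (Set.Ioi 0)) (t : ℝ) :
    IntegrableOn (fun s => (f s + t * F s) ^ 2 * s ^ 4) (Set.Ioi 0) ∧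
    ∫ s in Set.Ioi 0, (f s + t * F s) ^ 2 * s ^ 4 =
      (∫ s in Set.Ioi 0, f s ^ 2 * s ^ 4) + 2 * t * (∫ s in Set.Ioi 0, F s * f s * s ^ 4) +
        t ^ 2 * ∫ s in Set.Ioi 0, F s ^ 2 * s ^ 4 := by
  have i2 := (integrableOn_mul_of_sq hfm H.measurable_F hf (H.integrableOn_sq hk hh)).const_mul (2 * t)
  have i3 := (H.integrableOn_sq hk hh).const_mul (t ^ 2)
  have i12 : IntegrableOn (fun s => f s ^ 2 * s ^ 4 + 2 * t * (F s * f s * s ^ 4)) (Set.Ioi 0) :=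
    hf.add i2
  have e : (fun s => (f s + t * F s) ^ 2 * s ^ 4) = fun s =>
      f s ^ 2 * s ^ 4 + 2 * t * (F s * f s * s ^ 4) + t ^ 2 * (F s ^ 2 * s ^ 4) := by ext s; ring
  rw [e]
  refine ⟨i12.add i3, ?_⟩
  rw [← integral_const_mul, ← integral_const_mul, ← integral_add hf i2, ← integral_add i12 i3]

theorem admFn_add (H : IsPotential k h F Θ) (hk : 0 < k) (hh : IsSource h) {f : ℝ → ℝ}
    {a m : ℝ} (hf : AdmFn f a m) {t : ℝ} (ht : 0 ≤ t) :
    ∃ a' m', AdmFn (fun s => f s + t * F s) a' m' ∧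
      a' + k ^ 2 * m' = a + k ^ 2 * m + 2 * t * (∫ s in Set.Ioi 0, s ^ 4 * h s * f s) +
        t ^ 2 * ∫ s in Set.Ioi 0, s ^ 4 * h s * F s := by
  obtain ⟨C, hC0, hC⟩ := hf.exists_le_decay
  obtain ⟨D, hD0, hD⟩ := H.exists_abs_le_decay hk hh
  obtain ⟨i1, i2⟩ := H.integral_sq_add hk hh hf.measurable hf.sq t
  have hE := H.energy_add hk hh hf.energy hf.measurable hC t
  have e1 := H.integral_charge_mul hk hh hf.measurable hC hf.sq
  have e2 := H.integral_charge_mul hk hh H.measurable_F hD (H.integrableOn_sq hk hh)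
  refine ⟨_, m + 2 * t * (∫ s in Set.Ioi 0, F s * f s * s ^ 4) +
        t ^ 2 * ∫ s in Set.Ioi 0, F s ^ 2 * s ^ 4, ⟨fun s hs => ?_, ?_, hE, i1, ?_⟩, ?_⟩
  · exact add_nonneg (hf.nonneg s hs) (mul_nonneg ht (H.F_nonneg s hs))
  · exact fun x hx y hy hxy => add_le_add (hf.anti hx hy hxy)
      (mul_le_mul_of_nonneg_left (H.antitoneOn hx hy hxy) ht)
  · rw [i2]; linarith [hf.mass]
  · rw [e1, e2]
    simp only [pow_two (F _)]
    ring

theorem sq_sub_le (H : IsPotential k h F Θ) (hk : 0 < k) (hh : IsSource h) {f : ℝ → ℝ}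
    {a m : ℝ} (hf : AdmFn f a m) :
    2 * (∫ s in Set.Ioi 0, s ^ 4 * h s * f s) - (∫ s in Set.Ioi 0, s ^ 4 * h s * F s) +
      k ^ 2 * (∫ s in Set.Ioi 0, (f s + -1 * F s) ^ 2 * s ^ 4) ≤ a + k ^ 2 * m := by
  obtain ⟨C, hC0, hC⟩ := hf.exists_le_decay
  obtain ⟨D, hD0, hD⟩ := H.exists_abs_le_decay hk hh
  obtain ⟨i1, i2⟩ := H.integral_sq_add hk hh hf.measurable hf.sq (-1)
  have e1 := H.integral_charge_mul hk hh hf.measurable hC hf.sq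
  have e2 := H.integral_charge_mul hk hh H.measurable_F hD (H.integrableOn_sq hk hh)
  have h1 := hf.energy _ (H.isTest hk hh)
  rw [H.energy_charge hk hh, e1, e2] at h1
  rw [i2]
  simp only [pow_two (F _)] at h1 ⊢
  nlinarith [hf.mass, sq_nonneg k]

theorem ae_eq_of_integral_sq (H : IsPotential k h F Θ) (hk : 0 < k) (hh : IsSource h) {f : ℝ → ℝ}
    {a m : ℝ} (hf : AdmFn f a m)
    (h0 : ∫ s in Set.Ioi 0, (f s + -1 * F s) ^ 2 * s ^ 4 ≤ 0) :
    f =ᵐ[volume.restrict (Set.Ioi 0)] F := by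
  obtain ⟨i1, -⟩ := H.integral_sq_add hk hh hf.measurable hf.sq (-1)
  have h1 := (integral_eq_zero_iff_of_nonneg (fun s => by positivity) i1).1
    (le_antisymm h0 (integral_nonneg fun s => by positivity))
  filter_upwards [h1, self_mem_ae_restrict measurableSet_Ioi] with s hs hs'
  have hs'' : (0 : ℝ) < s := hs'
  have : (f s + -1 * F s) ^ 2 = 0 := by
    simpa [hs''.ne'] using hs
  have := pow_eq_zero_iff (two_ne_zero) |>.1 this
  linarith

theorem congr_source (H : IsPotential k h F Θ) {h' : ℝ → ℝ}
    (he : h =ᵐ[volume.restrict (Set.Ioi 0)] h') : IsPotential k h' F Θ := by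
  refine ⟨H.contF, H.contΘ, H.F_nonneg, H.Θ_nonneg, H.F_sub, fun a b ha hab => ?_, H.Θ_zero⟩
  rw [H.Θ_sub a b ha hab, intervalIntegral.integral_of_le hab, intervalIntegral.integral_of_le hab]
  refine integral_congr_ae ?_
  have : (volume.restrict (Set.Ioc a b)) ≤ volume.restrict (Set.Ioi 0) :=
    Measure.restrict_mono (Set.Ioc_subset_Ioi_self.trans (Set.Ioi_subset_Ioi ha.le)) le_rfl
  filter_upwards [Measure.absolutelyContinuous_of_le this |>.ae_le he] with s hs
  rw [hs]

end IsPotential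

theorem isSource_mul {f g : ℝ → ℝ} {c C D : ℝ} (hc : 0 ≤ c) (hf0 : ∀ s, 0 < s → 0 ≤ f s)
    (hg0 : ∀ s, 0 < s → 0 ≤ g s) (hf : AntitoneOn f (Set.Ioi 0)) (hg : AntitoneOn g (Set.Ioi 0))
    (hC0 : 0 ≤ C) (hD0 : 0 ≤ D) (hC : ∀ s, 0 < s → |f s| ≤ C * decay s)
    (hD : ∀ s, 0 < s → |g s| ≤ D * decay s) : IsSource fun s => c * (g s * f s) where
  anti x hx y hy hxy := mul_le_mul_of_nonneg_left
    (mul_le_mul (hg hx hy hxy) (hf hx hy hxy) (hf0 y hy) (hg0 x hx)) hc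
  nonneg s hs := mul_nonneg hc (mul_nonneg (hg0 s hs) (hf0 s hs))
  le := ⟨c * (D * C), by positivity, fun s hs => by
    have h1 := hC s hs
    have h2 := hD s hs
    have := decay_pos hs
    rw [abs_of_nonneg (hf0 s hs)] at h1
    rw [abs_of_nonneg (hg0 s hs)] at h2
    calc c * (g s * f s) ≤ c * ((D * decay s) * (C * decay s)) := by
          gcongr
          exact hf0 s hs
      _ = _ := by ring⟩

theorem le_one_of_forall_sq_le_cube {N : ℝ} (h : ∀ t, 0 < t → (1 + 3 * N * t) ^ 2 ≤
    (1 + 2 * t + t ^ 2 * N) ^ 3) : N ≤ 1 := by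
  by_contra! hN
  set B := 3 * N + 3 * (2 + N) ^ 2 + (2 + N) ^ 3 with hB
  have hB0 : 0 < B := by positivity
  set t := min 1 ((N - 1) / B) with ht
  have ht0 : 0 < t := lt_min one_pos (div_pos (by linarith) hB0)
  have ht1 : t ≤ 1 := min_le_left _ _
  have ht2 : B * t ≤ N - 1 := by
    have : t ≤ (N - 1) / B := min_le_right _ _
    rw [le_div_iff₀ hB0] at this; linarith
  have h1 := h t ht0
  set y := 2 * t + t ^ 2 * N with hy
  have hy0 : 0 ≤ y := by positivity
  have hyt : y ≤ (2 + N) * t := by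
    have : t ^ 2 ≤ t := by nlinarith
    nlinarith
  have hy2 : y ^ 2 ≤ (2 + N) ^ 2 * t := by
    calc y ^ 2 ≤ ((2 + N) * t) ^ 2 := by gcongr
      _ = (2 + N) ^ 2 * (t * t) := by ring
      _ ≤ (2 + N) ^ 2 * (1 * t) := by gcongr
      _ = _ := by ring
  have hy2' : y ^ 2 ≤ (2 + N) ^ 2 * t ^ 2 := by
    calc y ^ 2 ≤ ((2 + N) * t) ^ 2 := by gcongr
      _ = _ := by ring
  have hy3 : y ^ 3 ≤ (2 + N) ^ 3 * t ^ 2 := by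
    calc y ^ 3 ≤ ((2 + N) * t) ^ 3 := by gcongr
      _ = (2 + N) ^ 3 * (t ^ 2 * t) := by ring
      _ ≤ (2 + N) ^ 3 * (t ^ 2 * 1) := by gcongr
      _ = _ := by ring
  have h2 : 1 + 6 * N * t + 9 * N ^ 2 * t ^ 2 ≤ 1 + 3 * y + 3 * y ^ 2 + y ^ 3 := by
    calc _ = (1 + 3 * N * t) ^ 2 := by ring
      _ ≤ (1 + 2 * t + t ^ 2 * N) ^ 3 := h1
      _ = _ := by rw [hy]; ring
  have h3 : 6 * (N - 1) * t ≤ B * t * t := by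
    rw [hB]
    have : 0 ≤ 9 * N ^ 2 * t ^ 2 := by positivity
    nlinarith
  have : 6 * (N - 1) ≤ B * t := le_of_mul_le_mul_right h3 ht0
  linarith

theorem AdmPair.mono {ω : ℝ} {f g : ℝ → ℝ} {N N' : ℝ} (h : AdmPair ω f g N) (hN : N ≤ N') :
    AdmPair ω f g N' := by
  obtain ⟨a, b, m, n, hf, hg, hl⟩ := h
  exact ⟨a, b, m, n, hf, hg, hl.trans hN⟩

theorem AdmPair.radPot_le {ω p : ℝ} (hmax : ∀ f g, AdmPair ω f g 1 → radPot f g ≤ p)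
    {f g : ℝ → ℝ} {N : ℝ} (h : AdmPair ω f g N) (hN : 0 < N) : radPot f g ≤ p * √N ^ 3 := by
  have hs : 0 < √N := Real.sqrt_pos.2 hN
  have h1 := h.const_mul (inv_nonneg.2 hs.le)
  rw [inv_pow, Real.sq_sqrt hN.le, inv_mul_cancel₀ hN.ne'] at h1
  have h2 := hmax _ _ h1
  rw [radPot_const_mul, inv_pow, inv_mul_le_iff₀ (by positivity)] at h2
  linarith

theorem IsPotential.integral_flux_sq {k : ℝ} {h F Θ : ℝ → ℝ} (H : IsPotential k h F Θ) (hk : 0 < k)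
    (hh : IsSource h) : (∫ s in Set.Ioi 0, Θ s ^ 2 / s ^ 4) + k ^ 2 * ∫ s in Set.Ioi 0, F s ^ 2 * s ^ 4 =
      ∫ s in Set.Ioi 0, s ^ 4 * h s * F s := by
  obtain ⟨D, hD0, hD⟩ := H.exists_abs_le_decay hk hh
  have e2 := H.integral_charge_mul hk hh H.measurable_F hD (H.integrableOn_sq hk hh)
  have e3 := H.energy_charge hk hh
  have e4 : ∫ r in Set.Ioi 0, cumul (fun s => s ^ 4 * (h s - k ^ 2 * F s)) r ^ 2 / r ^ 4 =
      ∫ s in Set.Ioi 0, Θ s ^ 2 / s ^ 4 := setIntegral_congr_fun measurableSet_Ioi fun r hr => by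
    simp only [H.cumul_charge hk hh hr]
  rw [← e4, e3, e2]
  simp only [pow_two (F _)]
  ring

theorem exists_optimal_profile {ω : ℝ} (hω : 0 < ω)
    (hpos : ∃ f g N, AdmPair ω f g N ∧ 0 < radPot f g) :
    ∃ (p : ℝ) (F Θ G Ξ : ℝ → ℝ), 0 < p ∧
      (∀ f g N, 0 < N → AdmPair ω f g N → radPot f g ≤ p * √N ^ 3) ∧
      IsPotential √ω (fun s => 2 / (3 * p) * (G s * F s)) F Θ ∧
      IsPotential √(4 * ω) (fun s => 2 / (3 * p) * (F s * F s)) G Ξ ∧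
      IsSource (fun s => 2 / (3 * p) * (G s * F s)) ∧
      IsSource (fun s => 2 / (3 * p) * (F s * F s)) ∧
      radPot F G = p ∧
      (∫ s in Set.Ioi 0, Θ s ^ 2 / s ^ 4) + (∫ s in Set.Ioi 0, Ξ s ^ 2 / s ^ 4) / 2 +
        ω * (∫ s in Set.Ioi 0, F s ^ 2 * s ^ 4) + 2 * ω * (∫ s in Set.Ioi 0, G s ^ 2 * s ^ 4) = 1 := by
  obtain ⟨f, g, hfg, hmax⟩ := exists_maximizer hω
  set p := radPot f g with hp
  have hle : ∀ f g N, 0 < N → AdmPair ω f g N → radPot f g ≤ p * √N ^ 3 :=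
    fun f g N hN h => h.radPot_le hmax hN
  have hp0 : 0 < p := by
    obtain ⟨f', g', N, h', h0⟩ := hpos
    have h1 := hle _ _ (max N 1) (by positivity) (h'.mono (le_max_left _ _))
    by_contra! hneg
    have : p * √(max N 1) ^ 3 ≤ 0 := mul_nonpos_of_nonpos_of_nonneg hneg (by positivity)
    linarith
  set κ := 2 / (3 * p) with hκ
  have hκ0 : 0 < κ := by positivity
  have hκp : κ * p = 2 / 3 := by rw [hκ]; field_simp
  have hfg' := hfg
  obtain ⟨a, b, m, n, hf, hg, hN⟩ := hfg
  obtain ⟨C, hC0, hC⟩ := hf.exists_le_decay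
  obtain ⟨D, hD0, hD⟩ := hg.exists_le_decay
  have hS1 : IsSource fun s => κ * (g s * f s) :=
    isSource_mul hκ0.le hf.nonneg hg.nonneg hf.anti hg.anti hC0 hD0 hC hD
  have hS2 : IsSource fun s => κ * (f s * f s) :=
    isSource_mul hκ0.le hf.nonneg hf.nonneg hf.anti hf.anti hC0 hC0 hC hC
  have hk1 : 0 < √ω := Real.sqrt_pos.2 hω
  have hk2 : 0 < √(4 * ω) := Real.sqrt_pos.2 (by linarith)
  have hk1s : √ω ^ 2 = ω := Real.sq_sqrt hω.le
  have hk2s : √(4 * ω) ^ 2 = 4 * ω := Real.sq_sqrt (by linarith)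
  obtain ⟨F, Θ, HF⟩ := hS1.exists_isPotential hk1
  obtain ⟨G, Ξ, HG⟩ := hS2.exists_isPotential hk2
  obtain ⟨C', hC0', hC'⟩ := HF.exists_abs_le_decay hk1 hS1
  obtain ⟨D', hD0', hD'⟩ := HG.exists_abs_le_decay hk2 hS2
  set N₁ := ∫ s in Set.Ioi 0, s ^ 4 * (κ * (g s * f s)) * F s with hN1
  set N₂ := ∫ s in Set.Ioi 0, s ^ 4 * (κ * (f s * f s)) * G s with hN2
  have e1 : ∫ s in Set.Ioi 0, s ^ 4 * (κ * (g s * f s)) * f s = κ * p := by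
    rw [hp, radPot, ← integral_const_mul]; congr 1; ext s; ring
  have e2 : ∫ s in Set.Ioi 0, s ^ 4 * (κ * (f s * f s)) * g s = κ * p := by
    rw [hp, radPot, ← integral_const_mul]; congr 1; ext s; ring
  have i1 := hS1.integrableOn_mul HF.measurable_F hC'
  have i2 := hS2.integrableOn_mul HG.measurable_F hD'
  have hÑ : N₁ + N₂ / 2 ≤ 1 := by
    refine le_one_of_forall_sq_le_cube fun t ht => ?_
    obtain ⟨a', m', h1, h1e⟩ := HF.admFn_add hk1 hS1 hf ht.le
    obtain ⟨b', n', h2, h2e⟩ := HG.admFn_add hk2 hS2 hg ht.le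
    rw [e1, hκp, hk1s] at h1e
    rw [e2, hκp, hk2s] at h2e
    set X := 1 + 2 * t + t ^ 2 * (N₁ + N₂ / 2) with hX
    have hNN : 0 ≤ N₁ + N₂ / 2 := by
      have : 0 ≤ N₁ := setIntegral_nonneg measurableSet_Ioi fun s hs =>
        mul_nonneg (mul_nonneg (by positivity) (hS1.nonneg s hs)) (HF.F_nonneg s hs)
      have : 0 ≤ N₂ := setIntegral_nonneg measurableSet_Ioi fun s hs =>
        mul_nonneg (mul_nonneg (by positivity) (hS2.nonneg s hs)) (HG.F_nonneg s hs)
      positivity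
    have hX0 : 0 < X := by positivity
    have hadm : AdmPair ω (fun s => f s + t * F s) (fun s => g s + t * G s) X :=
      ⟨a', b', m', n', h1, h2, by rw [hX]; linarith⟩
    have h3 := hle _ _ X hX0 hadm
    have h4 : p + 3 * p * (N₁ + N₂ / 2) * t ≤
        radPot (fun s => f s + t * F s) fun s => g s + t * G s := by
      have j0 := hfg'.integrableOn_radPot
      have j1 := i1.const_mul (3 * p * t)
      have j2 := i2.const_mul (3 * p * t / 2)
      have j01 : IntegrableOn (fun s => g s * f s ^ 2 * s ^ 4 +
        3 * p * t * (s ^ 4 * (κ * (g s * f s)) * F s)) (Set.Ioi 0) := j0.add j1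
      have j012 : IntegrableOn (fun s => g s * f s ^ 2 * s ^ 4 +
        3 * p * t * (s ^ 4 * (κ * (g s * f s)) * F s) +
          3 * p * t / 2 * (s ^ 4 * (κ * (f s * f s)) * G s)) (Set.Ioi 0) := j01.add j2
      calc p + 3 * p * (N₁ + N₂ / 2) * t = p + 3 * p * t * N₁ + 3 * p * t / 2 * N₂ := by ring
        _ = ∫ s in Set.Ioi 0, g s * f s ^ 2 * s ^ 4 +
              3 * p * t * (s ^ 4 * (κ * (g s * f s)) * F s) +
              3 * p * t / 2 * (s ^ 4 * (κ * (f s * f s)) * G s) := by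
            rw [hN1, hN2, ← integral_const_mul, ← integral_const_mul, integral_add j01 j2,
              integral_add j0 j1, ← radPot]
        _ ≤ _ := by
            refine setIntegral_mono_on j012 hadm.integrableOn_radPot measurableSet_Ioi fun s hs => ?_
            have hs' : (0 : ℝ) < s := hs
            have hf0 := hf.nonneg s hs
            have hg0 := hg.nonneg s hs
            have hF0 := HF.F_nonneg s hs
            have hG0 := HG.F_nonneg s hs
            have ek : 3 * p * κ = 2 := by linarith
            have hnn : 0 ≤ g s * (t * F s) ^ 2 + 2 * (t * G s) * f s * (t * F s) +
              t * G s * (t * F s) ^ 2 := by positivity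
            calc _ = (g s * f s ^ 2 + (3 * p * κ) * t * (g s * f s) * F s +
                    (3 * p * κ) / 2 * t * f s ^ 2 * G s) * s ^ 4 := by ring
              _ = (g s * f s ^ 2 + 2 * t * (g s * f s) * F s + t * f s ^ 2 * G s) * s ^ 4 := by
                rw [ek]; ring
              _ ≤ _ := by
                gcongr
                nlinarith
    have h5 : 1 + 3 * (N₁ + N₂ / 2) * t ≤ √X ^ 3 := by
      refine le_of_mul_le_mul_left ?_ hp0
      linarith
    calc _ ≤ (√X ^ 3) ^ 2 := by gcongr
      _ = (√X ^ 2) ^ 3 := by ring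
      _ = X ^ 3 := by rw [Real.sq_sqrt hX0.le]
  have q1 := HF.sq_sub_le hk1 hS1 hf
  have q2 := HG.sq_sub_le hk2 hS2 hg
  rw [e1, hκp, hk1s] at q1
  rw [e2, hκp, hk2s] at q2
  have n1 : 0 ≤ ∫ s in Set.Ioi 0, (f s + -1 * F s) ^ 2 * s ^ 4 :=
    integral_nonneg fun s => by positivity
  have n2 : 0 ≤ ∫ s in Set.Ioi 0, (g s + -1 * G s) ^ 2 * s ^ 4 :=
    integral_nonneg fun s => by positivity
  have m1 := mul_nonneg hω.le n1
  have m2 := mul_nonneg hω.le n2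
  have hfF := HF.ae_eq_of_integral_sq hk1 hS1 hf (by
    refine le_of_mul_le_mul_left ?_ hω
    linarith)
  have hgG := HG.ae_eq_of_integral_sq hk2 hS2 hg (by
    refine le_of_mul_le_mul_left ?_ hω
    linarith)
  have HF' : IsPotential √ω (fun s => κ * (G s * F s)) F Θ := HF.congr_source (by
    filter_upwards [hfF, hgG] with s h1 h2; rw [h1, h2])
  have HG' : IsPotential √(4 * ω) (fun s => κ * (F s * F s)) G Ξ := HG.congr_source (by
    filter_upwards [hfF] with s h1; rw [h1])
  have hS1' : IsSource fun s => κ * (G s * F s) :=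
    isSource_mul hκ0.le HF.F_nonneg HG.F_nonneg HF.antitoneOn HG.antitoneOn hC0' hD0' hC' hD'
  have hS2' : IsSource fun s => κ * (F s * F s) :=
    isSource_mul hκ0.le HF.F_nonneg HF.F_nonneg HF.antitoneOn HF.antitoneOn hC0' hC0' hC' hC'
  have hP : radPot F G = p := by
    rw [hp]
    refine integral_congr_ae ?_
    filter_upwards [hfF, hgG] with s h1 h2; rw [h1, h2]
  refine ⟨p, F, Θ, G, Ξ, hp0, hle, HF', HG', hS1', hS2', hP, ?_⟩
  have E1 := HF'.integral_flux_sq hk1 hS1'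
  have E2 := HG'.integral_flux_sq hk2 hS2'
  have r1 : ∫ s in Set.Ioi 0, s ^ 4 * (κ * (G s * F s)) * F s = κ * p := by
    rw [← hP, radPot, ← integral_const_mul]; congr 1; ext s; ring
  have r2 : ∫ s in Set.Ioi 0, s ^ 4 * (κ * (F s * F s)) * G s = κ * p := by
    rw [← hP, radPot, ← integral_const_mul]; congr 1; ext s; ring
  rw [r1, hκp, hk1s] at E1
  rw [r2, hκp, hk2s] at E2
  linarith

theorem hasDerivAt_of_sub_eq_integral {J w : ℝ → ℝ} (hw : ContinuousOn w (Set.Ioi 0))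
    (hJ : ∀ a b, 0 < a → a ≤ b → J b - J a = ∫ s in a..b, w s) {r : ℝ} (hr : 0 < r) :
    HasDerivAt J (w r) r := by
  have hr2 : 0 < r / 2 := by linarith
  have hsub : Set.uIcc (r / 2) r ⊆ Set.Ioi 0 := by
    rw [Set.uIcc_of_le (by linarith)]; exact fun x hx => hr2.trans_le hx.1
  have h1 := intervalIntegral.integral_hasDerivAt_right (hw.mono hsub).intervalIntegrable
    (hw.stronglyMeasurableAtFilter isOpen_Ioi r hr) (hw.continuousAt (Ioi_mem_nhds hr))
  refine (h1.const_add (J (r / 2))).congr_of_eventuallyEq ?_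
  filter_upwards [Ioi_mem_nhds (show r / 2 < r by linarith)] with x hx
  have := hJ (r / 2) x hr2 (le_of_lt hx)
  linarith

theorem tendsto_cumul_div_pow_five {w : ℝ → ℝ} {L : ℝ}
    (hi : ∀ r, IntegrableOn (fun s => s ^ 4 * w s) (Set.Ioc 0 r))
    (hw : Tendsto w (𝓝[>] 0) (𝓝 L)) :
    Tendsto (fun r => cumul (fun s => s ^ 4 * w s) r / r ^ 5) (𝓝[>] 0) (𝓝 (L / 5)) := by
  rw [Metric.tendsto_nhds]
  intro ε hε
  have h1 := (Metric.tendsto_nhds.1 hw) ε hε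
  rw [eventually_nhdsWithin_iff, Metric.eventually_nhds_iff] at h1
  obtain ⟨δ, hδ, h1⟩ := h1
  filter_upwards [Ioo_mem_nhdsGT hδ] with r hr
  have hr0 : 0 < r := hr.1
  have hc : ∫ s in Set.Ioc 0 r, s ^ 4 = r ^ 5 / 5 := by
    rw [← intervalIntegral.integral_of_le hr0.le, integral_pow]; norm_num
  have hci : IntegrableOn (fun s : ℝ => s ^ 4) (Set.Ioc 0 r) := (continuous_pow 4).integrableOn_Ioc
  have e : cumul (fun s => s ^ 4 * w s) r - L * (r ^ 5 / 5) =
      ∫ s in Set.Ioc 0 r, s ^ 4 * (w s - L) := by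
    rw [← hc, cumul, ← integral_const_mul, ← integral_sub (hi r) (hci.const_mul L)]
    congr 1; ext s; ring
  have hb : ‖∫ s in Set.Ioc 0 r, s ^ 4 * (w s - L)‖ ≤ ∫ s in Set.Ioc 0 r, ε * s ^ 4 := by
    refine norm_integral_le_of_norm_le (hci.const_mul ε) ?_
    filter_upwards [self_mem_ae_restrict measurableSet_Ioc] with s hs
    have hs0 : 0 < s := hs.1
    have h2 := h1 (y := s) (by rw [Real.dist_eq, sub_zero, abs_of_pos hs0]; exact hs.2.trans_lt hr.2) hs0
    rw [norm_mul, norm_pow, Real.norm_of_nonneg hs0.le, mul_comm]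
    gcongr
    exact h2.le
  rw [integral_const_mul, hc, ← e, Real.norm_eq_abs] at hb
  have hr5 : 0 < r ^ 5 := by positivity
  rw [Real.dist_eq, show cumul (fun s => s ^ 4 * w s) r / r ^ 5 - L / 5 =
    (cumul (fun s => s ^ 4 * w s) r - L * (r ^ 5 / 5)) / r ^ 5 by field_simp, abs_div,
    abs_of_pos hr5, div_lt_iff₀ hr5]
  nlinarith

namespace IsPotential

variable {k : ℝ} {h F Θ : ℝ → ℝ}

theorem flux_le_rpow (H : IsPotential k h F Θ) (hh : IsSource h) {A β : ℝ} (hβ : 0 < β)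
    (hA : ∀ s, 0 < s → s ≤ 1 → h s ≤ A * s ^ (β - 5)) {r : ℝ} (hr : 0 < r) (hr1 : r ≤ 1) :
    Θ r ≤ A / β * r ^ β := by
  refine (H.flux_le_cumul hh.nonneg hh.integrableOn_Ioc hr).trans
    (cumul_le_rpow hβ hr.le (hh.integrableOn_Ioc r) fun s hs hsr => ?_)
  have h1 := hA s hs (hsr.trans hr1)
  calc s ^ 4 * h s ≤ s ^ 4 * (A * s ^ (β - 5)) := by gcongr
    _ = A * (s ^ (4 : ℝ) * s ^ (β - 5)) := by rw [pow_four_eq_rpow]; ring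
    _ = A * s ^ (β - 1) := by rw [← Real.rpow_add hs]; congr 2; ring

theorem le_rpow (H : IsPotential k h F Θ) (hh : IsSource h) {A β δ : ℝ} (hA0 : 0 ≤ A) (hβ : 0 < β)
    (hβ3 : β ≠ 3) (hδ : δ ≤ 0) (hδβ : δ ≤ β - 3)
    (hA : ∀ s, 0 < s → s ≤ 1 → h s ≤ A * s ^ (β - 5)) :
    ∃ B, 0 ≤ B ∧ ∀ s, 0 < s → s ≤ 1 → F s ≤ B * s ^ δ := by
  have hF1 := H.F_nonneg 1 one_pos
  refine ⟨F 1 + A / β * |β - 3|⁻¹, by positivity, fun r hr hr1 => ?_⟩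
  have h1 := H.le_of_flux_le hβ3 (fun s hs hs1 => H.flux_le_rpow hh hβ hA hs hs1) hr hr1
  have hone : 1 ≤ r ^ δ := Real.one_le_rpow_of_pos_of_le_one_of_nonpos hr hr1 hδ
  have h2 : (1 - r ^ (β - 3)) / (β - 3) ≤ |β - 3|⁻¹ * r ^ δ := by
    have hp := Real.rpow_pos_of_pos hr (β - 3)
    rcases lt_or_gt_of_ne hβ3 with hlt | hgt
    · have h3 : r ^ (β - 3) ≤ r ^ δ := Real.rpow_le_rpow_of_exponent_ge hr hr1 hδβ
      have h4 : 0 < 3 - β := by linarith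
      have e : (1 - r ^ (β - 3)) / (β - 3) = (r ^ (β - 3) - 1) / (3 - β) := by
        rw [div_eq_div_iff (by linarith) h4.ne']; ring
      rw [abs_of_neg (by linarith), neg_sub, ← div_eq_inv_mul, e]
      gcongr
      linarith
    · have h4 : 0 < β - 3 := by linarith
      rw [abs_of_pos h4, ← div_eq_inv_mul]
      gcongr
      linarith
  calc F r ≤ F 1 + A / β * ((1 - r ^ (β - 3)) / (β - 3)) := h1
    _ ≤ F 1 * r ^ δ + A / β * (|β - 3|⁻¹ * r ^ δ) := by
      gcongr
      nlinarith
    _ = _ := by ring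

theorem exists_tendsto (H : IsPotential k h F Θ) {B : ℝ} (hB : ∀ s, 0 < s → s ≤ 1 → F s ≤ B) :
    ∃ L, Tendsto F (𝓝[>] 0) (𝓝 L) := by
  have hbd : BddAbove (F '' Set.Ioi 0) := by
    refine ⟨B, ?_⟩
    rintro _ ⟨s, hs, rfl⟩
    rcases le_total s 1 with h1 | h1
    · exact hB s hs h1
    · exact (H.antitoneOn (Set.mem_Ioi.2 one_pos) hs h1).trans (hB 1 one_pos le_rfl)
  refine ⟨sSup (F '' Set.Ioi 0), tendsto_order.2 ⟨fun y hy => ?_, fun y hy => ?_⟩⟩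
  · obtain ⟨_, ⟨s, hs, rfl⟩, hys⟩ := exists_lt_of_lt_csSup
      (⟨F 1, 1, Set.mem_Ioi.2 one_pos, rfl⟩ : (F '' Set.Ioi 0).Nonempty) hy
    filter_upwards [Ioo_mem_nhdsGT hs] with t ht
    exact hys.trans_le (H.antitoneOn ht.1 hs ht.2.le)
  · filter_upwards [self_mem_nhdsWithin] with t ht
    exact (le_csSup hbd ⟨t, ht, rfl⟩).trans_lt hy

theorem hasDerivAt_F (H : IsPotential k h F Θ) {r : ℝ} (hr : 0 < r) :
    HasDerivAt F (-(Θ r / r ^ 4)) r := by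
  have hc : ContinuousOn (fun s => Θ s / s ^ 4) (Set.Ioi 0) :=
    H.contΘ.div (continuousOn_pow 4) fun x hx => pow_ne_zero 4 (ne_of_gt hx)
  have := (hasDerivAt_of_sub_eq_integral (J := fun s => -F s) hc (fun a b ha hab => by
    rw [← H.F_sub a b ha hab]; ring) hr).neg
  exact this.congr_of_eventuallyEq (Eventually.of_forall fun s => by simp)

theorem hasDerivAt_Θ (H : IsPotential k h F Θ) (hc : ContinuousOn h (Set.Ioi 0)) {r : ℝ}
    (hr : 0 < r) : HasDerivAt Θ (r ^ 4 * (h r - k ^ 2 * F r)) r :=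
  hasDerivAt_of_sub_eq_integral ((continuousOn_pow 4).mul (hc.sub (continuousOn_const.mul H.contF)))
    H.Θ_sub hr

theorem abs_sub_limit_le (H : IsPotential k h F Θ) {A L : ℝ}
    (hΘ : ∀ s, 0 < s → s ≤ 1 → Θ s ≤ A * s ^ 5) (hL : Tendsto F (𝓝[>] 0) (𝓝 L)) {r : ℝ}
    (hr : 0 < r) (hr1 : r ≤ 1) : |F r - L| ≤ A * r ^ 2 := by
  have hA : 0 ≤ A := by simpa using (H.Θ_nonneg 1 one_pos).trans (hΘ 1 one_pos le_rfl)
  have key : ∀ a, 0 < a → a ≤ r → |F r - F a| ≤ A * r ^ 2 := fun a ha har => by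
    have h1 := H.F_sub a r ha har
    have h2 : F r ≤ F a := H.antitoneOn ha (show r ∈ Set.Ioi 0 from hr) har
    rw [abs_sub_comm, abs_of_nonneg (by linarith), h1]
    have h3 : ∀ s ∈ Set.uIoc a r, ‖Θ s / s ^ 4‖ ≤ A * r := fun s hs => by
      rw [Set.uIoc_of_le har] at hs
      have hs0 : 0 < s := ha.trans hs.1
      rw [Real.norm_of_nonneg (div_nonneg (H.Θ_nonneg s hs0) (by positivity)),
        div_le_iff₀ (by positivity)]
      calc Θ s ≤ A * s ^ 5 := hΘ s hs0 (hs.2.trans hr1)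
        _ = A * s * s ^ 4 := by ring
        _ ≤ A * r * s ^ 4 := by gcongr; exact hs.2
    calc _ ≤ ‖∫ s in a..r, Θ s / s ^ 4‖ := le_abs_self _
      _ ≤ A * r * |r - a| := intervalIntegral.norm_integral_le_of_norm_le_const h3
      _ ≤ A * r * r := by
        gcongr
        rw [abs_of_nonneg (by linarith)]; linarith
      _ = _ := by ring
  refine le_of_tendsto ((tendsto_const_nhds.sub hL).abs) ?_
  filter_upwards [Ioo_mem_nhdsGT hr] with a ha using key a ha.1 ha.2.le

end IsPotential

theorem mul_le_rpow {f g : ℝ → ℝ} {c A B δ ε : ℝ} (hc : 0 ≤ c) (hA : 0 ≤ A)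
    (hf0 : ∀ s, 0 < s → 0 ≤ f s)
    (hf : ∀ s, 0 < s → s ≤ 1 → f s ≤ A * s ^ δ) (hg : ∀ s, 0 < s → s ≤ 1 → g s ≤ B * s ^ δ)
    (hB : 0 ≤ B) (hε : ε ≤ δ + δ) :
    ∀ s, 0 < s → s ≤ 1 → c * (g s * f s) ≤ c * (B * A) * s ^ ε := fun s hs hs1 => by
  have h1 : s ^ (δ + δ) ≤ s ^ ε := Real.rpow_le_rpow_of_exponent_ge hs hs1 hε
  calc c * (g s * f s) ≤ c * ((B * s ^ δ) * (A * s ^ δ)) := by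
        gcongr
        · exact hf0 s hs
        · exact hg s hs hs1
        · exact hf s hs hs1
    _ = c * (B * A) * s ^ (δ + δ) := by rw [Real.rpow_add hs]; ring
    _ ≤ _ := by gcongr

theorem bounded_of_system {k₁ k₂ c : ℝ} {F Θ G Ξ : ℝ → ℝ} (hk₁ : 0 < k₁) (hk₂ : 0 < k₂) (hc : 0 ≤ c)
    (HF : IsPotential k₁ (fun s => c * (G s * F s)) F Θ)
    (HG : IsPotential k₂ (fun s => c * (F s * F s)) G Ξ)
    (h₁ : IsSource fun s => c * (G s * F s)) (h₂ : IsSource fun s => c * (F s * F s)) :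
    ∃ A B, 0 ≤ A ∧ 0 ≤ B ∧ (∀ s, 0 < s → s ≤ 1 → F s ≤ A) ∧ ∀ s, 0 < s → s ≤ 1 → G s ≤ B := by
  obtain ⟨C₁, hC₁, hC₁'⟩ := h₁.le
  obtain ⟨C₂, hC₂, hC₂'⟩ := h₂.le
  obtain ⟨A, hA, -, -, hA', -⟩ := HF.bounds hk₁ hC₁ h₁.measurable h₁.nonneg hC₁'
  obtain ⟨B, hB, -, -, hB', -⟩ := HG.bounds hk₂ hC₂ h₂.measurable h₂.nonneg hC₂'
  obtain ⟨A₁, hA₁, hA₁'⟩ := HF.le_rpow (β := 5 / 2) (δ := -(1 / 2)) h₁ (by positivity) (by norm_num)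
    (by norm_num) (by norm_num) (by norm_num) (mul_le_rpow hc hA HF.F_nonneg hA' hB' hB (by norm_num))
  obtain ⟨B₁, hB₁, hB₁'⟩ := HG.le_rpow (β := 5 / 2) (δ := -(1 / 2)) h₂ (by positivity) (by norm_num)
    (by norm_num) (by norm_num) (by norm_num) (mul_le_rpow hc hA HF.F_nonneg hA' hA' hA (by norm_num))
  obtain ⟨A₂, hA₂, hA₂'⟩ := HF.le_rpow (β := 4) (δ := 0) h₁ (by positivity) (by norm_num)
    (by norm_num) (by norm_num) (by norm_num)
    (mul_le_rpow hc hA₁ HF.F_nonneg hA₁' hB₁' hB₁ (by norm_num))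
  obtain ⟨B₂, hB₂, hB₂'⟩ := HG.le_rpow (β := 4) (δ := 0) h₂ (by positivity) (by norm_num)
    (by norm_num) (by norm_num) (by norm_num)
    (mul_le_rpow hc hA₁ HF.F_nonneg hA₁' hA₁' hA₁ (by norm_num))
  exact ⟨A₂, B₂, hA₂, hB₂, by simpa using hA₂', by simpa using hB₂'⟩

/-- `φ`, `g` and `ℓ` are the value, the divided derivative and the Laplacian of a radial function on
five-dimensional space. -/
structure IsRadialJet (φ g ℓ : ℝ → ℝ) : Prop where
  deriv_value : ∀ r, 0 < r → HasDerivAt φ (g r * r) r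
  deriv_slope : ∀ r, 0 < r → HasDerivAt g ((ℓ r - 5 * g r) / r) r
  value_zero : ∃ C, ∀ r, 0 < r → r ≤ 1 → |φ r - φ 0| ≤ C * r ^ 2
  slope_zero : Tendsto g (𝓝[>] 0) (𝓝 (g 0))
  lap_zero : ℓ 0 = 5 * g 0

theorem hasFDerivAt_norm_inner {x : E5} (hx : x ≠ 0) :
    HasFDerivAt (fun y : E5 => ‖y‖) (‖x‖⁻¹ • innerSL ℝ x) x := by
  have hn : ‖x‖ ≠ 0 := norm_ne_zero_iff.2 hx
  have h := ((hasStrictFDerivAt_norm_sq x).hasFDerivAt).sqrt (pow_ne_zero 2 hn)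
  simp only [Real.sqrt_sq (norm_nonneg _)] at h
  refine h.congr_fderiv ?_
  ext y
  simp
  field_simp

namespace IsRadialJet

variable {φ g ℓ : ℝ → ℝ}

theorem hasFDerivAt_real (H : IsRadialJet φ g ℓ) (x : E5) :
    HasFDerivAt (fun y : E5 => φ ‖y‖) (g ‖x‖ • innerSL ℝ x) x := by
  by_cases hx : x = 0
  · subst hx
    obtain ⟨C, hC⟩ := H.value_zero
    rw [hasFDerivAt_iff_isLittleO_nhds_zero]
    have h1 : (fun h : E5 => φ ‖0 + h‖ - φ ‖(0 : E5)‖ - (g ‖(0 : E5)‖ • innerSL ℝ (0 : E5)) h)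
        =O[𝓝 0] fun h : E5 => ‖h‖ ^ 2 := by
      refine Asymptotics.IsBigO.of_bound |C| ?_
      filter_upwards [Metric.ball_mem_nhds (0 : E5) one_pos] with h hh
      rw [mem_ball_zero_iff] at hh
      rcases eq_or_ne h 0 with rfl | h0
      · simp
      · have h2 := hC ‖h‖ (norm_pos_iff.2 h0) hh.le
        simp only [zero_add, norm_zero, map_zero, smul_zero, zero_apply, sub_zero,
          Real.norm_eq_abs, norm_pow, abs_norm]
        exact h2.trans (by gcongr; exact le_abs_self C)
    exact h1.trans_isLittleO (Asymptotics.isLittleO_norm_pow_id one_lt_two)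
  · have hn : ‖x‖ ≠ 0 := norm_ne_zero_iff.2 hx
    have h := (H.deriv_value ‖x‖ (norm_pos_iff.2 hx)).comp_hasFDerivAt x (hasFDerivAt_norm_inner hx)
    refine h.congr_fderiv ?_
    rw [smul_smul, mul_assoc, mul_inv_cancel₀ hn, mul_one]

theorem hasFDerivAt (H : IsRadialJet φ g ℓ) (x : E5) :
    HasFDerivAt (fun y : E5 => (φ ‖y‖ : ℂ)) (Complex.ofRealCLM.comp (g ‖x‖ • innerSL ℝ x)) x :=
  Complex.ofRealCLM.hasFDerivAt.comp x (H.hasFDerivAt_real x)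

theorem norm_fderiv (H : IsRadialJet φ g ℓ) (x : E5) :
    ‖fderiv ℝ (fun y : E5 => (φ ‖y‖ : ℂ)) x‖ = |g ‖x‖| * ‖x‖ := by
  rw [(H.hasFDerivAt x).fderiv]
  have := Complex.ofRealLI.norm_toContinuousLinearMap_comp (g := g ‖x‖ • innerSL ℝ x)
  rw [show Complex.ofRealCLM = Complex.ofRealLI.toContinuousLinearMap from rfl, this, norm_smul,
    innerSL_apply_norm, Real.norm_eq_abs]

theorem hasFDerivAt_slope (H : IsRadialJet φ g ℓ) {x : E5} (hx : x ≠ 0) (i : Fin 5) :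
    HasFDerivAt (fun y : E5 => g ‖y‖ * y i)
      (g ‖x‖ • (EuclideanSpace.proj i : E5 →L[ℝ] ℝ) +
        x i • (((ℓ ‖x‖ - 5 * g ‖x‖) / ‖x‖) • (‖x‖⁻¹ • innerSL ℝ x))) x := by
  have h := (H.deriv_slope ‖x‖ (norm_pos_iff.2 hx)).comp_hasFDerivAt x (hasFDerivAt_norm_inner hx)
  exact h.mul (EuclideanSpace.proj i : E5 →L[ℝ] ℝ).hasFDerivAt

theorem tendsto_slope (H : IsRadialJet φ g ℓ) :
    Tendsto (fun y : E5 => g ‖y‖) (𝓝 0) (𝓝 (g 0)) := by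
  have h1 : Tendsto g (𝓝[≥] 0) (𝓝 (g 0)) := by
    rw [← Set.Ioi_insert, nhdsWithin_insert]
    exact tendsto_sup.2 ⟨tendsto_pure_nhds g 0, H.slope_zero⟩
  refine h1.comp (tendsto_nhdsWithin_iff.2 ⟨?_, Eventually.of_forall fun y => norm_nonneg y⟩)
  simpa using (continuous_norm (E := E5)).tendsto 0

theorem hasFDerivAt_slope_zero (H : IsRadialJet φ g ℓ) (i : Fin 5) :
    HasFDerivAt (fun y : E5 => g ‖y‖ * y i) (g 0 • (EuclideanSpace.proj i : E5 →L[ℝ] ℝ)) 0 := by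
  rw [hasFDerivAt_iff_isLittleO_nhds_zero]
  have h1 : (fun y : E5 => g ‖y‖ - g 0) =o[𝓝 0] fun _ => (1 : ℝ) := by
    rw [Asymptotics.isLittleO_one_iff]
    simpa using H.tendsto_slope.sub_const (g 0)
  have h2 : (fun y : E5 => (EuclideanSpace.proj i : E5 →L[ℝ] ℝ) y) =O[𝓝 0] fun y => y :=
    (EuclideanSpace.proj i : E5 →L[ℝ] ℝ).isBigO_id _
  have h3 := (h1.mul_isBigO h2.norm_right)
  refine Asymptotics.IsLittleO.of_norm_right (h3.congr (fun y => ?_) fun y => by rw [one_mul])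
  simp
  ring

theorem lap_eq (H : IsRadialJet φ g ℓ) (x : E5) :
    lap (fun y : E5 => (φ ‖y‖ : ℂ)) x = (ℓ ‖x‖ : ℂ) := by
  have h0 : ∀ i : Fin 5, (fun y : E5 => fderiv ℝ (fun y : E5 => (φ ‖y‖ : ℂ)) y
      (EuclideanSpace.single i (1 : ℝ))) = fun y => ((g ‖y‖ * y i : ℝ) : ℂ) := fun i => by
    ext y
    rw [(H.hasFDerivAt y).fderiv]
    simp [EuclideanSpace.inner_single_right]
  simp only [lap, h0]
  by_cases hx : x = 0
  · subst hx
    have h1 : ∀ i : Fin 5, HasFDerivAt (fun y : E5 => ((g ‖y‖ * y i : ℝ) : ℂ)) _ 0 := fun i =>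
      Complex.ofRealCLM.hasFDerivAt.comp 0 (H.hasFDerivAt_slope_zero i)
    simp only [(h1 _).fderiv]
    simp [H.lap_zero]
  · have h1 : ∀ i : Fin 5, HasFDerivAt (fun y : E5 => ((g ‖y‖ * y i : ℝ) : ℂ)) _ x := fun i =>
      Complex.ofRealCLM.hasFDerivAt.comp x (H.hasFDerivAt_slope hx i)
    have hn : ‖x‖ ≠ 0 := norm_ne_zero_iff.2 hx
    simp only [(h1 _).fderiv]
    have h2 : ∀ i : Fin 5, (Complex.ofRealCLM.comp (g ‖x‖ • (EuclideanSpace.proj i : E5 →L[ℝ] ℝ) +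
        x i • (((ℓ ‖x‖ - 5 * g ‖x‖) / ‖x‖) • (‖x‖⁻¹ • innerSL ℝ x)))
        (EuclideanSpace.single i (1 : ℝ))) =
        ((g ‖x‖ + (ℓ ‖x‖ - 5 * g ‖x‖) / ‖x‖ ^ 2 * x i ^ 2 : ℝ) : ℂ) := fun i => by
      simp only [ContinuousLinearMap.comp_apply, Complex.ofRealCLM_apply, Complex.ofReal_inj,
        add_apply, smul_apply, innerSL_apply_apply, smul_eq_mul,
        EuclideanSpace.inner_single_right]
      simp
      field_simp
    simp only [h2]
    rw [← Complex.ofReal_sum, Finset.sum_add_distrib, ← Finset.mul_sum,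
      ← EuclideanSpace.real_norm_sq_eq]
    congr 1
    simp
    field_simp
    ring

end IsRadialJet

theorem integrable_fun_norm_iff {f : ℝ → ℝ} :
    Integrable (fun x : E5 => f ‖x‖) ↔ IntegrableOn (fun s => f s * s ^ 4) (Set.Ioi 0) := by
  have h := integrable_fun_norm_addHaar (volume : Measure E5) (f := f)
  rw [h]
  simp only [finrank_euclideanSpace, Fintype.card_fin, smul_eq_mul, Nat.add_one_sub_one, mul_comm]

theorem integral_fun_norm_eq (f : ℝ → ℝ) :
    ∫ x : E5, f ‖x‖ = 5 * unitVol * ∫ s in Set.Ioi 0, f s * s ^ 4 := by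
  have h := integral_fun_norm_addHaar (volume : Measure E5) f
  rw [h]
  simp only [finrank_euclideanSpace, Fintype.card_fin, smul_eq_mul, nsmul_eq_mul,
    Nat.reduceSub, mul_comm, unitVol]
  push_cast
  ring

theorem hasDerivAt_update_zero {f : ℝ → ℝ} {f' r : ℝ} (a : ℝ) (hr : 0 < r) (h : HasDerivAt f f' r) :
    HasDerivAt (Function.update f 0 a) f' r := by
  refine h.congr_of_eventuallyEq ?_
  filter_upwards [Ioi_mem_nhds hr] with s hs
  exact Function.update_of_ne (ne_of_gt hs) _ _

namespace IsRadialJet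

variable {φ g ℓ : ℝ → ℝ}

theorem const_mul (H : IsRadialJet φ g ℓ) (c : ℝ) :
    IsRadialJet (fun r => c * φ r) (fun r => c * g r) (fun r => c * ℓ r) where
  deriv_value r hr := by
    simpa only [mul_assoc] using (H.deriv_value r hr).const_mul c
  deriv_slope r hr := by
    refine ((H.deriv_slope r hr).const_mul c).congr_deriv ?_
    ring
  value_zero := by
    obtain ⟨C, hC⟩ := H.value_zero
    refine ⟨|c| * C, fun r hr hr1 => ?_⟩
    rw [← mul_sub, abs_mul, mul_assoc]
    gcongr
    exact hC r hr hr1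
  slope_zero := H.slope_zero.const_mul c
  lap_zero := by rw [H.lap_zero]; ring

theorem integral_norm_sq (φ : ℝ → ℝ) :
    ∫ x : E5, ‖(φ ‖x‖ : ℂ)‖ ^ 2 = 5 * unitVol * ∫ s in Set.Ioi 0, φ s ^ 2 * s ^ 4 := by
  simp only [Complex.norm_real, Real.norm_eq_abs, sq_abs]
  exact integral_fun_norm_eq fun s => φ s ^ 2

theorem integral_norm_fderiv_sq (H : IsRadialJet φ g ℓ) :
    ∫ x : E5, ‖fderiv ℝ (fun y : E5 => (φ ‖y‖ : ℂ)) x‖ ^ 2 =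
      5 * unitVol * ∫ s in Set.Ioi 0, (g s * s) ^ 2 * s ^ 4 := by
  simp only [H.norm_fderiv, mul_pow, sq_abs]
  exact integral_fun_norm_eq fun s => g s ^ 2 * s ^ 2

theorem inH1 (H : IsRadialJet φ g ℓ) (h1 : IntegrableOn (fun s => φ s ^ 2 * s ^ 4) (Set.Ioi 0))
    (h2 : IntegrableOn (fun s => (g s * s) ^ 2 * s ^ 4) (Set.Ioi 0)) :
    InH1 fun x : E5 => (φ ‖x‖ : ℂ) := by
  have hd : Differentiable ℝ fun x : E5 => (φ ‖x‖ : ℂ) := fun x => (H.hasFDerivAt x).differentiableAt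
  refine ⟨?_, hd, ?_⟩
  · rw [memLp_two_iff_integrable_sq_norm hd.continuous.aestronglyMeasurable]
    simp only [Complex.norm_real, Real.norm_eq_abs, sq_abs]
    exact integrable_fun_norm_iff.2 h1
  · rw [memLp_two_iff_integrable_sq_norm (measurable_fderiv ℝ _).aestronglyMeasurable]
    simp only [H.norm_fderiv, mul_pow, sq_abs]
    simp only [mul_pow] at h2
    exact integrable_fun_norm_iff.2 h2

end IsRadialJet

theorem IsPotential.isRadialJet {k : ℝ} {h F Θ : ℝ → ℝ} (H : IsPotential k h F Θ) (hk : 0 < k)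
    (hh : IsSource h) (hc : ContinuousOn h (Set.Ioi 0)) {A h₀ F₀ : ℝ}
    (hA : ∀ s, 0 < s → s ≤ 1 → h s ≤ A) (hF₀ : Tendsto F (𝓝[>] 0) (𝓝 F₀))
    (hh₀ : Tendsto h (𝓝[>] 0) (𝓝 h₀)) :
    IsRadialJet (Function.update F 0 F₀)
      (Function.update (fun r => -(Θ r / r ^ 5)) 0 (-((h₀ - k ^ 2 * F₀) / 5)))
      (Function.update (fun r => -(h r - k ^ 2 * F r)) 0 (-(h₀ - k ^ 2 * F₀))) where
  deriv_value r hr := by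
    refine hasDerivAt_update_zero _ hr ?_
    rw [Function.update_of_ne hr.ne']
    convert H.hasDerivAt_F hr using 1
    field_simp
  deriv_slope r hr := by
    refine hasDerivAt_update_zero _ hr ?_
    rw [Function.update_of_ne hr.ne', Function.update_of_ne hr.ne']
    refine ((H.hasDerivAt_Θ hc hr).div (hasDerivAt_pow 5 r)
      (pow_ne_zero 5 hr.ne')).neg.congr_deriv ?_
    field_simp
    push_cast
    ring
  value_zero := by
    refine ⟨A / 5, fun r hr hr1 => ?_⟩
    rw [Function.update_of_ne hr.ne', Function.update_self]
    refine H.abs_sub_limit_le (fun s hs hs1 => ?_) hF₀ hr hr1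
    have := H.flux_le_rpow hh (A := A) (β := 5) (by norm_num) (by simpa using hA) hs hs1
    exact_mod_cast this
  slope_zero := by
    rw [Function.update_self]
    have h1 := (tendsto_cumul_div_pow_five (H.integrableOn_charge_Ioc hk hh)
      (hh₀.sub (hF₀.const_mul (k ^ 2)))).neg
    refine h1.congr' ?_
    filter_upwards [self_mem_nhdsWithin] with r hr
    rw [Function.update_of_ne (ne_of_gt hr), H.cumul_charge hk hh hr]
  lap_zero := by
    rw [Function.update_self, Function.update_self]; ring

theorem setIntegral_Ioi_congr_pos {f g : ℝ → ℝ} (h : ∀ s, 0 < s → f s = g s) :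
    ∫ s in Set.Ioi 0, f s = ∫ s in Set.Ioi 0, g s :=
  setIntegral_congr_fun measurableSet_Ioi fun s hs => h s hs

/-- A pair of radial potentials solving the normalised system yields a nontrivial solution of the
elliptic system whose action is explicit. -/
theorem exists_ellSol_of_profile {ω p : ℝ} {F Θ G Ξ : ℝ → ℝ} (hω : 0 < ω) (hp : 0 < p)
    (HF : IsPotential √ω (fun s => 2 / (3 * p) * (G s * F s)) F Θ)
    (HG : IsPotential √(4 * ω) (fun s => 2 / (3 * p) * (F s * F s)) G Ξ)
    (h₁ : IsSource fun s => 2 / (3 * p) * (G s * F s))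
    (h₂ : IsSource fun s => 2 / (3 * p) * (F s * F s)) (hrad : radPot F G = p)
    (hnorm : (∫ s in Set.Ioi 0, Θ s ^ 2 / s ^ 4) + (∫ s in Set.Ioi 0, Ξ s ^ 2 / s ^ 4) / 2 +
      ω * (∫ s in Set.Ioi 0, F s ^ 2 * s ^ 4) + 2 * ω * (∫ s in Set.Ioi 0, G s ^ 2 * s ^ 4) = 1) :
    ∃ φ ψ : E5 → ℂ, IsEllSol ω φ ψ ∧ Nontriv2 φ ψ ∧
      Sfun ω φ ψ = 5 * unitVol / (54 * p ^ 2) := by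
  have hk₁ : 0 < √ω := Real.sqrt_pos.2 hω
  have hk₂ : 0 < √(4 * ω) := Real.sqrt_pos.2 (by positivity)
  have hc : 0 ≤ 2 / (3 * p) := by positivity
  obtain ⟨A, B, hA0, hB0, hA, hB⟩ := bounded_of_system hk₁ hk₂ hc HF HG h₁ h₂
  obtain ⟨F₀, hF₀⟩ := HF.exists_tendsto hA
  obtain ⟨G₀, hG₀⟩ := HG.exists_tendsto hB
  have J₁ := (HF.isRadialJet hk₁ h₁ (continuousOn_const.mul (HG.contF.mul HF.contF))
    (A := 2 / (3 * p) * (B * A)) (fun s hs hs1 => by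
      have := HF.F_nonneg s hs
      gcongr
      exacts [hB s hs hs1, hA s hs hs1]) hF₀ ((hG₀.mul hF₀).const_mul _)).const_mul (1 / (3 * p))
  have J₂ := (HG.isRadialJet hk₂ h₂ (continuousOn_const.mul (HF.contF.mul HF.contF))
    (A := 2 / (3 * p) * (A * A)) (fun s hs hs1 => by
      have := HF.F_nonneg s hs
      gcongr
      exacts [hA s hs hs1, hA s hs hs1]) hG₀ ((hF₀.mul hF₀).const_mul _)).const_mul (1 / (3 * p))
  have hup : ∀ (f : ℝ → ℝ) (a s : ℝ), 0 < s → Function.update f 0 a s = f s := fun f a s hs =>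
    Function.update_of_ne hs.ne' _ _
  have i₁ : IntegrableOn (fun s => (1 / (3 * p) * Function.update F 0 F₀ s) ^ 2 * s ^ 4) (Set.Ioi 0) :=
    IntegrableOn.congr_fun ((HF.integrableOn_sq hk₁ h₁).const_mul ((1 / (3 * p)) ^ 2))
      (fun s hs => by simp only [hup _ _ s hs]; ring) measurableSet_Ioi
  have i₂ : IntegrableOn (fun s => (1 / (3 * p) * Function.update G 0 G₀ s) ^ 2 * s ^ 4) (Set.Ioi 0) :=
    IntegrableOn.congr_fun ((HG.integrableOn_sq hk₂ h₂).const_mul ((1 / (3 * p)) ^ 2))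
      (fun s hs => by simp only [hup _ _ s hs]; ring) measurableSet_Ioi
  have slope : ∀ (T : ℝ → ℝ) (a s : ℝ), 0 < s →
      (1 / (3 * p) * Function.update (fun r => -(T r / r ^ 5)) 0 a s * s) ^ 2 * s ^ 4 =
        (1 / (3 * p)) ^ 2 * (T s ^ 2 / s ^ 4) := fun T a s hs => by
    rw [hup _ _ s hs]
    field_simp
  have H₁ := J₁.inH1 i₁ (IntegrableOn.congr_fun
    ((HF.integrableOn_flux_sq hk₁ h₁).const_mul ((1 / (3 * p)) ^ 2))
    (fun s hs => (slope Θ _ s hs).symm) measurableSet_Ioi)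
  have H₂ := J₂.inH1 i₂ (IntegrableOn.congr_fun
    ((HG.integrableOn_flux_sq hk₂ h₂).const_mul ((1 / (3 * p)) ^ 2))
    (fun s hs => (slope Ξ _ s hs).symm) measurableSet_Ioi)
  have hsq : ∀ (f : ℝ → ℝ) (a : ℝ),
      ∫ s in Set.Ioi 0, (1 / (3 * p) * Function.update f 0 a s) ^ 2 * s ^ 4 =
        ∫ s in Set.Ioi 0, (1 / (3 * p)) ^ 2 * (f s ^ 2 * s ^ 4) := fun f a =>
    setIntegral_Ioi_congr_pos fun s hs => by rw [hup _ _ s hs]; ring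
  have hPot : Pot (fun x : E5 => ((1 / (3 * p) * Function.update F 0 F₀ ‖x‖ : ℝ) : ℂ))
      (fun x : E5 => ((1 / (3 * p) * Function.update G 0 G₀ ‖x‖ : ℝ) : ℂ)) =
      5 * unitVol * ((1 / (3 * p)) ^ 3 * p) := by
    have e : ∀ x : E5, ((starRingEnd ℂ) ((1 / (3 * p) * Function.update G 0 G₀ ‖x‖ : ℝ) : ℂ) *
        ((1 / (3 * p) * Function.update F 0 F₀ ‖x‖ : ℝ) : ℂ) ^ 2).re =
        (1 / (3 * p) * Function.update G 0 G₀ ‖x‖) * (1 / (3 * p) * Function.update F 0 F₀ ‖x‖) ^ 2 :=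
      fun x => by rw [Complex.conj_ofReal]; norm_cast
    simp only [Pot, e]
    rw [integral_fun_norm_eq fun s => (1 / (3 * p) * Function.update G 0 G₀ s) *
      (1 / (3 * p) * Function.update F 0 F₀ s) ^ 2, setIntegral_Ioi_congr_pos (g := fun s =>
      (1 / (3 * p)) ^ 3 * (G s * F s ^ 2 * s ^ 4)) fun s hs => by
        simp only [hup _ _ s hs]; ring, integral_const_mul, ← radPot, hrad]
  refine ⟨_, _, ⟨H₁, H₂, fun x => ?_, fun x => ?_⟩, fun h0 => ?_, ?_⟩
  · rw [J₁.lap_eq, Complex.conj_ofReal]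
    norm_cast
    rcases (norm_nonneg x).eq_or_lt with h | h
    · rw [← h]
      simp only [Function.update_self, Real.sq_sqrt hω.le]
      field_simp
      ring
    · simp only [hup _ _ _ h, Real.sq_sqrt hω.le]
      field_simp
      ring
  · rw [J₂.lap_eq]
    have e : ∀ a b c : ℝ, -(1 / 2) * a + 2 * ω * b = c ^ 2 →
        -(1 / 2 : ℂ) * (a : ℂ) + (2 * ω : ℂ) * (b : ℂ) = (c : ℂ) ^ 2 := fun a b c h => by
      rw [← Complex.ofReal_pow, ← h]; push_cast; ring
    refine e _ _ _ ?_
    rcases (norm_nonneg x).eq_or_lt with h | h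
    · rw [← h]
      simp only [Function.update_self, Real.sq_sqrt (show 0 ≤ 4 * ω by positivity)]
      field_simp
      ring
    · simp only [hup _ _ _ h, Real.sq_sqrt (show 0 ≤ 4 * ω by positivity)]
      field_simp
      ring
  · rw [h0.1, h0.2] at hPot
    have := unitVol_pos
    have h3 : 0 < 5 * unitVol * ((1 / (3 * p)) ^ 3 * p) := by positivity
    rw [← hPot] at h3
    simp [Pot] at h3
  · rw [Sfun, Kin, Mass, hPot, J₁.integral_norm_fderiv_sq, J₂.integral_norm_fderiv_sq,
      IsRadialJet.integral_norm_sq (fun r => 1 / (3 * p) * Function.update F 0 F₀ r),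
      IsRadialJet.integral_norm_sq (fun r => 1 / (3 * p) * Function.update G 0 G₀ r),
      setIntegral_Ioi_congr_pos (slope Θ _), setIntegral_Ioi_congr_pos (slope Ξ _), hsq F F₀, hsq G G₀]
    simp only [integral_const_mul]
    generalize (∫ s in Set.Ioi 0, Θ s ^ 2 / s ^ 4) = a at *
    generalize (∫ s in Set.Ioi 0, Ξ s ^ 2 / s ^ 4) = b at *
    generalize (∫ s in Set.Ioi 0, F s ^ 2 * s ^ 4) = m at *
    generalize (∫ s in Set.Ioi 0, G s ^ 2 * s ^ 4) = n at *
    calc _ = 5 * unitVol * ((1 / (3 * p)) ^ 2 * (a + b / 2 + ω * m + 2 * ω * n) / 2 -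
          (1 / (3 * p)) ^ 3 * p) := by ring
      _ = _ := by rw [hnorm]; field_simp; ring

/-- A continuously differentiable compactly supported probability density. -/
structure IsMollifier (ρ : E5 → ℝ) : Prop where
  contDiff : ContDiff ℝ 1 ρ
  support : HasCompactSupport ρ
  nonneg : ∀ x, 0 ≤ ρ x
  integral : ∫ x, ρ x = 1

/-- Convolution with a real density. -/
noncomputable def mollify (ρ f : E5 → ℝ) : E5 → ℝ :=
  convolution ρ f (ContinuousLinearMap.lsmul ℝ ℝ) volume

theorem mollify_apply (ρ f : E5 → ℝ) (x : E5) : mollify ρ f x = ∫ t, ρ t * f (x - t) := rfl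

theorem memLp_comp_sub_left {f : E5 → ℝ} (hf : MemLp f 2) (x : E5) :
    MemLp (fun t => f (x - t)) 2 :=
  hf.comp_measurePreserving (Measure.measurePreserving_sub_left volume x)

namespace IsMollifier

variable {ρ : E5 → ℝ}

theorem continuous (H : IsMollifier ρ) : Continuous ρ := H.contDiff.continuous

theorem integrable (H : IsMollifier ρ) : Integrable ρ :=
  H.continuous.integrable_of_hasCompactSupport H.support

theorem exists_bound (H : IsMollifier ρ) : ∃ B, ∀ x, ρ x ≤ B := by
  obtain ⟨B, hB⟩ := H.support.exists_bound_of_continuous H.continuous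
  exact ⟨B, fun x => (Real.le_norm_self _).trans (hB x)⟩

theorem integrable_mul (H : IsMollifier ρ) {f : E5 → ℝ} (hf : MemLp f 2) :
    Integrable fun t => ρ t * f t :=
  (H.continuous.memLp_of_hasCompactSupport (p := 2) (μ := volume) H.support).integrable_mul hf

theorem integrable_mul_of_integrable (H : IsMollifier ρ) {f : E5 → ℝ} (hf : Integrable f) :
    Integrable fun t => ρ t * f t := by
  obtain ⟨B, hB⟩ := H.exists_bound
  refine hf.bdd_mul (c := B) H.continuous.aestronglyMeasurable (ae_of_all _ fun x => ?_)
  rw [Real.norm_of_nonneg (H.nonneg x)]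
  exact hB x

theorem sq_integral_le (H : IsMollifier ρ) {f : E5 → ℝ} (hf : MemLp f 2) :
    (∫ t, ρ t * f t) ^ 2 ≤ ∫ t, ρ t * f t ^ 2 := by
  set m := ∫ t, ρ t * f t with hm
  have i1 := H.integrable_mul hf
  have i2 := H.integrable_mul_of_integrable hf.integrable_sq
  have h0 : 0 ≤ ∫ t, ρ t * (f t - m) ^ 2 :=
    integral_nonneg fun t => mul_nonneg (H.nonneg t) (sq_nonneg _)
  have e : ∫ t, ρ t * (f t - m) ^ 2 = (∫ t, ρ t * f t ^ 2) - 2 * m * m + m ^ 2 * 1 := by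
    have i3 : Integrable fun t => 2 * m * (ρ t * f t) := i1.const_mul (2 * m)
    have i4 : Integrable fun t => m ^ 2 * ρ t := H.integrable.const_mul (m ^ 2)
    have i5 : Integrable fun t => ρ t * f t ^ 2 - 2 * m * (ρ t * f t) := i2.sub i3
    have e1 : ∫ t, 2 * m * (ρ t * f t) = 2 * m * m := integral_const_mul _ _
    have e2 : ∫ t, m ^ 2 * ρ t = m ^ 2 * 1 := by rw [integral_const_mul, H.integral]
    rw [← e1, ← e2, ← integral_sub i2 i3, ← integral_add i5 i4]
    congr 1; ext t; ring
  nlinarith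

theorem sq_mollify_le (H : IsMollifier ρ) {f : E5 → ℝ} (hf : MemLp f 2) (x : E5) :
    mollify ρ f x ^ 2 ≤ mollify ρ (fun y => f y ^ 2) x :=
  H.sq_integral_le (memLp_comp_sub_left hf x)

theorem integrable_mollify (H : IsMollifier ρ) {f : E5 → ℝ} (hf : Integrable f) :
    Integrable (mollify ρ f) :=
  H.integrable.integrable_convolution (ContinuousLinearMap.lsmul ℝ ℝ) hf

theorem integral_mollify (H : IsMollifier ρ) {f : E5 → ℝ} (hf : Integrable f) :
    ∫ x, mollify ρ f x = ∫ x, f x := by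
  have := integral_convolution (μ := volume) (ν := volume) (ContinuousLinearMap.lsmul ℝ ℝ)
    H.integrable hf
  simpa [H.integral, mollify] using this

theorem exists_mollify_le (H : IsMollifier ρ) {f : E5 → ℝ} (hf : Integrable f) (h0 : ∀ x, 0 ≤ f x) :
    ∃ B, ∀ x, mollify ρ f x ≤ B := by
  obtain ⟨B, hB⟩ := H.exists_bound
  refine ⟨∫ t, B * f t, fun x => ?_⟩
  rw [mollify_apply, ← integral_sub_left_eq_self (fun t => B * f t) volume x]
  have h1 : Integrable fun t => f (x - t) := hf.comp_sub_left x
  exact integral_mono (H.integrable_mul_of_integrable h1) (h1.const_mul B)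
    fun t => mul_le_mul_of_nonneg_right (hB t) (h0 _)

theorem mollify_nonneg (H : IsMollifier ρ) {f : E5 → ℝ} (h0 : ∀ x, 0 ≤ f x) (x : E5) :
    0 ≤ mollify ρ f x := integral_nonneg fun t => mul_nonneg (H.nonneg t) (h0 _)

theorem hasFDerivAt_mollify (H : IsMollifier ρ) {f : E5 → ℝ} (hf : Continuous f) (x : E5) :
    HasFDerivAt (mollify ρ f) (convolution (fderiv ℝ ρ) f
      (ContinuousLinearMap.precompL E5 (ContinuousLinearMap.lsmul ℝ ℝ)) volume x) x :=
  H.support.hasFDerivAt_convolution_left _ H.contDiff hf.locallyIntegrable x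

theorem fderiv_mollify_apply (H : IsMollifier ρ) {f : E5 → ℝ} (hd : Differentiable ℝ f)
    (hg : MemLp (fun x => ‖fderiv ℝ f x‖) 2) (x h : E5) :
    fderiv ℝ (mollify ρ f) x h = ∫ t, ρ t * fderiv ℝ f (x - t) h := by
  have hcs : HasCompactSupport (fderiv ℝ ρ) := H.support.fderiv ℝ
  have hcc : Continuous (fderiv ℝ ρ) := H.contDiff.continuous_fderiv one_ne_zero
  have hex := hcs.convolutionExists_left
    (ContinuousLinearMap.precompL E5 (ContinuousLinearMap.lsmul ℝ ℝ)) hcc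
    (hd.continuous.locallyIntegrable (μ := (volume : Measure E5))) x
  have hcx : Continuous fun t => f (x - t) := hd.continuous.comp (continuous_const.sub continuous_id)
  have hfd : ∀ t, HasFDerivAt (fun t => f (x - t)) (-fderiv ℝ f (x - t)) t := fun t => by
    have h1 : HasFDerivAt (fun t : E5 => x - t) (-ContinuousLinearMap.id ℝ E5) t :=
      (hasFDerivAt_id t).const_sub x
    refine ((hd (x - t)).hasFDerivAt.comp t h1).congr_fderiv ?_
    ext; simp
  have hm : MemLp (fun t => fderiv ℝ f t h) 2 := by
    refine hg.of_le_mul (c := ‖h‖)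
      ((measurable_fderiv_apply_const ℝ f h).aestronglyMeasurable) (ae_of_all _ fun t => ?_)
    rw [norm_norm, mul_comm]
    exact (fderiv ℝ f t).le_opNorm h
  have hibp := integral_mul_fderiv_eq_neg_fderiv_mul_of_integrable (μ := (volume : Measure E5))
    (f := fun t => f (x - t)) (g := ρ) (v := h) ?_ ?_ ?_ (fun t _ => (hfd t).differentiableAt)
    (fun t _ => (H.contDiff.differentiable one_ne_zero) t)
  · rw [(H.hasFDerivAt_mollify hd.continuous x).fderiv, convolution_def,
      ContinuousLinearMap.integral_apply hex]
    simp only [ContinuousLinearMap.precompL_apply, ContinuousLinearMap.lsmul_apply, smul_eq_mul]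
    have e1 : ∀ t, fderiv ℝ ρ t h * f (x - t) = f (x - t) * fderiv ℝ ρ t h := fun t => mul_comm _ _
    simp only [e1, hibp, (hfd _).fderiv]
    rw [← integral_neg]
    congr 1; ext t
    simp [mul_comm]
  · simp only [(hfd _).fderiv]
    refine (H.integrable_mul (memLp_comp_sub_left hm x)).neg.congr (ae_of_all _ fun t => ?_)
    simp [mul_comm]
  · refine (hcx.mul (hcc.clm_apply continuous_const)).integrable_of_hasCompactSupport ?_
    exact (hcs.comp_left (g := fun L : E5 →L[ℝ] ℝ => L h) (by simp)).mul_left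
  · exact (hcx.mul H.continuous).integrable_of_hasCompactSupport H.support.mul_left

theorem norm_fderiv_mollify_le (H : IsMollifier ρ) {f : E5 → ℝ} (hd : Differentiable ℝ f)
    (hg : MemLp (fun x => ‖fderiv ℝ f x‖) 2) (x : E5) :
    ‖fderiv ℝ (mollify ρ f) x‖ ≤ mollify ρ (fun y => ‖fderiv ℝ f y‖) x := by
  refine ContinuousLinearMap.opNorm_le_bound _ (H.mollify_nonneg (fun _ => norm_nonneg _) x)
    fun h => ?_
  rw [H.fderiv_mollify_apply hd hg, mollify_apply, ← integral_mul_const]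
  refine norm_integral_le_of_norm_le ((H.integrable_mul (memLp_comp_sub_left hg x)).mul_const _)
    (ae_of_all _ fun t => ?_)
  rw [norm_mul, Real.norm_of_nonneg (H.nonneg t), mul_assoc]
  exact mul_le_mul_of_nonneg_left (ContinuousLinearMap.le_opNorm _ _) (H.nonneg t)

end IsMollifier

/-- Nonnegative differentiable functions with square integrable value and gradient. -/
structure FiniteEnergy (f : E5 → ℝ) : Prop where
  nonneg : ∀ x, 0 ≤ f x
  diff : Differentiable ℝ f
  sq : MemLp f 2
  grad : MemLp (fun x => ‖fderiv ℝ f x‖) 2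

namespace FiniteEnergy

variable {f ρ : E5 → ℝ}

theorem sq_norm_fderiv_mollify_le (hf : FiniteEnergy f) (H : IsMollifier ρ) (x : E5) :
    ‖fderiv ℝ (mollify ρ f) x‖ ^ 2 ≤ mollify ρ (fun y => ‖fderiv ℝ f y‖ ^ 2) x :=
  (pow_le_pow_left₀ (norm_nonneg _) (H.norm_fderiv_mollify_le hf.diff hf.grad x) 2).trans
    (H.sq_mollify_le hf.grad x)

theorem differentiable_mollify (hf : FiniteEnergy f) (H : IsMollifier ρ) :
    Differentiable ℝ (mollify ρ f) :=
  fun x => (H.hasFDerivAt_mollify hf.diff.continuous x).differentiableAt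

theorem integrable_sq_mollify (hf : FiniteEnergy f) (H : IsMollifier ρ) :
    Integrable fun x => mollify ρ f x ^ 2 := by
  refine (H.integrable_mollify hf.sq.integrable_sq).mono'
    ((hf.differentiable_mollify H).continuous.pow 2).aestronglyMeasurable (ae_of_all _ fun x => ?_)
  rw [Real.norm_of_nonneg (sq_nonneg _)]
  exact H.sq_mollify_le hf.sq x

theorem integrable_sq_fderiv_mollify (hf : FiniteEnergy f) (H : IsMollifier ρ) :
    Integrable fun x => ‖fderiv ℝ (mollify ρ f) x‖ ^ 2 := by
  refine (H.integrable_mollify hf.grad.integrable_sq).mono'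
    ((measurable_fderiv ℝ (mollify ρ f)).norm.pow_const 2).aestronglyMeasurable
    (ae_of_all _ fun x => ?_)
  rw [Real.norm_of_nonneg (sq_nonneg _)]
  exact hf.sq_norm_fderiv_mollify_le H x

theorem integral_sq_mollify_le (hf : FiniteEnergy f) (H : IsMollifier ρ) :
    ∫ x, mollify ρ f x ^ 2 ≤ ∫ x, f x ^ 2 := by
  rw [← H.integral_mollify hf.sq.integrable_sq]
  exact integral_mono (hf.integrable_sq_mollify H) (H.integrable_mollify hf.sq.integrable_sq)
    (H.sq_mollify_le hf.sq)

theorem integral_sq_fderiv_mollify_le (hf : FiniteEnergy f) (H : IsMollifier ρ) :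
    ∫ x, ‖fderiv ℝ (mollify ρ f) x‖ ^ 2 ≤ ∫ x, ‖fderiv ℝ f x‖ ^ 2 := by
  rw [← H.integral_mollify hf.grad.integrable_sq]
  exact integral_mono (hf.integrable_sq_fderiv_mollify H)
    (H.integrable_mollify hf.grad.integrable_sq) (hf.sq_norm_fderiv_mollify_le H)

theorem niceFn_mollify (hf : FiniteEnergy f) (H : IsMollifier ρ) : NiceFn (mollify ρ f) where
  nonneg := H.mollify_nonneg hf.nonneg
  diff := hf.differentiable_mollify H
  lip := by
    obtain ⟨B, hB⟩ := H.exists_mollify_le hf.grad.integrable_sq fun x => sq_nonneg _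
    refine ⟨Real.toNNReal √B, lipschitzWith_of_nnnorm_fderiv_le (hf.differentiable_mollify H)
      fun x => ?_⟩
    rw [← NNReal.coe_le_coe, coe_nnnorm,
      Real.coe_toNNReal _ (Real.sqrt_nonneg B)]
    exact Real.le_sqrt_of_sq_le ((hf.sq_norm_fderiv_mollify_le H x).trans (hB x))
  sq := hf.integrable_sq_mollify H
  bdd := by
    obtain ⟨B, hB⟩ := H.exists_mollify_le hf.sq.integrable_sq fun x => sq_nonneg _
    exact ⟨√B, fun x => Real.le_sqrt_of_sq_le ((H.sq_mollify_le hf.sq x).trans (hB x))⟩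

end FiniteEnergy

theorem admFn_rearr {u : E5 → ℝ} (hu : NiceFn u) (hg : Integrable fun x => ‖fderiv ℝ u x‖ ^ 2) :
    AdmFn (rearr u) ((∫ x, ‖fderiv ℝ u x‖ ^ 2) / (5 * unitVol)) ((∫ x, u x ^ 2) / (5 * unitVol)) where
  nonneg s _ := rearr_nonneg s
  anti := rearr_antitoneOn hu
  energy := energyLE_rearr hu hg
  sq := integrableOn_rearr_sq hu
  mass := (integral_rearr_sq hu).le

/-- The quadratic part of the action for real pairs. -/
noncomputable def realQuad (ω : ℝ) (f g : E5 → ℝ) : ℝ :=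
  (∫ x, ‖fderiv ℝ f x‖ ^ 2) + (∫ x, ‖fderiv ℝ g x‖ ^ 2) / 2 + ω * (∫ x, f x ^ 2) +
    2 * ω * ∫ x, g x ^ 2

theorem NiceFn.lintegral_mul_sq_le {ω N b : ℝ} {u v : E5 → ℝ} (hu : NiceFn u) (hv : NiceFn v)
    (hgu : Integrable fun x => ‖fderiv ℝ u x‖ ^ 2) (hgv : Integrable fun x => ‖fderiv ℝ v x‖ ^ 2)
    (hN : realQuad ω u v ≤ 5 * unitVol * N) (hb : ∀ f g, AdmPair ω f g N → radPot f g ≤ b) :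
    ∫⁻ x, ENNReal.ofReal (v x * u x ^ 2) ≤ ENNReal.ofReal (5 * unitVol * b) := by
  have hβ := unitVol_pos
  have hadm : AdmPair ω (rearr u) (rearr v) N := by
    refine ⟨_, _, _, _, admFn_rearr hu hgu, admFn_rearr hv hgv, ?_⟩
    calc _ = realQuad ω u v / (5 * unitVol) := by rw [realQuad]; ring
      _ ≤ N := by rw [div_le_iff₀ (by positivity)]; linarith
  have hmeas : AEMeasurable (fun s => ENNReal.ofReal (rearr v s * rearr u s ^ 2))
      (volume.restrict (Set.Ioi 0)) :=
    ((aemeasurable_rearr_restrict hv).mul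
      ((aemeasurable_rearr_restrict hu).pow_const 2)).ennreal_ofReal
  calc ∫⁻ x, ENNReal.ofReal (v x * u x ^ 2)
      ≤ ∫⁻ s, ENNReal.ofReal (rearr v s * rearr u s ^ 2) ∂radMeasure := lintegral_mul_sq_le_rearr hu hv
    _ = ∫⁻ s in Set.Ioi 0,
        ENNReal.ofReal (5 * unitVol * (rearr v s * rearr u s ^ 2 * s ^ 4)) := by
      rw [lintegral_radMeasure hmeas]
      refine setLIntegral_congr_fun measurableSet_Ioi fun s hs => ?_
      rw [← ENNReal.ofReal_mul (by positivity)]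
      congr 1; ring
    _ = ENNReal.ofReal (∫ s in Set.Ioi 0, 5 * unitVol * (rearr v s * rearr u s ^ 2 * s ^ 4)) := by
      rw [ofReal_integral_eq_lintegral_ofReal (hadm.integrableOn_radPot.const_mul _)
        (ae_of_all _ fun s => ?_)]
      have := rearr_nonneg (u := v) s
      change 0 ≤ 5 * unitVol * (rearr v s * rearr u s ^ 2 * s ^ 4)
      positivity
    _ ≤ _ := by
      rw [integral_const_mul]
      exact ENNReal.ofReal_le_ofReal (mul_le_mul_of_nonneg_left (hb _ _ hadm) (by positivity))

theorem lintegral_ofReal_le_of_tendsto {F : ℕ → E5 → ℝ} {f : E5 → ℝ} {B : ℝ≥0∞}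
    (hF : ∀ n, Continuous (F n)) (hlim : ∀ x, Tendsto (fun n => F n x) atTop (𝓝 (f x)))
    (hB : ∀ n, ∫⁻ x, ENNReal.ofReal (F n x) ≤ B) : ∫⁻ x, ENNReal.ofReal (f x) ≤ B := by
  calc ∫⁻ x, ENNReal.ofReal (f x) = ∫⁻ x, liminf (fun n => ENNReal.ofReal (F n x)) atTop := by
        congr 1; ext x
        exact ((ENNReal.continuous_ofReal.tendsto _).comp (hlim x)).liminf_eq.symm
    _ ≤ liminf (fun n => ∫⁻ x, ENNReal.ofReal (F n x)) atTop :=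
        lintegral_liminf_le fun n => (hF n).measurable.ennreal_ofReal
    _ ≤ B := by
        refine liminf_le_of_le ?_ fun b hb => ?_
        · isBoundedDefault
        · obtain ⟨n, hn⟩ := hb.exists
          exact hn.trans (hB n)

theorem exists_mollifier_seq : ∃ ρ : ℕ → E5 → ℝ, (∀ n, IsMollifier (ρ n)) ∧
    ∀ f : E5 → ℝ, Continuous f → ∀ x, Tendsto (fun n => mollify (ρ n) f x) atTop (𝓝 (f x)) := by
  let B : ℕ → ContDiffBump (0 : E5) := fun n =>
    ⟨1 / (2 * ((n : ℝ) + 1)), 1 / ((n : ℝ) + 1), by positivity, by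
      have hn : (0 : ℝ) ≤ n := n.cast_nonneg
      apply one_div_lt_one_div_of_lt <;> linarith⟩
  refine ⟨fun n => (B n).normed volume, fun n => ⟨(B n).contDiff_normed (n := 1),
    (B n).hasCompactSupport_normed, (B n).nonneg_normed, (B n).integral_normed⟩, fun f hf x => ?_⟩
  exact ContDiffBump.convolution_tendsto_right_of_continuous (φ := B)
    tendsto_one_div_add_atTop_nhds_zero_nat hf x

theorem FiniteEnergy.lintegral_mul_sq_le {ω N b : ℝ} (hω : 0 ≤ ω) {u v : E5 → ℝ}
    (hu : FiniteEnergy u) (hv : FiniteEnergy v)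
    (hN : realQuad ω u v ≤ 5 * unitVol * N) (hb : ∀ f g, AdmPair ω f g N → radPot f g ≤ b) :
    ∫⁻ x, ENNReal.ofReal (v x * u x ^ 2) ≤ ENNReal.ofReal (5 * unitVol * b) := by
  obtain ⟨ρ, hρ, hlim⟩ := exists_mollifier_seq
  refine lintegral_ofReal_le_of_tendsto
    (F := fun n x => mollify (ρ n) v x * mollify (ρ n) u x ^ 2) (fun n => ?_) (fun x => ?_) fun n => ?_
  · exact (hv.differentiable_mollify (hρ n)).continuous.mul
      ((hu.differentiable_mollify (hρ n)).continuous.pow 2)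
  · exact (hlim v hv.diff.continuous x).mul ((hlim u hu.diff.continuous x).pow 2)
  · refine (hu.niceFn_mollify (hρ n)).lintegral_mul_sq_le (hv.niceFn_mollify (hρ n))
      (hu.integrable_sq_fderiv_mollify (hρ n)) (hv.integrable_sq_fderiv_mollify (hρ n))
      (le_trans ?_ hN) hb
    have h1 := hu.integral_sq_mollify_le (hρ n)
    have h2 := hv.integral_sq_mollify_le (hρ n)
    have h3 := hu.integral_sq_fderiv_mollify_le (hρ n)
    have h4 := hv.integral_sq_fderiv_mollify_le (hρ n)
    unfold realQuad
    gcongr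

/-- A differentiable approximation from below of the modulus. -/
noncomputable def smoothAbs (δ : ℝ) (u : E5 → ℂ) (x : E5) : ℝ := √(‖u x‖ ^ 2 + δ ^ 2) - δ

theorem smoothAbs_nonneg {δ : ℝ} (u : E5 → ℂ) (x : E5) : 0 ≤ smoothAbs δ u x :=
  sub_nonneg.2 (Real.le_sqrt_of_sq_le (by nlinarith [sq_nonneg ‖u x‖]))

theorem smoothAbs_le {δ : ℝ} (hδ : 0 ≤ δ) (u : E5 → ℂ) (x : E5) : smoothAbs δ u x ≤ ‖u x‖ := by
  have hn := norm_nonneg (u x)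
  rw [smoothAbs, sub_le_iff_le_add, Real.sqrt_le_left (by positivity)]
  nlinarith

theorem hasFDerivAt_smoothAbs {δ : ℝ} (hδ : 0 < δ) {u : E5 → ℂ} (hu : Differentiable ℝ u) (x : E5) :
    HasFDerivAt (smoothAbs δ u) ((1 / (2 * √(‖u x‖ ^ 2 + δ ^ 2))) •
      (2 • (innerSL ℝ (u x)).comp (fderiv ℝ u x))) x :=
  (((hu x).hasFDerivAt.norm_sq.add_const (δ ^ 2)).sqrt (by positivity)).sub_const δ

theorem norm_fderiv_smoothAbs_le {δ : ℝ} (hδ : 0 < δ) {u : E5 → ℂ} (hu : Differentiable ℝ u)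
    (x : E5) : ‖fderiv ℝ (smoothAbs δ u) x‖ ≤ ‖fderiv ℝ u x‖ := by
  have hs : 0 < √(‖u x‖ ^ 2 + δ ^ 2) := Real.sqrt_pos.2 (by positivity)
  have h1 : ‖u x‖ ≤ √(‖u x‖ ^ 2 + δ ^ 2) := Real.le_sqrt_of_sq_le (by nlinarith)
  rw [(hasFDerivAt_smoothAbs hδ hu x).fderiv, ← Nat.cast_smul_eq_nsmul ℝ, smul_smul, norm_smul,
    Real.norm_of_nonneg (by positivity)]
  calc _ ≤ 1 / (2 * √(‖u x‖ ^ 2 + δ ^ 2)) * ((2 : ℕ) : ℝ) * (‖u x‖ * ‖fderiv ℝ u x‖) := by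
        gcongr
        exact (ContinuousLinearMap.opNorm_comp_le _ _).trans_eq (by rw [innerSL_apply_norm])
    _ = (‖u x‖ / √(‖u x‖ ^ 2 + δ ^ 2)) * ‖fderiv ℝ u x‖ := by push_cast; field_simp
    _ ≤ 1 * ‖fderiv ℝ u x‖ := by gcongr; exact (div_le_one hs).2 h1
    _ = _ := one_mul _

theorem finiteEnergy_smoothAbs {δ : ℝ} (hδ : 0 < δ) {u : E5 → ℂ} (hu : InH1 u) :
    FiniteEnergy (smoothAbs δ u) := by
  have hd : Differentiable ℝ (smoothAbs δ u) := fun x =>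
    (hasFDerivAt_smoothAbs hδ hu.2.1 x).differentiableAt
  refine ⟨smoothAbs_nonneg u, hd, ?_, ?_⟩
  · refine hu.1.of_le hd.continuous.aestronglyMeasurable (ae_of_all _ fun x => ?_)
    rw [Real.norm_of_nonneg (smoothAbs_nonneg u x)]
    exact smoothAbs_le hδ.le u x
  · refine hu.2.2.of_le (measurable_fderiv ℝ _).norm.aestronglyMeasurable (ae_of_all _ fun x => ?_)
    rw [norm_norm]
    exact norm_fderiv_smoothAbs_le hδ hu.2.1 x

theorem integral_sq_smoothAbs_le {δ : ℝ} (hδ : 0 < δ) {u : E5 → ℂ} (hu : InH1 u) :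
    ∫ x, smoothAbs δ u x ^ 2 ≤ ∫ x, ‖u x‖ ^ 2 :=
  integral_mono (finiteEnergy_smoothAbs hδ hu).sq.integrable_sq
    ((memLp_two_iff_integrable_sq_norm hu.1.1).1 hu.1)
    fun x => pow_le_pow_left₀ (smoothAbs_nonneg u x) (smoothAbs_le hδ.le u x) 2

theorem integral_sq_fderiv_smoothAbs_le {δ : ℝ} (hδ : 0 < δ) {u : E5 → ℂ} (hu : InH1 u) :
    ∫ x, ‖fderiv ℝ (smoothAbs δ u) x‖ ^ 2 ≤ ∫ x, ‖fderiv ℝ u x‖ ^ 2 :=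
  integral_mono (finiteEnergy_smoothAbs hδ hu).grad.integrable_sq
    ((memLp_two_iff_integrable_sq_norm hu.2.2.1).1 hu.2.2)
    fun x => pow_le_pow_left₀ (norm_nonneg _) (norm_fderiv_smoothAbs_le hδ hu.2.1 x) 2

theorem tendsto_smoothAbs (u : E5 → ℂ) (x : E5) :
    Tendsto (fun n : ℕ => smoothAbs (1 / ((n : ℝ) + 1)) u x) atTop (𝓝 ‖u x‖) := by
  have hc : Continuous fun δ : ℝ => smoothAbs δ u x := by unfold smoothAbs; fun_prop
  have := (hc.tendsto 0).comp (tendsto_one_div_add_atTop_nhds_zero_nat (𝕜 := ℝ))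
  simpa [smoothAbs, Function.comp_def] using this

theorem lintegral_norm_mul_sq_le {ω N b : ℝ} (hω : 0 ≤ ω) {u v : E5 → ℂ} (hu : InH1 u) (hv : InH1 v)
    (hN : Kin u v + ω * Mass u v ≤ 5 * unitVol * N)
    (hb : ∀ f g, AdmPair ω f g N → radPot f g ≤ b) :
    ∫⁻ x, ENNReal.ofReal (‖v x‖ * ‖u x‖ ^ 2) ≤ ENNReal.ofReal (5 * unitVol * b) := by
  have hδ : ∀ n : ℕ, 0 < 1 / ((n : ℝ) + 1) := fun n => by positivity
  refine lintegral_ofReal_le_of_tendsto (F := fun n x => smoothAbs (1 / ((n : ℝ) + 1)) v x *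
    smoothAbs (1 / ((n : ℝ) + 1)) u x ^ 2) (fun n => ?_) (fun x => ?_) fun n => ?_
  · exact (finiteEnergy_smoothAbs (hδ n) hv).diff.continuous.mul
      ((finiteEnergy_smoothAbs (hδ n) hu).diff.continuous.pow 2)
  · exact (tendsto_smoothAbs v x).mul ((tendsto_smoothAbs u x).pow 2)
  · refine (finiteEnergy_smoothAbs (hδ n) hu).lintegral_mul_sq_le hω
      (finiteEnergy_smoothAbs (hδ n) hv) (le_trans ?_ hN) hb
    have h1 := integral_sq_smoothAbs_le (hδ n) hu
    have h2 := integral_sq_smoothAbs_le (hδ n) hv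
    have h3 := integral_sq_fderiv_smoothAbs_le (hδ n) hu
    have h4 := integral_sq_fderiv_smoothAbs_le (hδ n) hv
    calc realQuad ω _ _ ≤ (∫ x, ‖fderiv ℝ u x‖ ^ 2) + (∫ x, ‖fderiv ℝ v x‖ ^ 2) / 2 +
          ω * (∫ x, ‖u x‖ ^ 2) + 2 * ω * ∫ x, ‖v x‖ ^ 2 := by unfold realQuad; gcongr
      _ = _ := by rw [Kin, Mass]; ring

theorem pot_le {ω N b : ℝ} (hω : 0 ≤ ω) (hb0 : 0 ≤ b) {u v : E5 → ℂ} (hu : InH1 u) (hv : InH1 v)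
    (hN : Kin u v + ω * Mass u v ≤ 5 * unitVol * N)
    (hb : ∀ f g, AdmPair ω f g N → radPot f g ≤ b) : Pot u v ≤ 5 * unitVol * b := by
  have hβ := unitVol_pos
  by_cases hi : Integrable fun x : E5 => ((starRingEnd ℂ) (v x) * u x ^ 2).re
  · have h1 := (ofReal_integral_le_lintegral hi).trans
      ((lintegral_mono fun x => ENNReal.ofReal_le_ofReal ?_).trans
        (lintegral_norm_mul_sq_le hω hu hv hN hb))
    · exact (ENNReal.ofReal_le_ofReal_iff (by positivity)).1 h1
    · refine (Complex.re_le_norm _).trans_eq ?_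
      rw [norm_mul, norm_pow, RCLike.norm_conj]
  · rw [Pot, integral_undef hi]
    positivity

theorem integral_comp_smul_E5 (f : E5 → ℝ) {t : ℝ} (ht : 0 < t) :
    ∫ x, f (t • x) = (t ^ 5)⁻¹ * ∫ x, f x := by
  rw [Measure.integral_comp_smul, finrank_euclideanSpace, Fintype.card_fin, smul_eq_mul,
    abs_of_pos (by positivity)]

theorem norm_fderiv_comp_smul_sq (u : E5 → ℂ) (t : ℝ) (x : E5) :
    ‖fderiv ℝ (fun y => u (t • y)) x‖ ^ 2 = t ^ 2 * ‖fderiv ℝ u (t • x)‖ ^ 2 := by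
  rw [fderiv_comp_smul, norm_smul, mul_pow, Real.norm_eq_abs, sq_abs]

theorem InH1.comp_smul {u : E5 → ℂ} (hu : InH1 u) {t : ℝ} (ht : 0 < t) :
    InH1 fun x => u (t • x) := by
  have hd : Differentiable ℝ fun x : E5 => u (t • x) :=
    hu.2.1.comp (differentiable_id.const_smul t)
  refine ⟨?_, hd, ?_⟩
  · rw [memLp_two_iff_integrable_sq_norm hd.continuous.aestronglyMeasurable]
    exact ((memLp_two_iff_integrable_sq_norm hu.1.1).1 hu.1).comp_smul ht.ne'
  · rw [memLp_two_iff_integrable_sq_norm (measurable_fderiv ℝ _).aestronglyMeasurable]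
    simp only [norm_fderiv_comp_smul_sq]
    exact (((memLp_two_iff_integrable_sq_norm hu.2.2.1).1 hu.2.2).comp_smul ht.ne').const_mul _

theorem kin_comp_smul (u v : E5 → ℂ) {t : ℝ} (ht : 0 < t) :
    Kin (fun x => u (t • x)) (fun x => v (t • x)) = (t ^ 5)⁻¹ * (t ^ 2 * Kin u v) := by
  simp only [Kin, norm_fderiv_comp_smul_sq, integral_const_mul]
  rw [integral_comp_smul_E5 (fun x => ‖fderiv ℝ u x‖ ^ 2) ht,
    integral_comp_smul_E5 (fun x => ‖fderiv ℝ v x‖ ^ 2) ht]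
  ring

theorem mass_comp_smul (u v : E5 → ℂ) {t : ℝ} (ht : 0 < t) :
    Mass (fun x => u (t • x)) (fun x => v (t • x)) = (t ^ 5)⁻¹ * Mass u v := by
  rw [Mass, integral_comp_smul_E5 (fun x => ‖u x‖ ^ 2) ht,
    integral_comp_smul_E5 (fun x => ‖v x‖ ^ 2) ht, Mass]
  ring

theorem pot_comp_smul (u v : E5 → ℂ) {t : ℝ} (ht : 0 < t) :
    Pot (fun x => u (t • x)) (fun x => v (t • x)) = (t ^ 5)⁻¹ * Pot u v :=
  integral_comp_smul_E5 (fun x => ((starRingEnd ℂ) (v x) * u x ^ 2).re) ht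

theorem mass_pos_of_pot_pos {u v : E5 → ℂ} (hu : InH1 u) (hP : 0 < Pot u v) : 0 < Mass u v := by
  have h1 : 0 ≤ ∫ x, ‖u x‖ ^ 2 := integral_nonneg fun x => sq_nonneg _
  have h2 : 0 ≤ ∫ x, ‖v x‖ ^ 2 := integral_nonneg fun x => sq_nonneg _
  by_contra hM
  rw [Mass] at hM
  have h0 : ∫ x, ‖u x‖ ^ 2 = 0 := by linarith
  rw [integral_eq_zero_iff_of_nonneg (fun x => sq_nonneg _)
    ((memLp_two_iff_integrable_sq_norm hu.1.1).1 hu.1)] at h0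
  refine hP.ne' (integral_eq_zero_of_ae ?_)
  filter_upwards [h0] with x hx
  have : u x = 0 := by simpa using hx
  simp [this]

theorem exists_admPair_of_pot_pos {ω : ℝ} (hω : 0 < ω) {u v : E5 → ℂ} (hu : InH1 u) (hv : InH1 v)
    (hP : 0 < Pot u v) : ∃ f g N, AdmPair ω f g N ∧ 0 < radPot f g := by
  have hβ := unitVol_pos
  by_contra! h
  have := pot_le hω.le le_rfl hu hv (N := (Kin u v + ω * Mass u v) / (5 * unitVol))
    (by rw [mul_div_cancel₀ _ (by positivity)]) fun f g hfg => h f g _ hfg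
  linarith

/-- The sharp trilinear inequality optimised over dilations. -/
theorem two_mul_sq_le_mass_mul_pot {ω p : ℝ} (hω : 0 < ω) (hp : 0 < p)
    (hopt : ∀ f g N, 0 < N → AdmPair ω f g N → radPot f g ≤ p * √N ^ 3) {u v : E5 → ℂ}
    (hu : InH1 u) (hv : InH1 v) (hP : 0 < Pot u v) (hQ : Kin u v ≤ 5 / 2 * Pot u v) :
    2 * (5 * unitVol / (54 * p ^ 2)) ^ 2 ≤ ω * Mass u v * Pot u v := by
  have hβ := unitVol_pos
  have hm : 0 < ω * Mass u v := mul_pos hω (mass_pos_of_pot_pos hu hP)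
  set c := 5 * unitVol with hc
  have hc0 : 0 < c := by positivity
  set P := Pot u v with hPdef
  obtain ⟨m, hmdef⟩ : ∃ m, m = ω * Mass u v := ⟨_, rfl⟩
  rw [← hmdef] at hm ⊢
  set t := √(2 * m / P) with ht
  have ht0 : 0 < t := Real.sqrt_pos.2 (by positivity)
  have ht2 : t ^ 2 = 2 * m / P := Real.sq_sqrt (by positivity)
  set N := (t ^ 5)⁻¹ * (6 * m) / c with hN
  have hN0 : 0 < N := by positivity
  have hbound : Kin (fun x => u (t • x)) (fun x => v (t • x)) +
      ω * Mass (fun x => u (t • x)) (fun x => v (t • x)) ≤ c * N := by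
    rw [kin_comp_smul u v ht0, mass_comp_smul u v ht0, hN, mul_div_cancel₀ _ hc0.ne']
    have h1 : t ^ 2 * Kin u v ≤ 5 * m := by
      rw [ht2]
      calc 2 * m / P * Kin u v ≤ 2 * m / P * (5 / 2 * P) := by gcongr
        _ = 5 * m := by field_simp
    calc _ = (t ^ 5)⁻¹ * (t ^ 2 * Kin u v + m) := by rw [hmdef]; ring
      _ ≤ (t ^ 5)⁻¹ * (6 * m) := by gcongr; linarith
  have h1 := pot_le hω.le (by positivity) (hu.comp_smul ht0) (hv.comp_smul ht0) hbound
    fun f g hfg => hopt f g N hN0 hfg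
  rw [pot_comp_smul u v ht0] at h1
  have h2 : ((t ^ 5)⁻¹ * P) ^ 2 ≤ c ^ 2 * p ^ 2 * N ^ 3 := by
    calc ((t ^ 5)⁻¹ * P) ^ 2 ≤ (c * (p * √N ^ 3)) ^ 2 := pow_le_pow_left₀ (by positivity) h1 2
      _ = c ^ 2 * p ^ 2 * (√N ^ 2) ^ 3 := by ring
      _ = _ := by rw [Real.sq_sqrt hN0.le]
  have h3 : c * t ^ 5 * P ^ 2 ≤ 216 * p ^ 2 * m ^ 3 := by
    have e1 : c * t ^ 5 * P ^ 2 = c * t ^ 15 * ((t ^ 5)⁻¹ * P) ^ 2 := by field_simp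
    have e2 : 216 * p ^ 2 * m ^ 3 = c * t ^ 15 * (c ^ 2 * p ^ 2 * N ^ 3) := by
      rw [hN]; field_simp; norm_num
    rw [e1, e2]
    gcongr
  have h4 : c * t ≤ 54 * p ^ 2 * m := by
    have e : c * t ^ 5 * P ^ 2 = 4 * m ^ 2 * (c * t) := by
      rw [show t ^ 5 = (t ^ 2) ^ 2 * t by ring, ht2]; field_simp; norm_num
    rw [e] at h3
    have hm2 : 0 < 4 * m ^ 2 := by positivity
    refine le_of_mul_le_mul_left ?_ hm2
    linarith
  have h5 : c ^ 2 * (2 * m / P) ≤ (54 * p ^ 2 * m) ^ 2 := by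
    rw [← ht2, ← mul_pow]; exact pow_le_pow_left₀ (by positivity) h4 2
  have h6 : 2 * c ^ 2 ≤ (54 * p ^ 2) ^ 2 * (m * P) := by
    have e : c ^ 2 * (2 * m / P) = m / P * (2 * c ^ 2) := by ring
    have e' : (54 * p ^ 2 * m) ^ 2 = m / P * ((54 * p ^ 2) ^ 2 * (m * P)) := by field_simp
    rw [e, e'] at h5
    exact le_of_mul_le_mul_left h5 (by positivity)
  rw [div_pow, ← mul_div_assoc, div_le_iff₀ (by positivity)]
  linarith

/-- Key inequality: for `(u,v) ∈ ℬ_ω`, `Q(u,v) ≤ 2(S_ω(u,v) − S_ω(φ_ω,ψ_ω))`. -/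
theorem key_inequality (ω : ℝ) (hω : 0 < ω) (φ ψ : E5 → ℂ)
    (hgs : IsGroundState ω φ ψ) (u v : E5 → ℂ) (hB : InBset ω φ ψ u v) :
    Qfun u v ≤ 2 * (Sfun ω u v - Sfun ω φ ψ) := by
  obtain ⟨hu, hv, -, -, hQ⟩ := hB
  have hK : 0 ≤ Kin u v := by unfold Kin; positivity
  rw [Qfun] at hQ
  have hP : 0 < Pot u v := by linarith
  obtain ⟨p, F, Θ, G, Ξ, hp, hopt, HF, HG, h₁, h₂, hrad, hnorm⟩ :=
    exists_optimal_profile hω (exists_admPair_of_pot_pos hω hu hv hP)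
  obtain ⟨φ₀, ψ₀, hsol, hnt, hS⟩ := exists_ellSol_of_profile hω hp HF HG h₁ h₂ hrad hnorm
  have hmin := hgs.2.2 φ₀ ψ₀ hsol hnt
  have hkey := two_mul_sq_le_mass_mul_pot hω hp hopt hu hv hP (by linarith)
  have hM : 0 ≤ ω * Mass u v := (mul_pos hω (mass_pos_of_pot_pos hu hP)).le
  rw [← hS] at hkey
  have hle : 2 * Sfun ω φ₀ ψ₀ ≤ ω * Mass u v + Pot u v / 2 := by
    refine le_of_sq_le_sq ?_ (by positivity)
    nlinarith [sq_nonneg (ω * Mass u v - Pot u v / 2)]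
  have e : 2 * Sfun ω u v = Qfun u v + (ω * Mass u v + Pot u v / 2) := by
    rw [Sfun, Qfun]; ring
  linarith
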